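/- arXiv:2504.15839 — 7 statements merged into one kernel-verified Lean document; each statement's English description precedes it below -/
import Mathlib

section
/- For every integer k ≥ 2 there exists a constant C_k > 0 such that for every positive integer N, one has I_k(N) ≤ C_k·N^{2k+2}. -/
/-- `detQ (a₁,a₂,a₃,a₄) = a₁a₂ - a₃a₄`. -/
def detQ (a : ℤ × ℤ × ℤ × ℤ) : ℤ := a.1 * a.2.1 - a.2.2.1 * a.2.2.2

/-- `IkCount k N` is the number of integer solutions to
`x₁x₂ - x₃x₄ = x₅x₆ - x₇x₈ = ⋯ = x_{4k-3}x_{4k-2} - x_{4k-1}x_{4k}`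
with all `|xᵢ| ≤ N`. -/
noncomputable def IkCount (k N : ℕ) : ℕ :=
  Nat.card {x : Fin k → ℤ × ℤ × ℤ × ℤ //
    (∀ i, |(x i).1| ≤ (N : ℤ) ∧ |(x i).2.1| ≤ (N : ℤ) ∧
      |(x i).2.2.1| ≤ (N : ℤ) ∧ |(x i).2.2.2| ≤ (N : ℤ)) ∧
    ∀ i j, detQ (x i) = detQ (x j)}

/-- A set of integers in `[-M, M]` whose elements are congruent modulo `r ≤ M` has at most
`4M/r` elements. -/
theorem card_le_of_pairwise_dvd_sub {M r : ℤ} (hr : 0 < r) (hrM : r ≤ M) (s : Finset ℤ)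
    (hs : s ⊆ Finset.Icc (-M) M) (hd : ∀ x ∈ s, ∀ y ∈ s, r ∣ x - y) :
    (s.card : ℝ) ≤ 4 * M / r := by
  have hr' : (0 : ℝ) < r := by exact_mod_cast hr
  have hrM' : (r : ℝ) ≤ M := by exact_mod_cast hrM
  rcases s.eq_empty_or_nonempty with rfl | ⟨v, hv⟩
  · simp only [Finset.card_empty, Nat.cast_zero]
    have : (0 : ℝ) ≤ M := by linarith
    positivity
  have hsub : s ⊆ {x ∈ Finset.Ioc (-M - 1) M | x ≡ v [ZMOD r]} := fun x hx => by
    have h1 := Finset.mem_Icc.1 (hs hx)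
    refine Finset.mem_filter.2 ⟨Finset.mem_Ioc.2 ⟨by omega, h1.2⟩, ?_⟩
    exact Int.modEq_iff_dvd.2 (hd v hv x hx)
  have hcard := Finset.card_le_card hsub
  have h2 := Int.Ioc_filter_modEq_card (-M - 1) M hr v
  have hpos : 0 < s.card := Finset.card_pos.2 ⟨v, hv⟩
  have h3 : (s.card : ℤ) ≤ ⌊((M : ℚ) - v) / r⌋ - ⌊(((-M - 1 : ℤ) : ℚ) - v) / r⌋ := by
    rcases max_cases (⌊((M : ℚ) - v) / r⌋ - ⌊(((-M - 1 : ℤ) : ℚ) - v) / r⌋) 0 with h | h <;>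
      omega
  have hrq : (0 : ℚ) < r := by exact_mod_cast hr
  have hrMq : (r : ℚ) ≤ M := by exact_mod_cast hrM
  have hr1 : (1 : ℚ) ≤ r := by exact_mod_cast hr
  have h4 : (s.card : ℚ) ≤ 4 * M / r := by
    have h5 := Int.floor_le (((M : ℚ) - v) / r)
    have h6 := Int.lt_floor_add_one ((((-M - 1 : ℤ) : ℚ) - v) / r)
    have h7 : (s.card : ℚ) ≤ ⌊((M : ℚ) - v) / r⌋ - ⌊(((-M - 1 : ℤ) : ℚ) - v) / r⌋ := by
      exact_mod_cast h3
    have h8 : (s.card : ℚ) ≤ ((M : ℚ) - v) / r - (((-M - 1 : ℤ) : ℚ) - v) / r + 1 := by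
      linarith
    refine h8.trans ?_
    rw [← sub_div, div_add_one hrq.ne', div_le_div_iff_of_pos_right hrq]
    push_cast
    linarith
  exact_mod_cast h4

/-- The integer quadruples with entries in `[-N, N]` and `a₁a₂ - a₃a₄ = h`. -/
noncomputable def detFiber (N : ℕ) (h : ℤ) : Finset (ℤ × ℤ × ℤ × ℤ) :=
  {x ∈ Finset.Icc (-N : ℤ) N ×ˢ Finset.Icc (-N : ℤ) N ×ˢ Finset.Icc (-N : ℤ) N ×ˢ
    Finset.Icc (-N : ℤ) N | detQ x = h}

theorem mem_detFiber {N : ℕ} {h a b c e : ℤ} :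
    (a, b, c, e) ∈ detFiber N h ↔
      (|a| ≤ N ∧ |b| ≤ N ∧ |c| ≤ N ∧ |e| ≤ N) ∧ a * b - c * e = h := by
  rw [detFiber, Finset.mem_filter]
  simp only [Finset.mem_product, Finset.mem_Icc, ← abs_le, detQ]

/-- The divisors of `h` in `[1, N]`. -/
def smallDivisors (N : ℕ) (h : ℤ) : Finset ℕ := {d ∈ Finset.Icc 1 N | (d : ℤ) ∣ h}

theorem card_solutions_le {N : ℕ} {a : ℤ} (c h : ℤ) (d : ℕ) (ha : a ≠ 0) (haN : |a| ≤ N) :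
    (({e ∈ Finset.Icc (-N : ℤ) N | a.gcd c = d ∧ a ∣ h + c * e} : Finset ℤ).card : ℝ)
      ≤ 4 * N * d / |(a : ℝ)| := by
  by_cases hd : a.gcd c = d
  swap
  · simp only [hd, false_and, Finset.filter_false, Finset.card_empty, Nat.cast_zero]
    positivity
  have hd0 : 0 < a.gcd c := Int.gcd_pos_of_ne_zero_left _ ha
  obtain ⟨a', ha'⟩ : (d : ℤ) ∣ a := hd ▸ Int.gcd_dvd_left a c
  obtain ⟨c', hc'⟩ : (d : ℤ) ∣ c := hd ▸ Int.gcd_dvd_right a c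
  rw [hd] at hd0
  have hdz : (0 : ℤ) < d := by exact_mod_cast hd0
  have hdr : (0 : ℝ) < d := by exact_mod_cast hd0
  have hcop : a'.gcd c' = 1 := by
    have := hd
    rw [ha', hc', Int.gcd_mul_left, Int.natAbs_natCast] at this
    exact Nat.eq_of_mul_eq_mul_left hd0 (by simpa using this)
  have ha0 : a' ≠ 0 := by rintro rfl; simp at ha'; exact ha ha'
  have habs : |a| = d * |a'| := by rw [ha', abs_mul, Nat.abs_cast]
  have hpos : 0 < |a'| := abs_pos.2 ha0
  have key := card_le_of_pairwise_dvd_sub (M := N) (r := |a'|) hpos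
    (by nlinarith) {e ∈ Finset.Icc (-N : ℤ) N | a.gcd c = d ∧ a ∣ h + c * e}
    (Finset.filter_subset _ _) (by
      intro x hx y hy
      have hx := (Finset.mem_filter.1 hx).2.2
      have hy := (Finset.mem_filter.1 hy).2.2
      have h1 := dvd_sub hx hy
      rw [show h + c * x - (h + c * y) = d * (c' * (x - y)) by rw [hc']; ring, ha'] at h1
      exact (abs_dvd _ _).2
        (Int.dvd_of_dvd_mul_right_of_gcd_one (Int.dvd_of_mul_dvd_mul_left hdz.ne' h1) hcop))
  refine key.trans_eq ?_
  have h1 : |(a : ℝ)| = d * |(a' : ℝ)| := by exact_mod_cast habs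
  have h2 : (0 : ℝ) < |(a' : ℝ)| := by exact_mod_cast hpos
  rw [h1]
  push_cast
  field_simp

theorem card_multiples_le {M d : ℕ} (hd : 0 < d) (hdM : d ≤ M) :
    (({x ∈ Finset.Icc (-M : ℤ) M | (d : ℤ) ∣ x} : Finset ℤ).card : ℝ) ≤ 4 * M / d := by
  simpa only [Int.cast_natCast] using card_le_of_pairwise_dvd_sub (M := M) (r := d) (by exact_mod_cast hd)
    (by exact_mod_cast hdM) _ (Finset.filter_subset _ _) fun x hx y hy =>
      dvd_sub (Finset.mem_filter.1 hx).2 (Finset.mem_filter.1 hy).2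

theorem card_detFiber_dominant_gcd_le (N : ℕ) (h : ℤ) {d : ℕ} (hd : 0 < d) (hdN : d ≤ N) :
    ((({x ∈ detFiber N h | x.1 ≠ 0 ∧ |x.2.2.1| ≤ |x.1| ∧ x.1.gcd x.2.2.1 = d}) :
      Finset (ℤ × ℤ × ℤ × ℤ)).card : ℝ) ≤ 64 * N ^ 2 * (d : ℝ)⁻¹ := by
  set A : Finset ℤ := {a ∈ Finset.Icc (-N : ℤ) N | (d : ℤ) ∣ a} with hA
  set C : ℤ → Finset ℤ := fun a =>
    {c ∈ Finset.Icc (-a.natAbs : ℤ) a.natAbs | (d : ℤ) ∣ c} with hC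
  set E : ℤ → ℤ → Finset ℤ := fun a c =>
    {e ∈ Finset.Icc (-N : ℤ) N | a.gcd c = d ∧ a ∣ h + c * e} with hE
  have hsub : ({x ∈ detFiber N h | x.1 ≠ 0 ∧ |x.2.2.1| ≤ |x.1| ∧ x.1.gcd x.2.2.1 = d}) ⊆
      ({a ∈ A | a ≠ 0}).biUnion fun a => (C a).biUnion fun c =>
        (E a c).image fun e => (a, (h + c * e) / a, c, e) := by
    rintro ⟨a, b, c, e⟩ hx
    simp only [Finset.mem_filter, mem_detFiber] at hx
    obtain ⟨⟨⟨h1, h2, h3, h4⟩, h5⟩, h6, h7, h8⟩ := hx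
    have h9 : h + c * e = a * b := by linarith
    simp only [Finset.mem_biUnion, Finset.mem_image, hA, hC, hE, Finset.mem_filter]
    refine ⟨a, ⟨⟨Finset.mem_Icc.2 (abs_le.1 h1), h8 ▸ Int.gcd_dvd_left a c⟩, h6⟩, c, ⟨?_, h8 ▸ Int.gcd_dvd_right a c⟩, e,
      ⟨Finset.mem_Icc.2 (abs_le.1 h4), h8, ⟨b, h9⟩⟩, ?_⟩
    · rw [Finset.mem_Icc, ← abs_le, Int.natCast_natAbs]; exact h7
    · rw [h9, Int.mul_ediv_cancel_left _ h6]
  have hcard := (Finset.card_le_card hsub).trans (Finset.card_biUnion_le.trans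
    (Finset.sum_le_sum fun a _ => Finset.card_biUnion_le.trans
      (Finset.sum_le_sum fun c _ => Finset.card_image_le)))
  have hdr : (0 : ℝ) < d := by exact_mod_cast hd
  calc _ ≤ ((∑ a ∈ A with a ≠ 0, ∑ c ∈ C a, (E a c).card : ℕ) : ℝ) := by exact_mod_cast hcard
    _ ≤ ∑ a ∈ A with a ≠ 0, (16 * N : ℝ) := by
        push_cast
        refine Finset.sum_le_sum fun a ha => ?_
        obtain ⟨ha, ha0⟩ := Finset.mem_filter.1 ha
        obtain ⟨haN, hda⟩ := Finset.mem_filter.1 ha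
        have haN' : |a| ≤ N := abs_le.2 (Finset.mem_Icc.1 haN)
        have hda' : d ≤ a.natAbs := Nat.le_of_dvd (by omega) (Int.natCast_dvd.1 hda)
        have hcC : ((C a).card : ℝ) ≤ 4 * (a.natAbs : ℝ) / d := card_multiples_le hd hda'
        have habs : (0 : ℝ) < |(a : ℝ)| := abs_pos.2 (by exact_mod_cast ha0)
        rw [Nat.cast_natAbs, Int.cast_abs] at hcC
        calc ∑ c ∈ C a, ((E a c).card : ℝ) ≤ ∑ c ∈ C a, 4 * N * d / |(a : ℝ)| :=
              Finset.sum_le_sum fun c _ => card_solutions_le c h d ha0 haN'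
          _ = (C a).card * (4 * N * d / |(a : ℝ)|) := by simp
          _ ≤ (4 * |(a : ℝ)| / d) * (4 * N * d / |(a : ℝ)|) := by gcongr
          _ = 16 * N := by field_simp; ring
    _ = ({a ∈ A | a ≠ 0}).card * (16 * N : ℝ) := by simp
    _ ≤ (4 * N / d) * (16 * N : ℝ) := by
        gcongr
        exact (Nat.cast_le.2 (Finset.card_filter_le _ _)).trans (card_multiples_le hd hdN)
    _ = _ := by field_simp; ring

theorem card_detFiber_dominant_le (N : ℕ) (h : ℤ) :
    ((({x ∈ detFiber N h | x.1 ≠ 0 ∧ |x.2.2.1| ≤ |x.1|}) : Finset (ℤ × ℤ × ℤ × ℤ)).card : ℝ)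
      ≤ 64 * N ^ 2 * ∑ d ∈ smallDivisors N h, (d : ℝ)⁻¹ := by
  have hsub : ({x ∈ detFiber N h | x.1 ≠ 0 ∧ |x.2.2.1| ≤ |x.1|}) ⊆
      (smallDivisors N h).biUnion fun d =>
        {x ∈ detFiber N h | x.1 ≠ 0 ∧ |x.2.2.1| ≤ |x.1| ∧ x.1.gcd x.2.2.1 = d} := by
    rintro ⟨a, b, c, e⟩ hx
    obtain ⟨h1, h2, h3⟩ := Finset.mem_filter.1 hx
    refine Finset.mem_biUnion.2 ⟨a.gcd c, ?_, Finset.mem_filter.2 ⟨h1, h2, h3, rfl⟩⟩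
    rw [mem_detFiber] at h1
    simp only at h2
    refine Finset.mem_filter.2 ⟨Finset.mem_Icc.2 ⟨Int.gcd_pos_of_ne_zero_left _ h2, ?_⟩, ?_⟩
    · have := Int.gcd_le_natAbs_left c h2
      have := Int.abs_eq_natAbs a ▸ h1.1.1
      omega
    · rw [← h1.2]
      exact dvd_sub ((Int.gcd_dvd_left a c).mul_right b) ((Int.gcd_dvd_right a c).mul_right e)
  have hcard := (Finset.card_le_card hsub).trans Finset.card_biUnion_le
  rw [Finset.mul_sum]
  refine (Nat.cast_le.2 hcard).trans ?_
  push_cast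
  refine Finset.sum_le_sum fun d hd => ?_
  have := Finset.mem_Icc.1 (Finset.mem_filter.1 hd).1
  exact card_detFiber_dominant_gcd_le N h this.1 this.2

theorem card_detFiber_le {N : ℕ} (hN : 0 < N) (h : ℤ) :
    ((detFiber N h).card : ℝ) ≤ 137 * N ^ 2 * ∑ d ∈ smallDivisors N h, (d : ℝ)⁻¹ := by
  have hsub : detFiber N h ⊆
      ((Finset.Icc (-N : ℤ) N ×ˢ Finset.Icc (-N : ℤ) N).image
        fun p : ℤ × ℤ => ((0, p.1, 0, p.2) : ℤ × ℤ × ℤ × ℤ)) ∪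
      ({x ∈ detFiber N h | x.1 ≠ 0 ∧ |x.2.2.1| ≤ |x.1|} ∪
      ({x ∈ detFiber N (-h) | x.1 ≠ 0 ∧ |x.2.2.1| ≤ |x.1|}).image
        fun x => (x.2.2.1, x.2.2.2, x.1, x.2.1)) := by
    rintro ⟨a, b, c, e⟩ hx
    by_cases h0 : a = 0 ∧ c = 0
    · obtain ⟨rfl, rfl⟩ := h0
      have hx := (mem_detFiber.1 hx).1
      exact Finset.mem_union_left _ (Finset.mem_image.2
        ⟨(b, e), Finset.mem_product.2 ⟨Finset.mem_Icc.2 (abs_le.1 hx.2.1),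
          Finset.mem_Icc.2 (abs_le.1 hx.2.2.2)⟩, rfl⟩)
    refine Finset.mem_union_right _ ?_
    by_cases hac : |c| ≤ |a|
    · refine Finset.mem_union_left _ (Finset.mem_filter.2 ⟨hx, ?_, hac⟩)
      rintro rfl
      simp_all
    · refine Finset.mem_union_right _ (Finset.mem_image.2 ⟨(c, e, a, b), ?_, rfl⟩)
      simp only [Finset.mem_filter, mem_detFiber] at hx ⊢
      refine ⟨⟨⟨hx.1.2.2.1, hx.1.2.2.2, hx.1.1, hx.1.2.1⟩, by linarith⟩, ?_, by omega⟩
      rintro rfl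
      exact hac (by simp)
  have hcard := (Finset.card_le_card hsub).trans ((Finset.card_union_le _ _).trans
    (add_le_add Finset.card_image_le ((Finset.card_union_le _ _).trans
      (Nat.add_le_add_left Finset.card_image_le _))))
  have hcard' : ((detFiber N h).card : ℝ) ≤ _ := Nat.cast_le.2 hcard
  push_cast [Finset.card_product, Int.card_Icc] at hcard'
  have hS : smallDivisors N (-h) = smallDivisors N h := by
    simp only [smallDivisors, dvd_neg]
  have h1 := card_detFiber_dominant_le N h
  have h2 := card_detFiber_dominant_le N (-h)
  rw [hS] at h2
  have h3 : (1 : ℝ) ≤ ∑ d ∈ smallDivisors N h, (d : ℝ)⁻¹ := by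
    have : 1 ∈ smallDivisors N h := by
      simp [smallDivisors]
      omega
    simpa using Finset.single_le_sum (f := fun d : ℕ => (d : ℝ)⁻¹)
      (fun d _ => by positivity) this
  have hI : (((N : ℤ) + 1 - -N).toNat : ℝ) = 2 * N + 1 := by
    have : ((N : ℤ) + 1 - -N).toNat = 2 * N + 1 := by omega
    rw [this]; push_cast; ring
  rw [hI] at hcard'
  have hN' : (1 : ℝ) ≤ N := by exact_mod_cast hN
  have h4 : (9 * N ^ 2 : ℝ) ≤ 9 * N ^ 2 * ∑ d ∈ smallDivisors N h, (d : ℝ)⁻¹ :=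
    le_mul_of_one_le_right (by positivity) h3
  nlinarith

theorem IkCount_le_sum_pow {k : ℕ} (hk : 0 < k) (N : ℕ) :
    IkCount k N ≤
      ∑ h ∈ Finset.Icc (-((2 * N ^ 2 : ℕ) : ℤ)) (2 * N ^ 2 : ℕ), (detFiber N h).card ^ k := by
  have hle : ∑ h ∈ Finset.Icc (-((2 * N ^ 2 : ℕ) : ℤ)) (2 * N ^ 2 : ℕ), (detFiber N h).card ^ k
      = ∑ h ∈ Finset.Icc (-((2 * N ^ 2 : ℕ) : ℤ)) (2 * N ^ 2 : ℕ),
        (Fintype.piFinset fun _ : Fin k => detFiber N h).card := by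
    simp only [Fintype.card_piFinset_const]
  rw [hle]
  refine le_trans ?_ Finset.card_biUnion_le
  rw [IkCount, ← Nat.card_eq_finsetCard]
  refine Nat.card_le_card_of_injective (Set.inclusion (s := {x | _}) (t := {x | _}) ?_)
    (Set.inclusion_injective _)
  rintro x ⟨hx, hdet⟩
  refine Finset.mem_biUnion.2 ⟨detQ (x ⟨0, hk⟩), ?_, ?_⟩
  · obtain ⟨h1, h2, h3, h4⟩ := hx ⟨0, hk⟩
    have hmul {a b : ℤ} (ha : |a| ≤ N) (hb : |b| ≤ N) : |a * b| ≤ (N : ℤ) ^ 2 := by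
      rw [abs_mul, sq]
      exact mul_le_mul ha hb (abs_nonneg _) (by positivity)
    have h5 := abs_le.1 (hmul h1 h2)
    have h6 := abs_le.1 (hmul h3 h4)
    rw [Finset.mem_Icc, detQ]
    push_cast
    constructor <;> linarith
  · refine Fintype.mem_piFinset.2 fun i => ?_
    obtain ⟨h1, h2, h3, h4⟩ := hx i
    exact mem_detFiber.2 ⟨⟨h1, h2, h3, h4⟩, hdet _ _⟩

/-- Hölder's inequality with weights `d ^ (-1 - 1/k)`. -/
theorem sum_inv_pow_le {k : ℕ} (hk : 0 < k) (s : Finset ℕ) (hs : ∀ d ∈ s, 0 < d) :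
    (∑ d ∈ s, (d : ℝ)⁻¹) ^ k ≤
      (∑' d : ℕ, ((d : ℝ) ^ (1 + (k : ℝ)⁻¹))⁻¹) ^ (k - 1) *
        ∑ d ∈ s, ((d : ℝ) ^ (k : ℝ)⁻¹)⁻¹ := by
  have hk' : (1 : ℝ) ≤ k := by exact_mod_cast hk
  have hk0 : (k : ℝ) ≠ 0 := by positivity
  have hsum : Summable fun d : ℕ => ((d : ℝ) ^ (1 + (k : ℝ)⁻¹))⁻¹ :=
    Real.summable_nat_rpow_inv.2 (by simp; omega)
  have hH := Real.inner_le_weight_mul_Lp_of_nonneg s hk'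
    (fun d : ℕ => ((d : ℝ) ^ (1 + (k : ℝ)⁻¹))⁻¹) (fun d : ℕ => (d : ℝ) ^ (k : ℝ)⁻¹)
    (fun d => by positivity) (fun d => by positivity)
  have e1 : ∑ d ∈ s, ((d : ℝ) ^ (1 + (k : ℝ)⁻¹))⁻¹ * (d : ℝ) ^ (k : ℝ)⁻¹ =
      ∑ d ∈ s, (d : ℝ)⁻¹ := by
    refine Finset.sum_congr rfl fun d hd => ?_
    have hd' : (0 : ℝ) < d := by exact_mod_cast hs d hd
    rw [Real.rpow_add hd', Real.rpow_one]
    field_simp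
  have e2 : ∑ d ∈ s, ((d : ℝ) ^ (1 + (k : ℝ)⁻¹))⁻¹ * ((d : ℝ) ^ (k : ℝ)⁻¹) ^ (k : ℝ) =
      ∑ d ∈ s, ((d : ℝ) ^ (k : ℝ)⁻¹)⁻¹ := by
    refine Finset.sum_congr rfl fun d hd => ?_
    have hd' : (0 : ℝ) < d := by exact_mod_cast hs d hd
    rw [Real.rpow_add hd', Real.rpow_one, Real.rpow_inv_rpow hd'.le hk0]
    field_simp
  rw [e1, e2] at hH
  have hW : 0 ≤ ∑ d ∈ s, ((d : ℝ) ^ (1 + (k : ℝ)⁻¹))⁻¹ :=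
    Finset.sum_nonneg fun d _ => by positivity
  have hV : 0 ≤ ∑ d ∈ s, ((d : ℝ) ^ (k : ℝ)⁻¹)⁻¹ :=
    Finset.sum_nonneg fun d _ => by positivity
  have hexp : (1 - (k : ℝ)⁻¹) * k = (k - 1 : ℕ) := by
    rw [Nat.cast_sub hk]; field_simp; simp
  calc _ ≤ _ := pow_le_pow_left₀ (Finset.sum_nonneg fun d _ => by positivity) hH k
    _ = (∑ d ∈ s, ((d : ℝ) ^ (1 + (k : ℝ)⁻¹))⁻¹) ^ (k - 1) *
        ∑ d ∈ s, ((d : ℝ) ^ (k : ℝ)⁻¹)⁻¹ := by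
      rw [mul_pow, Real.rpow_inv_natCast_pow hV hk.ne', ← Real.rpow_mul_natCast hW, hexp,
        Real.rpow_natCast]
    _ ≤ _ := by
      gcongr
      exact hsum.sum_le_tsum s fun d _ => by positivity

theorem sum_sum_inv_pow_le {k N : ℕ} (hk : 0 < k) :
    ∑ h ∈ Finset.Icc (-((2 * N ^ 2 : ℕ) : ℤ)) (2 * N ^ 2 : ℕ),
      (∑ d ∈ smallDivisors N h, (d : ℝ)⁻¹) ^ k ≤
      8 * N ^ 2 * (∑' d : ℕ, ((d : ℝ) ^ (1 + (k : ℝ)⁻¹))⁻¹) ^ k := by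
  set W := ∑' d : ℕ, ((d : ℝ) ^ (1 + (k : ℝ)⁻¹))⁻¹
  have hW : 0 ≤ W := tsum_nonneg fun d => by positivity
  have hsum : Summable fun d : ℕ => ((d : ℝ) ^ (1 + (k : ℝ)⁻¹))⁻¹ :=
    Real.summable_nat_rpow_inv.2 (by simp; omega)
  set H := Finset.Icc (-((2 * N ^ 2 : ℕ) : ℤ)) (2 * N ^ 2 : ℕ) with hH
  calc _ ≤ ∑ h ∈ H, W ^ (k - 1) * ∑ d ∈ smallDivisors N h, ((d : ℝ) ^ (k : ℝ)⁻¹)⁻¹ :=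
        Finset.sum_le_sum fun h _ => sum_inv_pow_le hk _ fun d hd =>
          (Finset.mem_Icc.1 (Finset.mem_filter.1 hd).1).1
    _ = W ^ (k - 1) * ∑ d ∈ Finset.Icc 1 N,
          ({h ∈ H | (d : ℤ) ∣ h}).card * ((d : ℝ) ^ (k : ℝ)⁻¹)⁻¹ := by
        rw [← Finset.mul_sum, Finset.sum_comm' (t' := Finset.Icc 1 N)
          (s' := fun d => {h ∈ H | (d : ℤ) ∣ h})]
        · simp
        · intro h d
          simp only [smallDivisors, Finset.mem_filter]
          tauto
    _ ≤ W ^ (k - 1) * ∑ d ∈ Finset.Icc 1 N,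
          8 * N ^ 2 * ((d : ℝ) ^ (1 + (k : ℝ)⁻¹))⁻¹ := by
        refine mul_le_mul_of_nonneg_left (Finset.sum_le_sum fun d hd => ?_) (by positivity)
        obtain ⟨hd1, hdN⟩ := Finset.mem_Icc.1 hd
        have hd' : (0 : ℝ) < d := by exact_mod_cast hd1
        have hcard := card_multiples_le (M := 2 * N ^ 2) hd1 (by nlinarith)
        push_cast at hcard
        calc _ ≤ 4 * (2 * (N : ℝ) ^ 2) / d * ((d : ℝ) ^ (k : ℝ)⁻¹)⁻¹ := by
              gcongr
              simpa [hH] using hcard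
          _ = _ := by
              rw [Real.rpow_add hd', Real.rpow_one]
              field_simp
              ring
    _ ≤ W ^ (k - 1) * (8 * N ^ 2 * W) := by
        rw [← Finset.mul_sum]
        gcongr
        exact hsum.sum_le_tsum _ fun d _ => by positivity
    _ = 8 * N ^ 2 * W ^ k := by
        obtain ⟨m, rfl⟩ := Nat.exists_eq_succ_of_ne_zero hk.ne'
        simp only [Nat.succ_eq_add_one, Nat.add_sub_cancel, pow_succ]
        ring

theorem Ik_upper_bound (k : ℕ) (hk : 2 ≤ k) :
    ∃ C : ℝ, 0 < C ∧ ∀ N : ℕ, 0 < N →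
      (IkCount k N : ℝ) ≤ C * (N : ℝ) ^ (2 * k + 2) := by
  have hk0 : 0 < k := by omega
  set W := ∑' d : ℕ, ((d : ℝ) ^ (1 + (k : ℝ)⁻¹))⁻¹
  have hW : 0 ≤ W := tsum_nonneg fun d => by positivity
  refine ⟨137 ^ k * (8 * W ^ k) + 1, by positivity, fun N hN => ?_⟩
  calc (IkCount k N : ℝ) ≤ ∑ h ∈ Finset.Icc (-((2 * N ^ 2 : ℕ) : ℤ)) (2 * N ^ 2 : ℕ),
        ((detFiber N h).card : ℝ) ^ k := by exact_mod_cast IkCount_le_sum_pow hk0 N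
    _ ≤ ∑ h ∈ Finset.Icc (-((2 * N ^ 2 : ℕ) : ℤ)) (2 * N ^ 2 : ℕ),
        (137 * N ^ 2 * ∑ d ∈ smallDivisors N h, (d : ℝ)⁻¹) ^ k :=
      Finset.sum_le_sum fun h _ => pow_le_pow_left₀ (by positivity) (card_detFiber_le hN h) k
    _ = (137 * N ^ 2) ^ k * ∑ h ∈ Finset.Icc (-((2 * N ^ 2 : ℕ) : ℤ)) (2 * N ^ 2 : ℕ),
        (∑ d ∈ smallDivisors N h, (d : ℝ)⁻¹) ^ k := by
      rw [Finset.mul_sum]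
      exact Finset.sum_congr rfl fun h _ => mul_pow _ _ _
    _ ≤ (137 * N ^ 2) ^ k * (8 * N ^ 2 * W ^ k) := by
      gcongr
      exact sum_sum_inv_pow_le hk0
    _ = 137 ^ k * (8 * W ^ k) * (N : ℝ) ^ (2 * k + 2) := by
      rw [mul_pow, ← pow_mul]
      ring
    _ ≤ _ := by
      gcongr
      linarith
end

section
/- There exist absolute constants c, C > 0 such that for every finite non-empty set 𝒜 ⊂ ℝ with |𝒜 + 𝒜| = K·|𝒜| for some real K ≥ 1, one has c·K^{-3}·|𝒜|^{10} ≤ 𝔠₃(𝒜) ≤ C·K^{6}·|𝒜|^{10}·(log(2|𝒜|))³. -/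
open Pointwise

/-- The number of pairs `(A,B)` of `3 × 3` real matrices, all of whose entries lie in
the finite set `𝒜`, such that `A * B = B * A`. -/
noncomputable def commCount3 (A : Finset ℝ) : ℕ :=
  Nat.card {AB : Matrix (Fin 3) (Fin 3) ℝ × Matrix (Fin 3) (Fin 3) ℝ //
    (∀ i j, AB.1 i j ∈ A) ∧ (∀ i j, AB.2 i j ∈ A) ∧ AB.1 * AB.2 = AB.2 * AB.1}

/-- A second moment is controlled by weak-type bounds on the level sets, with a logarithmic loss. -/
lemma sum_sq_le_of_card_level_le {ι : Type*} (S : Finset ι) (f : ι → ℕ) (N : ℕ) (hN : 1 ≤ N) (Q : ℝ)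
    (hf : ∀ m ∈ S, f m ≤ N)
    (h : ∀ k : ℕ, 1 ≤ k → k ≤ N → ((S.filter fun m => k ≤ f m).card : ℝ) * (k : ℝ) ^ 2 ≤ Q) :
    ∑ m ∈ S, (f m : ℝ) ^ 2 ≤ 2 * Q * (1 + Real.log N) := by
  have hQ : 0 ≤ Q := le_trans (by positivity) (h 1 le_rfl hN)
  have key : ∀ m ∈ S, (f m : ℝ) ^ 2 ≤
      ∑ k ∈ Finset.Icc 1 N, if k ≤ f m then 2 * (k : ℝ) else 0 := by
    intro m hm
    rw [← Finset.sum_filter]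
    have hs : (Finset.Icc 1 N).filter (fun k => k ≤ f m) = Finset.Icc 1 (f m) := by
      ext k
      have := hf m hm
      simp only [Finset.mem_filter, Finset.mem_Icc]
      omega
    rw [hs]
    generalize f m = r
    induction r with
    | zero => simp
    | succ r ih =>
      rw [Finset.sum_Icc_succ_top (by omega)]
      push_cast
      nlinarith
  calc ∑ m ∈ S, (f m : ℝ) ^ 2
      ≤ ∑ m ∈ S, ∑ k ∈ Finset.Icc 1 N, (if k ≤ f m then 2 * (k : ℝ) else 0) :=
        Finset.sum_le_sum key
    _ = ∑ k ∈ Finset.Icc 1 N, ((S.filter fun m => k ≤ f m).card : ℝ) * (2 * k) := by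
        rw [Finset.sum_comm]
        refine Finset.sum_congr rfl fun k _ => ?_
        rw [← Finset.sum_filter, Finset.sum_const, nsmul_eq_mul]
    _ ≤ ∑ k ∈ Finset.Icc 1 N, 2 * Q * (k : ℝ)⁻¹ := by
        refine Finset.sum_le_sum fun k hk => ?_
        obtain ⟨hk1, hkN⟩ := Finset.mem_Icc.mp hk
        have hk0 : (0 : ℝ) < k := by exact_mod_cast hk1
        rw [← div_eq_mul_inv, le_div_iff₀ hk0]
        nlinarith [h k hk1 hkN]
    _ = 2 * Q * ∑ k ∈ Finset.Icc 1 N, (k : ℝ)⁻¹ := by rw [Finset.mul_sum]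
    _ ≤ 2 * Q * (1 + Real.log N) := by
        refine mul_le_mul_of_nonneg_left ?_ (by positivity)
        have := harmonic_le_one_add_log N
        rw [harmonic_eq_sum_Icc] at this
        push_cast at this
        exact this

/-- Solymosi's argument: few lines through the origin are rich in a grid with small sumsets. -/
lemma card_rich_slopes_mul_sq_le (X Y S : Finset ℝ) (k : ℕ)
    (hX : ∀ x ∈ X, ∀ x' ∈ X, 0 < x * x') (hS : ∀ m ∈ S, m ≠ 0)
    (h : ∀ m ∈ S, k ≤ (X.filter fun x => m * x ∈ Y).card) :
    S.card * k ^ 2 ≤ 2 * ((X + X).card * (Y + Y).card) := by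
  classical
  set Z := (X + X) ×ˢ (Y + Y) with hZ
  have key : ∀ S : Finset ℝ, (∀ m ∈ S, k ≤ (X.filter fun x => m * x ∈ Y).card) →
      S.card * k ^ 2 ≤ k ^ 2 + (Z.filter fun z => ∃ m ∈ S, z.2 / z.1 < m).card := by
    intro S
    induction S using Finset.induction_on_max with
    | empty => simp
    | insert m S hm ih =>
      intro h
      rw [Finset.card_insert_of_notMem (fun hc => (hm m hc).false)]
      rcases S.eq_empty_or_nonempty with rfl | hne
      · simp
      have ih' := ih fun m' hm' => h m' (Finset.mem_insert_of_mem hm')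
      set μ := S.max' hne with hμ
      have hμS : μ ∈ S := S.max'_mem hne
      have hlt : μ < m := hm μ hμS
      set P₁ := X.filter fun x => μ * x ∈ Y
      set P₂ := X.filter fun x => m * x ∈ Y
      set New := (P₁ ×ˢ P₂).image fun q => (q.1 + q.2, μ * q.1 + m * q.2)
      have hcard : k ^ 2 ≤ New.card := by
        rw [Finset.card_image_of_injective, Finset.card_product, sq]
        · exact Nat.mul_le_mul (h μ (Finset.mem_insert_of_mem hμS))
            (h m (Finset.mem_insert_self _ _))
        · rintro ⟨a, b⟩ ⟨c, d⟩ hac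
          simp only [Prod.mk.injEq] at hac ⊢
          have h1 : (m - μ) * (b - d) = 0 := by linear_combination hac.2 - μ * hac.1
          have h2 : b = d := by
            rcases mul_eq_zero.mp h1 with h | h <;> linarith
          exact ⟨by linarith, h2⟩
      have hnew : ∀ z ∈ New, z ∈ Z ∧ μ < z.2 / z.1 ∧ z.2 / z.1 < m := by
        intro z hz
        obtain ⟨⟨a, b⟩, hab, rfl⟩ := Finset.mem_image.mp hz
        obtain ⟨ha, hb⟩ := Finset.mem_product.mp hab
        obtain ⟨ha1, ha2⟩ := Finset.mem_filter.mp ha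
        obtain ⟨hb1, hb2⟩ := Finset.mem_filter.mp hb
        simp only at ha1 ha2 hb1 hb2 ⊢
        refine ⟨Finset.mem_product.mpr ⟨Finset.add_mem_add ha1 hb1,
          Finset.add_mem_add ha2 hb2⟩, ?_, ?_⟩
        all_goals
          rcases lt_trichotomy a 0 with h0 | h0 | h0
          · have hb0 : b < 0 := by nlinarith [hX a ha1 b hb1]
            first
            | rw [lt_div_iff_of_neg (by linarith)]; nlinarith
            | rw [div_lt_iff_of_neg (by linarith)]; nlinarith
          · have := hX a ha1 a ha1
            simp [h0] at this
          · have hb0 : 0 < b := by nlinarith [hX a ha1 b hb1]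
            first
            | rw [lt_div_iff₀ (by linarith)]; nlinarith
            | rw [div_lt_iff₀ (by linarith)]; nlinarith
      have hdisj : Disjoint (Z.filter fun z => ∃ m ∈ S, z.2 / z.1 < m) New := by
        rw [Finset.disjoint_left]
        intro z hz hz'
        obtain ⟨-, m', hm', hlt'⟩ := Finset.mem_filter.mp hz
        have := S.le_max' m' hm'
        linarith [(hnew z hz').2.1]
      have hsub : (Z.filter fun z => ∃ m ∈ S, z.2 / z.1 < m) ∪ New ⊆
          Z.filter fun z => ∃ m' ∈ insert m S, z.2 / z.1 < m' := by
        intro z hz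
        rcases Finset.mem_union.mp hz with hz | hz
        · obtain ⟨hzZ, m', hm', hlt'⟩ := Finset.mem_filter.mp hz
          exact Finset.mem_filter.mpr ⟨hzZ, m', Finset.mem_insert_of_mem hm', hlt'⟩
        · exact Finset.mem_filter.mpr
            ⟨(hnew z hz).1, m, Finset.mem_insert_self _ _, (hnew z hz).2.2⟩
      have := Finset.card_le_card hsub
      rw [Finset.card_union_of_disjoint hdisj] at this
      calc (S.card + 1) * k ^ 2 = S.card * k ^ 2 + k ^ 2 := by ring
        _ ≤ _ := by omega
  rcases S.eq_empty_or_nonempty with rfl | ⟨m, hm⟩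
  · simp
  have hkey := key S h
  have hZc : Z.card = (X + X).card * (Y + Y).card := Finset.card_product _ _
  have hle := Finset.card_filter_le Z fun z => ∃ m ∈ S, z.2 / z.1 < m
  have hself : ∀ W : Finset ℝ, W.card ≤ (W + W).card := fun W => by
    rcases W.eq_empty_or_nonempty with rfl | hW
    · simp
    · exact Finset.card_le_card_add_left hW
  have hkX : k ≤ (X + X).card :=
    (h m hm).trans ((Finset.card_filter_le _ _).trans (hself X))
  have hkY : k ≤ (Y + Y).card := by
    refine ((h m hm).trans ?_).trans (hself Y)
    refine Finset.card_le_card_of_injOn (fun x => m * x)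
      (fun x hx => (Finset.mem_filter.mp hx).2) ?_
    exact (mul_right_injective₀ (hS m hm)).injOn
  have : k ^ 2 ≤ (X + X).card * (Y + Y).card := by
    rw [sq]; exact Nat.mul_le_mul hkX hkY
  omega

/-- The number of elements of `B` that are at most `z`. -/
noncomputable def rankIn (B : Finset ℝ) (z : ℝ) : ℕ := (B.filter fun b => b ≤ z).card

lemma rankIn_mono (B : Finset ℝ) : Monotone (rankIn B) := fun _ _ h =>
  Finset.card_le_card (Finset.monotone_filter_right _ fun _ _ hb => le_trans hb h)

lemma rankIn_le (B : Finset ℝ) (z : ℝ) : rankIn B z ≤ B.card := Finset.card_filter_le _ _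

lemma rankIn_injOn (B : Finset ℝ) : Set.InjOn (rankIn B) B := by
  have key : ∀ z w : ℝ, w ∈ B → z < w → rankIn B z < rankIn B w := by
    intro z w hw hzw
    refine Finset.card_lt_card ⟨Finset.monotone_filter_right _
      fun _ _ hb => le_trans hb hzw.le, fun hc => ?_⟩
    have := (Finset.mem_filter.mp (hc (Finset.mem_filter.mpr ⟨hw, le_rfl⟩))).2
    linarith
  intro z hz w hw hzw
  rcases lt_trichotomy z w with h | h | h
  · exact absurd hzw (key z w hw h).ne
  · exact h
  · exact absurd hzw (key w z hz h).ne'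

/-- The pairs in `B` whose ranks differ by at most `g`. -/
noncomputable def closePairs (B : Finset ℝ) (g : ℕ) : Finset (ℝ × ℝ) :=
  (B ×ˢ B).filter fun p => |(rankIn B p.2 : ℤ) - rankIn B p.1| ≤ g

lemma card_closePairs_le (B : Finset ℝ) (g : ℕ) :
    (closePairs B g).card ≤ B.card * (2 * g + 1) := by
  have h : (closePairs B g).card ≤ (B ×ˢ Finset.Icc (-(g : ℤ)) g).card := by
    refine Finset.card_le_card_of_injOn
      (fun p => (p.1, (rankIn B p.2 : ℤ) - rankIn B p.1)) ?_ ?_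
    · intro p hp
      obtain ⟨hp1, hp2⟩ := Finset.mem_filter.mp hp
      have := abs_le.mp hp2
      simp only [Finset.coe_product, Set.mem_prod, Finset.mem_coe, Finset.mem_Icc]
      exact ⟨(Finset.mem_product.mp hp1).1, this⟩
    · rintro ⟨a, b⟩ hp ⟨c, d⟩ hq hpq
      have hb := (Finset.mem_product.mp (Finset.mem_filter.mp hp).1).2
      have hd := (Finset.mem_product.mp (Finset.mem_filter.mp hq).1).2
      simp only [Prod.mk.injEq] at hpq hb hd ⊢
      obtain ⟨rfl, h2⟩ := hpq
      exact ⟨rfl, rankIn_injOn B hb hd (by omega)⟩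
  rw [Finset.card_product, Int.card_Icc] at h
  convert h using 2
  omega

/-- A real function cannot increase by at least `δ` between all pairs of points of a large set
if its oscillation is small. -/
lemma card_pred_mul_le_of_separated (Φ : ℝ → ℝ) (δ : ℝ) (Q : Finset ℝ) (x : ℝ) (hx : x ∈ Q)
    (h : ∀ a ∈ Q, ∀ b ∈ Q, a < b → δ ≤ Φ b - Φ a) :
    ∃ a ∈ Q, ∃ b ∈ Q, ((Q.card : ℝ) - 1) * δ ≤ Φ b - Φ a := by
  classical
  suffices H : ∀ Q : Finset ℝ, (∀ a ∈ Q, ∀ b ∈ Q, a < b → δ ≤ Φ b - Φ a) →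
      ∀ hQ : Q.Nonempty, ∃ a ∈ Q, ((Q.card : ℝ) - 1) * δ ≤ Φ (Q.max' hQ) - Φ a by
    obtain ⟨a, ha, hab⟩ := H Q h ⟨x, hx⟩
    exact ⟨a, ha, _, Q.max'_mem _, hab⟩
  intro Q
  induction Q using Finset.induction_on_max with
  | empty => intro _ hQ; simp at hQ
  | insert m Q hm ih =>
    intro h hQ
    have hmax : (insert m Q).max' hQ = m := by
      refine le_antisymm (Finset.max'_le _ _ _ fun y hy => ?_)
        (Finset.le_max' _ _ (Finset.mem_insert_self _ _))
      rcases Finset.mem_insert.mp hy with rfl | hy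
      · exact le_rfl
      · exact (hm y hy).le
    rw [hmax, Finset.card_insert_of_notMem (fun hc => (hm m hc).false)]
    rcases Q.eq_empty_or_nonempty with rfl | hne
    · exact ⟨m, by simp, by simp⟩
    obtain ⟨a, ha, hab⟩ := ih (fun a ha b hb => h a (Finset.mem_insert_of_mem ha) b
      (Finset.mem_insert_of_mem hb)) hne
    have := h _ (Finset.mem_insert_of_mem (Q.max'_mem hne)) m (Finset.mem_insert_self _ _)
      (hm _ (Q.max'_mem hne))
    refine ⟨a, Finset.mem_insert_of_mem ha, ?_⟩
    push_cast
    linarith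

/-- The sum of the ranks in `A + A` of the elements of `A + x`. -/
noncomputable def rankSum (A : Finset ℝ) (x : ℝ) : ℝ := ∑ a ∈ A, (rankIn (A + A) (a + x) : ℝ)

lemma rankSum_mono (A : Finset ℝ) : Monotone (rankSum A) := fun x y h =>
  Finset.sum_le_sum fun a _ => by
    exact_mod_cast rankIn_mono (A + A) (by linarith : a + x ≤ a + y)

lemma rankSum_nonneg (A : Finset ℝ) (x : ℝ) : 0 ≤ rankSum A x :=
  Finset.sum_nonneg fun _ _ => Nat.cast_nonneg _

lemma rankSum_le (A : Finset ℝ) (x : ℝ) : rankSum A x ≤ A.card * (A + A).card := by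
  have : rankSum A x ≤ ∑ a ∈ A, ((A + A).card : ℝ) :=
    Finset.sum_le_sum fun a _ => by exact_mod_cast rankIn_le (A + A) (a + x)
  simpa using this

/-- If `rankSum` changes little, most translates of the pair are close in `A + A`. -/
lemma card_close_translates (A : Finset ℝ) (k g : ℕ) (hk : 0 < k) (hA : A.Nonempty)
    (hg : 20 * ((A + A).card : ℝ) / k ≤ g + 1) (x y : ℝ)
    (h : |rankSum A y - rankSum A x| ≤ 5 / k * (A.card * (A + A).card)) :
    (3 / 4 : ℝ) * A.card ≤ (A.filter fun a =>
      |(rankIn (A + A) (a + y) : ℤ) - rankIn (A + A) (a + x)| ≤ g).card := by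
  wlog hxy : x ≤ y generalizing x y with H
  · have := H y x (by rwa [abs_sub_comm]) (by linarith)
    simp_rw [abs_sub_comm (rankIn (A + A) (_ + y) : ℤ)]
    exact this
  rw [abs_of_nonneg (sub_nonneg.mpr (rankSum_mono A hxy))] at h
  have hn : 0 < (A + A).card := (hA.add hA).card_pos
  have hsum : rankSum A y - rankSum A x =
      ∑ a ∈ A, ((rankIn (A + A) (a + y) : ℝ) - rankIn (A + A) (a + x)) := by
    simp [rankSum, Finset.sum_sub_distrib]
  have hpos : ∀ a : ℝ, (0 : ℝ) ≤ (rankIn (A + A) (a + y) : ℝ) - rankIn (A + A) (a + x) :=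
    fun a => sub_nonneg.mpr (by exact_mod_cast rankIn_mono (A + A) (by linarith))
  set p : ℝ → Prop := fun a => |(rankIn (A + A) (a + y) : ℤ) - rankIn (A + A) (a + x)| ≤ g
  have hbad : ((A.filter fun a => ¬ p a).card : ℝ) * (20 * ((A + A).card : ℝ) / k) ≤
      5 / k * (A.card * (A + A).card) := by
    refine le_trans ?_ h
    rw [hsum]
    calc ((A.filter fun a => ¬ p a).card : ℝ) * (20 * ((A + A).card : ℝ) / k)
        = ∑ a ∈ A.filter (fun a => ¬ p a), 20 * ((A + A).card : ℝ) / k := by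
          rw [Finset.sum_const, nsmul_eq_mul]
      _ ≤ ∑ a ∈ A.filter (fun a => ¬ p a),
          ((rankIn (A + A) (a + y) : ℝ) - rankIn (A + A) (a + x)) := by
          refine Finset.sum_le_sum fun a ha => hg.trans ?_
          have h1 := (Finset.mem_filter.mp ha).2
          simp only [p, not_le] at h1
          have h2 : (rankIn (A + A) (a + x) : ℤ) ≤ rankIn (A + A) (a + y) := by
            exact_mod_cast rankIn_mono (A + A) (by linarith)
          rw [abs_of_nonneg (by omega)] at h1
          have h3 : (g : ℤ) + 1 ≤ (rankIn (A + A) (a + y) : ℤ) - rankIn (A + A) (a + x) := h1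
          exact_mod_cast h3
      _ ≤ _ := Finset.sum_le_sum_of_subset_of_nonneg (Finset.filter_subset _ _)
          fun a _ _ => hpos a
  have hsplit : ((A.filter p).card : ℝ) + (A.filter fun a => ¬ p a).card = A.card := by
    exact_mod_cast Finset.card_filter_add_card_filter_not (s := A) p
  have hk' : (0 : ℝ) < k := by exact_mod_cast hk
  have hn' : (0 : ℝ) < (A + A).card := by exact_mod_cast hn
  have h4 : 4 * ((A.filter fun a => ¬ p a).card : ℝ) ≤ A.card := by
    have : (4 * ((A.filter fun a => ¬ p a).card : ℝ)) * (5 * ((A + A).card : ℝ) / k) ≤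
        A.card * (5 * ((A + A).card : ℝ) / k) := by
      refine le_trans (le_of_eq ?_) (hbad.trans (le_of_eq ?_)) <;> ring
    exact le_of_mul_le_mul_right this (by positivity)
  linarith

/-- A line of slope `m` that is rich in `A × A` contains two points most of whose translates are
close in `A + A` in both coordinates. -/
lemma exists_close_pair (A : Finset ℝ) (k g : ℕ) (hk : 2 ≤ k)
    (hg : 20 * ((A + A).card : ℝ) / k ≤ g + 1) (m s : ℝ) (hm : m ≠ 0)
    (h : k ≤ (A.filter fun x => m * x + s ∈ A).card) :
    ∃ x ∈ A, ∃ x' ∈ A, ∃ y ∈ A, ∃ y' ∈ A, x < x' ∧ y' - y = m * (x' - x) ∧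
      (3 / 4 : ℝ) * A.card ≤ (A.filter fun a =>
        |(rankIn (A + A) (a + x') : ℤ) - rankIn (A + A) (a + x)| ≤ g).card ∧
      (3 / 4 : ℝ) * A.card ≤ (A.filter fun a =>
        |(rankIn (A + A) (a + y') : ℤ) - rankIn (A + A) (a + y)| ≤ g).card := by
  set Q := A.filter fun x => m * x + s ∈ A
  obtain ⟨x₀, hx₀⟩ : Q.Nonempty := Finset.card_pos.mp (by omega)
  have hA : A.Nonempty := ⟨x₀, (Finset.mem_filter.mp hx₀).1⟩
  have hc : (0 : ℝ) < A.card * (A + A).card := by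
    have h1 := hA.card_pos
    have h2 := (hA.add hA).card_pos
    positivity
  set c : ℝ := A.card * (A + A).card with hcdef
  have hk' : (2 : ℝ) ≤ k := by exact_mod_cast hk
  have hkQ : (k : ℝ) ≤ Q.card := by exact_mod_cast h
  obtain ⟨Ψ, hΨm, hΨb, hΨa⟩ : ∃ Ψ : ℝ → ℝ, Monotone Ψ ∧ (∀ a b, Ψ b - Ψ a ≤ c) ∧
      ∀ a b, |rankSum A (m * b + s) - rankSum A (m * a + s)| = |Ψ b - Ψ a| := by
    rcases lt_or_gt_of_ne hm with hm | hm
    · refine ⟨fun x => - rankSum A (m * x + s), fun a b hab => ?_, fun a b => ?_, fun a b => ?_⟩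
      · exact neg_le_neg (rankSum_mono A (by nlinarith))
      · have := rankSum_le A (m * a + s)
        have := rankSum_nonneg A (m * b + s)
        linarith
      · rw [← abs_neg]; ring_nf
    · refine ⟨fun x => rankSum A (m * x + s), fun a b hab => ?_, fun a b => ?_, fun a b => rfl⟩
      · exact rankSum_mono A (by nlinarith)
      · have := rankSum_le A (m * b + s)
        have := rankSum_nonneg A (m * a + s)
        linarith
  have hex : ∃ a ∈ Q, ∃ b ∈ Q, a < b ∧
      (rankSum A b + Ψ b) - (rankSum A a + Ψ a) < 5 / k * c := by
    by_contra! hcon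
    obtain ⟨a, -, b, -, hab⟩ := card_pred_mul_le_of_separated
      (fun x => rankSum A x + Ψ x) (5 / k * c) Q x₀ hx₀ hcon
    have h1 : ((k : ℝ) - 1) * (5 / k * c) ≤ ((Q.card : ℝ) - 1) * (5 / k * c) :=
      mul_le_mul_of_nonneg_right (by linarith) (by positivity)
    have h2 : (5 / 2) * c ≤ ((k : ℝ) - 1) * (5 / k * c) := by
      rw [← mul_assoc ((k : ℝ) - 1)]
      refine mul_le_mul_of_nonneg_right (a := c) ?_ hc.le
      rw [← mul_div_assoc, le_div_iff₀ (by linarith)]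
      linarith
    have h3 := hΨb a b
    have h4 := rankSum_le A b
    have h5 := rankSum_nonneg A a
    linarith
  obtain ⟨a, ha, b, hb, hlt, hab⟩ := hex
  obtain ⟨haA, haA'⟩ := Finset.mem_filter.mp ha
  obtain ⟨hbA, hbA'⟩ := Finset.mem_filter.mp hb
  have h1 := rankSum_mono A hlt.le
  have h2 := hΨm hlt.le
  refine ⟨a, haA, b, hbA, _, haA', _, hbA', hlt, by ring, ?_, ?_⟩
  · refine card_close_translates A k g (by omega) hA hg a b ?_
    rw [abs_of_nonneg (by linarith)]
    linarith
  · refine card_close_translates A k g (by omega) hA hg _ _ ?_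
    rw [hΨa, abs_of_nonneg (by linarith)]
    linarith

/-- Few directions have a line that is rich in `A × A`. -/
lemma card_rich_directions_le (A S : Finset ℝ) (hA : A.Nonempty) (k : ℕ) (hk : 2 ≤ k)
    (hkA : k ≤ A.card) (hS : ∀ m ∈ S, m ≠ 0)
    (h : ∀ m ∈ S, ∃ s, k ≤ (A.filter fun x => m * x + s ∈ A).card) :
    (S.card : ℝ) * k ^ 2 * A.card ^ 2 ≤ 6400 * (A + A).card ^ 4 := by
  classical
  set n := (A + A).card with hn
  have hAn : A.card ≤ n := Finset.card_le_card_add_left hA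
  have hk' : (0 : ℝ) < k := by exact_mod_cast (by omega : 0 < k)
  have hkn : (k : ℝ) ≤ n := by exact_mod_cast hkA.trans hAn
  set g := ⌊20 * (n : ℝ) / k⌋₊
  have hg1 : 20 * (n : ℝ) / k ≤ g + 1 := (Nat.lt_floor_add_one _).le
  have hg2 : (g : ℝ) ≤ 20 * (n : ℝ) / k := Nat.floor_le (by positivity)
  have hg3 : (2 * g + 1 : ℝ) ≤ 60 * n / k := by
    have : 1 ≤ (n : ℝ) / k := by rwa [one_le_div hk']
    have e1 : 20 * (n : ℝ) / k = 20 * (n / k) := by ring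
    have e2 : 60 * (n : ℝ) / k = 60 * (n / k) := by ring
    rw [e1] at hg2; rw [e2]; linarith
  have hex : ∀ m : ℝ, ∃ q : (ℝ × ℝ) × (ℝ × ℝ), m ∈ S →
      q.1.1 ∈ A ∧ q.1.2 ∈ A ∧ q.2.1 ∈ A ∧ q.2.2 ∈ A ∧ q.1.1 < q.1.2 ∧
      q.2.2 - q.2.1 = m * (q.1.2 - q.1.1) ∧
      (3 / 4 : ℝ) * A.card ≤ (A.filter fun a =>
        |(rankIn (A + A) (a + q.1.2) : ℤ) - rankIn (A + A) (a + q.1.1)| ≤ g).card ∧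
      (3 / 4 : ℝ) * A.card ≤ (A.filter fun a =>
        |(rankIn (A + A) (a + q.2.2) : ℤ) - rankIn (A + A) (a + q.2.1)| ≤ g).card := by
    intro m
    by_cases hm : m ∈ S
    · obtain ⟨s, hs⟩ := h m hm
      obtain ⟨x, hx, x', hx', y, hy, y', hy', h1, h2, h3, h4⟩ :=
        exists_close_pair A k g hk hg1 m s (hS m hm) hs
      exact ⟨((x, x'), (y, y')), fun _ => ⟨hx, hx', hy, hy', h1, h2, h3, h4⟩⟩
    · exact ⟨0, fun h => absurd h hm⟩
  choose q hq using hex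
  set F : ℝ → Finset (ℝ × ℝ) := fun m =>
    (A.filter fun a =>
      |(rankIn (A + A) (a + (q m).1.2) : ℤ) - rankIn (A + A) (a + (q m).1.1)| ≤ g) ×ˢ
    (A.filter fun a =>
      |(rankIn (A + A) (a + (q m).2.2) : ℤ) - rankIn (A + A) (a + (q m).2.1)| ≤ g) with hF
  have hinj : (S.sigma F).card ≤ (closePairs (A + A) g ×ˢ closePairs (A + A) g).card := by
    refine Finset.card_le_card_of_injOn (fun z =>
      ((z.2.1 + (q z.1).1.1, z.2.1 + (q z.1).1.2), (z.2.2 + (q z.1).2.1, z.2.2 + (q z.1).2.2)))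
      ?_ ?_
    · rintro ⟨m, a, b⟩ hz
      obtain ⟨hm, hab⟩ := Finset.mem_sigma.mp hz
      obtain ⟨ha, hb⟩ := Finset.mem_product.mp hab
      obtain ⟨ha1, ha2⟩ := Finset.mem_filter.mp ha
      obtain ⟨hb1, hb2⟩ := Finset.mem_filter.mp hb
      obtain ⟨h1, h2, h3, h4, -⟩ := hq m hm
      refine Finset.mem_coe.mpr (Finset.mem_product.mpr ⟨?_, ?_⟩)
      · exact Finset.mem_filter.mpr ⟨Finset.mem_product.mpr
          ⟨Finset.add_mem_add ha1 h1, Finset.add_mem_add ha1 h2⟩, ha2⟩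
      · exact Finset.mem_filter.mpr ⟨Finset.mem_product.mpr
          ⟨Finset.add_mem_add hb1 h3, Finset.add_mem_add hb1 h4⟩, hb2⟩
    · rintro ⟨m, a, b⟩ hz ⟨m', a', b'⟩ hz' he
      have hm := (Finset.mem_sigma.mp hz).1
      have hm' := (Finset.mem_sigma.mp hz').1
      simp only [Prod.mk.injEq] at he hm hm'
      obtain ⟨⟨e1, e2⟩, e3, e4⟩ := he
      obtain ⟨-, -, -, -, h5, h6, -⟩ := hq m hm
      obtain ⟨-, -, -, -, h5', h6', -⟩ := hq m' hm'
      have hmm : m = m' := by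
        have h7 : (q m).1.2 - (q m).1.1 ≠ 0 := by linarith
        refine mul_right_cancel₀ h7 ?_
        have h8 : (q m).1.2 - (q m).1.1 = (q m').1.2 - (q m').1.1 := by linarith
        rw [← h6, h8, ← h6']
        linarith
      subst hmm
      have : a = a' := by linarith
      have : b = b' := by linarith
      subst_vars
      rfl
  have hlow : (S.card : ℝ) * (9 / 16 * A.card ^ 2) ≤ (S.sigma F).card := by
    rw [Finset.card_sigma]
    push_cast
    rw [← nsmul_eq_mul, ← Finset.sum_const]
    refine Finset.sum_le_sum fun m hm => ?_
    obtain ⟨-, -, -, -, -, -, h7, h8⟩ := hq m hm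
    rw [hF, Finset.card_product]
    push_cast
    calc (9 / 16 * (A.card : ℝ) ^ 2) = (3 / 4 * A.card) * (3 / 4 * A.card) := by ring
      _ ≤ _ := mul_le_mul h7 h8 (by positivity) (by positivity)
  have hup : ((S.sigma F).card : ℝ) ≤ (n * (60 * n / k)) ^ 2 := by
    have h1 : ((closePairs (A + A) g).card : ℝ) ≤ n * (60 * n / k) := by
      refine le_trans (Nat.cast_le.mpr (card_closePairs_le (A + A) g)) ?_
      push_cast
      exact mul_le_mul_of_nonneg_left hg3 (by positivity)
    calc ((S.sigma F).card : ℝ) ≤ (closePairs (A + A) g).card * (closePairs (A + A) g).card := by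
          rw [Finset.card_product] at hinj
          exact_mod_cast hinj
      _ ≤ _ := by rw [sq]; exact mul_le_mul h1 h1 (by positivity) (by positivity)
  have := hlow.trans hup
  have e : (n * (60 * n / k) : ℝ) ^ 2 = 3600 * n ^ 4 / k ^ 2 := by
    field_simp; norm_num
  rw [e, le_div_iff₀ (by positivity)] at this
  nlinarith

lemma card_le_card_add_self (W : Finset ℝ) : W.card ≤ (W + W).card := by
  rcases W.eq_empty_or_nonempty with rfl | hW
  · simp
  · exact Finset.card_le_card_add_left hW

lemma one_le_one_add_log_card (A : Finset ℝ) : 1 ≤ 1 + Real.log A.card := by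
  have := Real.log_natCast_nonneg A.card
  linarith

/-- The nonzero points of `A` that a dilation by `m` sends into `A`. -/
noncomputable def dilationPoints (A : Finset ℝ) (m : ℝ) : Finset ℝ :=
  A.filter fun x => x ≠ 0 ∧ m * x ∈ A

/-- The number of points of `A × A` on the richest line of slope `m`. -/
noncomputable def maxRichness (A : Finset ℝ) (m : ℝ) : ℕ :=
  (A ×ˢ A).sup fun p => (A.filter fun x => m * x + (p.2 - m * p.1) ∈ A).card

/-- The finite nonzero slopes of the lines joining the origin to points of `A × A`. -/
noncomputable def slopes (A : Finset ℝ) : Finset ℝ :=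
  ((A ×ˢ A).filter fun p => p.1 ≠ 0 ∧ p.2 ≠ 0).image fun p => p.2 / p.1

lemma card_filter_le_maxRichness (A : Finset ℝ) (m s : ℝ) :
    (A.filter fun x => m * x + s ∈ A).card ≤ maxRichness A m := by
  rcases (A.filter fun x => m * x + s ∈ A).eq_empty_or_nonempty with h | ⟨x, hx⟩
  · simp [h]
  · obtain ⟨hx1, hx2⟩ := Finset.mem_filter.mp hx
    have := Finset.le_sup (f := fun p : ℝ × ℝ =>
      (A.filter fun x => m * x + (p.2 - m * p.1) ∈ A).card)
      (Finset.mk_mem_product hx1 hx2)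
    simpa [maxRichness] using this

lemma ne_zero_of_mem_slopes {A : Finset ℝ} {m : ℝ} (hm : m ∈ slopes A) : m ≠ 0 := by
  obtain ⟨p, hp, rfl⟩ := Finset.mem_image.mp hm
  have := (Finset.mem_filter.mp hp).2
  exact div_ne_zero this.2 this.1

lemma card_slopes_le (A : Finset ℝ) : (slopes A).card ≤ A.card ^ 2 := by
  refine Finset.card_image_le.trans ((Finset.card_filter_le _ _).trans ?_)
  rw [Finset.card_product, sq]

lemma sum_sq_card_same_sign_le (A X : Finset ℝ) (hA : A.Nonempty) (hXA : X ⊆ A)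
    (hX : ∀ x ∈ X, ∀ x' ∈ X, 0 < x * x') :
    ∑ m ∈ slopes A, ((X.filter fun x => m * x ∈ A).card : ℝ) ^ 2 ≤
      4 * ((A + A).card : ℝ) ^ 2 * (1 + Real.log A.card) := by
  have h := sum_sq_le_of_card_level_le (slopes A) (fun m => (X.filter fun x => m * x ∈ A).card)
    A.card hA.card_pos (2 * ((A + A).card : ℝ) ^ 2)
    (fun m _ => (Finset.card_filter_le _ _).trans (Finset.card_le_card hXA)) ?_
  · linarith
  · intro k _ _
    have h1 := card_rich_slopes_mul_sq_le X A
      ((slopes A).filter fun m => k ≤ (X.filter fun x => m * x ∈ A).card) k hX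
      (fun m hm => ne_zero_of_mem_slopes (Finset.mem_filter.mp hm).1)
      (fun m hm => (Finset.mem_filter.mp hm).2)
    have h2 : (X + X).card ≤ (A + A).card :=
      Finset.card_le_card (Finset.add_subset_add hXA hXA)
    have h3 := h1.trans (Nat.mul_le_mul_left 2 (Nat.mul_le_mul_right _ h2))
    rw [sq ((A + A).card : ℝ)]
    exact_mod_cast h3

lemma sum_sq_card_dilationPoints_le (A : Finset ℝ) (hA : A.Nonempty) :
    ∑ m ∈ slopes A, ((dilationPoints A m).card : ℝ) ^ 2 ≤
      16 * ((A + A).card : ℝ) ^ 2 * (1 + Real.log A.card) := by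
  have hp := sum_sq_card_same_sign_le A (A.filter fun x => 0 < x) hA (Finset.filter_subset _ _)
    (fun x hx y hy => mul_pos (Finset.mem_filter.mp hx).2 (Finset.mem_filter.mp hy).2)
  have hn := sum_sq_card_same_sign_le A (A.filter fun x => x < 0) hA (Finset.filter_subset _ _)
    (fun x hx y hy => mul_pos_of_neg_of_neg (Finset.mem_filter.mp hx).2
      (Finset.mem_filter.mp hy).2)
  have key : ∀ m ∈ slopes A, ((dilationPoints A m).card : ℝ) ^ 2 ≤
      2 * (((A.filter fun x => 0 < x).filter fun x => m * x ∈ A).card : ℝ) ^ 2 +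
      2 * (((A.filter fun x => x < 0).filter fun x => m * x ∈ A).card : ℝ) ^ 2 := by
    intro m _
    have hsub : dilationPoints A m ⊆ ((A.filter fun x => 0 < x).filter fun x => m * x ∈ A) ∪
        ((A.filter fun x => x < 0).filter fun x => m * x ∈ A) := by
      intro x hx
      obtain ⟨hx1, hx2, hx3⟩ := Finset.mem_filter.mp hx
      simp only [Finset.mem_union, Finset.mem_filter]
      rcases lt_or_gt_of_ne hx2 with h | h <;> tauto
    have h1 := (Finset.card_le_card hsub).trans (Finset.card_union_le _ _)
    have h2 : ((dilationPoints A m).card : ℝ) ≤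
      (((A.filter fun x => 0 < x).filter fun x => m * x ∈ A).card : ℝ) +
      (((A.filter fun x => x < 0).filter fun x => m * x ∈ A).card : ℝ) := by exact_mod_cast h1
    have h3 : (0 : ℝ) ≤ (dilationPoints A m).card := by positivity
    nlinarith [sq_nonneg ((((A.filter fun x => 0 < x).filter fun x => m * x ∈ A).card : ℝ) -
      (((A.filter fun x => x < 0).filter fun x => m * x ∈ A).card : ℝ))]
  refine (Finset.sum_le_sum key).trans ?_
  rw [Finset.sum_add_distrib, ← Finset.mul_sum, ← Finset.mul_sum]
  linarith

lemma sum_sq_maxRichness_le (A : Finset ℝ) (hA : A.Nonempty) :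
    ∑ m ∈ slopes A, (maxRichness A m : ℝ) ^ 2 ≤
      12800 * ((A + A).card : ℝ) ^ 4 / A.card ^ 2 * (1 + Real.log A.card) := by
  have hpos : (0 : ℝ) < A.card := by exact_mod_cast hA.card_pos
  have h := sum_sq_le_of_card_level_le (slopes A) (maxRichness A) A.card hA.card_pos
    (6400 * ((A + A).card : ℝ) ^ 4 / A.card ^ 2)
    (fun m _ => Finset.sup_le fun p _ => Finset.card_filter_le _ _) ?_
  · exact h.trans (le_of_eq (by ring))
  · intro k hk1 hkA
    rw [le_div_iff₀ (by positivity)]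
    rcases hk1.eq_or_lt with rfl | hk
    · have h1 : (((slopes A).filter fun m => 1 ≤ maxRichness A m).card : ℝ) ≤
          (A.card : ℝ) ^ 2 := by
        exact_mod_cast (Finset.card_filter_le _ _).trans (card_slopes_le A)
      have h2 : (A.card : ℝ) ≤ (A + A).card := by exact_mod_cast card_le_card_add_self A
      have h3 : (A.card : ℝ) ^ 4 ≤ ((A + A).card : ℝ) ^ 4 := pow_le_pow_left₀ hpos.le h2 4
      have h4 := mul_le_mul_of_nonneg_right h1 (sq_nonneg (A.card : ℝ))
      have h5 : (0 : ℝ) ≤ ((A + A).card : ℝ) ^ 4 := by positivity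
      norm_num
      nlinarith
    · refine card_rich_directions_le A _ hA k hk hkA
        (fun m hm => ne_zero_of_mem_slopes (Finset.mem_filter.mp hm).1) fun m hm => ?_
      obtain ⟨p, -, hp⟩ := Finset.exists_mem_eq_sup (A ×ˢ A) (hA.product hA)
        fun p => (A.filter fun x => m * x + (p.2 - m * p.1) ∈ A).card
      refine ⟨p.2 - m * p.1, ?_⟩
      rw [← hp]
      exact (Finset.mem_filter.mp hm).2

/-- The determinant of a pair of vectors in the plane. -/
def wedge (u v : ℝ × ℝ) : ℝ := u.1 * v.2 - u.2 * v.1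

/-- The pairs of vectors in `A × A` with determinant `t`. -/
noncomputable def detPairs (A : Finset ℝ) (t : ℝ) : Finset ((ℝ × ℝ) × (ℝ × ℝ)) :=
  ((A ×ˢ A) ×ˢ (A ×ˢ A)).filter fun e => wedge e.1 e.2 = t

lemma mem_detPairs {A : Finset ℝ} {t a b c d : ℝ} :
    ((a, b), (c, d)) ∈ detPairs A t ↔
      ((a ∈ A ∧ b ∈ A) ∧ c ∈ A ∧ d ∈ A) ∧ a * d - b * c = t := by
  rw [detPairs, Finset.mem_filter]
  simp only [Finset.mem_product, wedge]

lemma card_detPairs_zero_le (A : Finset ℝ) (hA : A.Nonempty) :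
    ((detPairs A 0).card : ℝ) ≤ 20 * ((A + A).card : ℝ) ^ 2 * (1 + Real.log A.card) := by
  set I : Finset (Σ _ : ℝ, ℝ × ℝ) :=
    (slopes A).sigma fun m => dilationPoints A m ×ˢ dilationPoints A m with hI
  set Z : Finset ((ℝ × ℝ) × (ℝ × ℝ)) :=
    ((A ×ˢ A).image fun p => ((0, 0), p)) ∪ ((A ×ˢ A).image fun p => ((0, p.1), (0, p.2))) ∪
    (((A ×ˢ A).image fun p => ((p.1, 0), (p.2, 0))) ∪ ((A ×ˢ A).image fun p => (p, (0, 0))))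
    with hZ
  have hZc : Z.card ≤ 4 * A.card ^ 2 := by
    have hi : ∀ f : ℝ × ℝ → (ℝ × ℝ) × (ℝ × ℝ), ((A ×ˢ A).image f).card ≤ A.card ^ 2 :=
      fun f => Finset.card_image_le.trans (by rw [Finset.card_product, sq])
    refine (Finset.card_union_le _ _).trans ((Nat.add_le_add
      ((Finset.card_union_le _ _).trans (Nat.add_le_add (hi _) (hi _)))
      ((Finset.card_union_le _ _).trans (Nat.add_le_add (hi _) (hi _)))).trans ?_)
    omega
  have hIc : (I.card : ℝ) ≤ 16 * ((A + A).card : ℝ) ^ 2 * (1 + Real.log A.card) := by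
    refine le_trans (le_of_eq ?_) (sum_sq_card_dilationPoints_le A hA)
    rw [hI, Finset.card_sigma]
    push_cast [Finset.card_product]
    exact Finset.sum_congr rfl fun m _ => by ring
  have hsplit : (detPairs A 0 \ Z).card ≤ I.card := by
    have hmem : ∀ a b c d : ℝ, ((a, b), (c, d)) ∈ detPairs A 0 \ Z →
        a ≠ 0 ∧ b ≠ 0 ∧ c ≠ 0 ∧ d = b / a * c ∧ a ∈ A ∧ b ∈ A ∧ c ∈ A ∧ d ∈ A := by
      intro a b c d h
      obtain ⟨h1, h2⟩ := Finset.mem_sdiff.mp h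
      obtain ⟨⟨⟨ha, hb⟩, hc, hd⟩, hdet⟩ := mem_detPairs.mp h1
      simp only [hZ, Finset.mem_union, Finset.mem_image, Finset.mem_product, Prod.mk.injEq,
        Prod.exists, not_or, not_exists, not_and, and_imp] at h2
      have hne : a ≠ 0 ∧ b ≠ 0 ∧ c ≠ 0 := by
        obtain ⟨⟨g1, g2⟩, g3, g4⟩ := h2
        refine ⟨?_, ?_, ?_⟩
        · rintro rfl
          rcases mul_eq_zero.mp (show b * c = 0 by linarith) with rfl | rfl
          · exact g1 c d hc hd rfl rfl rfl rfl
          · exact g2 b d hb hd rfl rfl rfl rfl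
        · rintro rfl
          rcases mul_eq_zero.mp (show a * d = 0 by linarith) with rfl | rfl
          · exact g1 c d hc hd rfl rfl rfl rfl
          · exact g3 a c ha hc rfl rfl rfl rfl
        · rintro rfl
          rcases mul_eq_zero.mp (show a * d = 0 by linarith) with rfl | rfl
          · exact g2 b d hb hd rfl rfl rfl rfl
          · exact g4 a b ha hb rfl rfl rfl rfl
      refine ⟨hne.1, hne.2.1, hne.2.2, ?_, ha, hb, hc, hd⟩
      have := hne.1
      field_simp
      linarith
    refine Finset.card_le_card_of_injOn
      (fun e => (⟨e.1.2 / e.1.1, (e.1.1, e.2.1)⟩ : Σ _ : ℝ, ℝ × ℝ)) ?_ ?_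
    · rintro ⟨⟨a, b⟩, c, d⟩ he
      obtain ⟨ha0, hb0, hc0, hd0, ha, hb, hc, hd⟩ := hmem a b c d he
      refine Finset.mem_coe.mpr (Finset.mem_sigma.mpr ⟨Finset.mem_image.mpr ⟨(a, b), ?_, rfl⟩,
        Finset.mem_product.mpr ⟨Finset.mem_filter.mpr ⟨ha, ha0, ?_⟩,
        Finset.mem_filter.mpr ⟨hc, hc0, ?_⟩⟩⟩)
      · simp [ha, hb, ha0, hb0]
      · simpa [ha0] using hb
      · exact hd0 ▸ hd
    · rintro ⟨⟨a, b⟩, c, d⟩ he ⟨⟨a', b'⟩, c', d'⟩ he' hee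
      obtain ⟨ha0, -, -, hd0, -⟩ := hmem a b c d he
      obtain ⟨-, -, -, hd0', -⟩ := hmem a' b' c' d' he'
      simp only [Sigma.mk.injEq, heq_eq_eq, Prod.mk.injEq] at hee
      obtain ⟨h1, rfl, rfl⟩ := hee
      have hb : b = b' := by field_simp at h1; exact h1
      subst hb
      rw [hd0, hd0']
  have hle := Finset.card_le_card_sdiff_add_card (t := Z) (s := detPairs A 0)
  have h1 : ((detPairs A 0).card : ℝ) ≤ I.card + 4 * (A.card : ℝ) ^ 2 := by
    exact_mod_cast hle.trans (Nat.add_le_add hsplit hZc)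
  have h2 : (A.card : ℝ) ^ 2 ≤ ((A + A).card : ℝ) ^ 2 * (1 + Real.log A.card) := by
    have h3 : (A.card : ℝ) ≤ (A + A).card := by exact_mod_cast card_le_card_add_self A
    have h4 := pow_le_pow_left₀ (Nat.cast_nonneg _) h3 2
    have h5 := one_le_one_add_log_card A
    nlinarith [sq_nonneg ((A + A).card : ℝ)]
  linarith

lemma card_detPairs_le (A : Finset ℝ) (hA : A.Nonempty) (t : ℝ) (ht : t ≠ 0) :
    ((detPairs A t).card : ℝ) ≤
      455 * ((A + A).card : ℝ) ^ 3 / A.card * (1 + Real.log A.card) := by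
  set L := 1 + Real.log A.card with hL
  have hL1 : 1 ≤ L := one_le_one_add_log_card A
  have hN : (0 : ℝ) < A.card := by exact_mod_cast hA.card_pos
  have hNn : (A.card : ℝ) ≤ (A + A).card := by exact_mod_cast card_le_card_add_self A
  set I : Finset (Σ _ : ℝ, Σ _ : ℝ, ℝ) :=
    (slopes A).sigma fun m => (dilationPoints A m).sigma fun a =>
      A.filter fun c => m * c + t / a ∈ A with hI
  set Z : Finset ((ℝ × ℝ) × (ℝ × ℝ)) :=
    ((A ×ˢ A).image fun p => ((0, p.1), (-t / p.1, p.2))) ∪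
    ((A ×ˢ A).image fun p => ((p.1, 0), (p.2, t / p.1)))
    with hZ
  have hZc : Z.card ≤ 2 * A.card ^ 2 := by
    have hi : ∀ f : ℝ × ℝ → (ℝ × ℝ) × (ℝ × ℝ), ((A ×ˢ A).image f).card ≤ A.card ^ 2 :=
      fun f => Finset.card_image_le.trans (by rw [Finset.card_product, sq])
    refine (Finset.card_union_le _ _).trans ((Nat.add_le_add (hi _) (hi _)).trans ?_)
    omega
  have hIc : (I.card : ℝ) ≤ 453 * ((A + A).card : ℝ) ^ 3 / A.card * L := by
    have h1 : (I.card : ℝ) ≤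
        ∑ m ∈ slopes A, ((dilationPoints A m).card : ℝ) * (maxRichness A m : ℝ) := by
      rw [hI, Finset.card_sigma]
      push_cast [Finset.card_sigma]
      refine Finset.sum_le_sum fun m _ => ?_
      rw [← nsmul_eq_mul, ← Finset.sum_const]
      exact Finset.sum_le_sum fun a _ => by exact_mod_cast card_filter_le_maxRichness A m (t / a)
    refine h1.trans (abs_le_of_sq_le_sq' ?_ (by positivity)).2
    refine (Finset.sum_mul_sq_le_sq_mul_sq _ _ _).trans ((mul_le_mul
      (sum_sq_card_dilationPoints_le A hA) (sum_sq_maxRichness_le A hA)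
      (Finset.sum_nonneg fun _ _ => sq_nonneg _) (by positivity)).trans ?_)
    rw [← hL]
    have e1 : 16 * ((A + A).card : ℝ) ^ 2 * L * (12800 * (A + A).card ^ 4 / A.card ^ 2 * L) =
        204800 * (((A + A).card : ℝ) ^ 3 / A.card * L) ^ 2 := by ring
    have e2 : (453 * ((A + A).card : ℝ) ^ 3 / A.card * L) ^ 2 =
        205209 * (((A + A).card : ℝ) ^ 3 / A.card * L) ^ 2 := by ring
    rw [e1, e2]
    nlinarith [sq_nonneg (((A + A).card : ℝ) ^ 3 / A.card * L)]
  have hsplit : (detPairs A t \ Z).card ≤ I.card := by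
    have hmem : ∀ a b c d : ℝ, ((a, b), (c, d)) ∈ detPairs A t \ Z →
        a ≠ 0 ∧ b ≠ 0 ∧ d = b / a * c + t / a ∧ a ∈ A ∧ b ∈ A ∧ c ∈ A ∧ d ∈ A := by
      intro a b c d h
      obtain ⟨h1, h2⟩ := Finset.mem_sdiff.mp h
      obtain ⟨⟨⟨ha, hb⟩, hc, hd⟩, hdet⟩ := mem_detPairs.mp h1
      simp only [hZ, Finset.mem_union, Finset.mem_image, Finset.mem_product, Prod.mk.injEq,
        Prod.exists, not_or, not_exists, not_and, and_imp] at h2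
      have ha0 : a ≠ 0 := by
        rintro rfl
        have hb0 : b ≠ 0 := by rintro rfl; apply ht; linarith
        exact h2.1 b d hb hd rfl rfl (by field_simp; linarith) rfl
      have hb0 : b ≠ 0 := by
        rintro rfl
        exact h2.2 a c ha hc rfl rfl rfl (by field_simp; linarith)
      refine ⟨ha0, hb0, ?_, ha, hb, hc, hd⟩
      field_simp
      linarith
    refine Finset.card_le_card_of_injOn
      (fun e => (⟨e.1.2 / e.1.1, ⟨e.1.1, e.2.1⟩⟩ : Σ _ : ℝ, Σ _ : ℝ, ℝ)) ?_ ?_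
    · rintro ⟨⟨a, b⟩, c, d⟩ he
      obtain ⟨ha0, hb0, hd0, ha, hb, hc, hd⟩ := hmem a b c d he
      refine Finset.mem_coe.mpr (Finset.mem_sigma.mpr ⟨Finset.mem_image.mpr ⟨(a, b), ?_, rfl⟩,
        Finset.mem_sigma.mpr ⟨Finset.mem_filter.mpr ⟨ha, ha0, ?_⟩,
        Finset.mem_filter.mpr ⟨hc, ?_⟩⟩⟩)
      · simp [ha, hb, ha0, hb0]
      · simpa [ha0] using hb
      · exact hd0 ▸ hd
    · rintro ⟨⟨a, b⟩, c, d⟩ he ⟨⟨a', b'⟩, c', d'⟩ he' hee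
      obtain ⟨ha0, -, hd0, -⟩ := hmem a b c d he
      obtain ⟨-, -, hd0', -⟩ := hmem a' b' c' d' he'
      simp only [Sigma.mk.injEq, heq_eq_eq] at hee
      obtain ⟨h1, rfl, rfl⟩ := hee
      have hb : b = b' := by field_simp at h1; exact h1
      subst hb
      rw [hd0, hd0']
  have hle := Finset.card_le_card_sdiff_add_card (t := Z) (s := detPairs A t)
  have h1 : ((detPairs A t).card : ℝ) ≤ I.card + 2 * (A.card : ℝ) ^ 2 := by
    exact_mod_cast hle.trans (Nat.add_le_add hsplit hZc)
  have h2 : (A.card : ℝ) ^ 2 ≤ ((A + A).card : ℝ) ^ 3 / A.card * L := by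
    have h4 := pow_le_pow_left₀ hN.le hNn 3
    have h5 : (A.card : ℝ) ^ 2 ≤ ((A + A).card : ℝ) ^ 3 / A.card := by
      rw [le_div_iff₀ hN]; linarith [pow_succ (A.card : ℝ) 2]
    exact h5.trans (le_mul_of_one_le_right (by positivity) hL1)
  have e3 : 455 * ((A + A).card : ℝ) ^ 3 / A.card * L =
      453 * ((A + A).card : ℝ) ^ 3 / A.card * L +
      2 * (((A + A).card : ℝ) ^ 3 / A.card * L) := by ring
  rw [e3]
  linarith

/-- The difference `p - q` has prescribed determinants with the two vectors of `e`. -/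
def LinRel (e : (ℝ × ℝ) × (ℝ × ℝ)) (α p q : ℝ × ℝ) : Prop :=
  wedge (p - q) e.1 = α.1 ∧ wedge (p - q) e.2 = α.2

noncomputable instance (e : (ℝ × ℝ) × (ℝ × ℝ)) (α p q : ℝ × ℝ) : Decidable (LinRel e α p q) :=
  inferInstanceAs (Decidable (_ ∧ _))

lemma LinRel.symm {e : (ℝ × ℝ) × (ℝ × ℝ)} {α p q : ℝ × ℝ} (h : LinRel e α p q) :
    LinRel e (-α) q p := by
  obtain ⟨h1, h2⟩ := h
  simp only [wedge, Prod.fst_sub, Prod.snd_sub] at h1 h2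
  constructor <;> simp only [wedge, Prod.fst_sub, Prod.snd_sub, Prod.fst_neg, Prod.snd_neg] <;>
    linarith

lemma LinRel.unique {e : (ℝ × ℝ) × (ℝ × ℝ)} {α p q q' : ℝ × ℝ} (he : wedge e.1 e.2 ≠ 0)
    (h : LinRel e α p q) (h' : LinRel e α p q') : q = q' := by
  obtain ⟨h1, h2⟩ := h
  obtain ⟨h3, h4⟩ := h'
  simp only [wedge, Prod.fst_sub, Prod.snd_sub] at h1 h2 h3 h4 he
  ext
  · refine mul_right_cancel₀ he ?_
    linear_combination e.2.1 * (h1 - h3) - e.1.1 * (h2 - h4)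
  · refine mul_right_cancel₀ he ?_
    linear_combination e.2.2 * (h1 - h3) - e.1.2 * (h2 - h4)

lemma card_linRel_le (A : Finset ℝ) (e : (ℝ × ℝ) × (ℝ × ℝ)) (he : e ≠ 0) (α p : ℝ × ℝ) :
    ((A ×ˢ A).filter fun q => LinRel e α p q).card ≤ A.card := by
  have key : ∀ a b : ℝ, (a, b) ≠ (0, 0) → ∀ c : ℝ, ∀ F : Finset (ℝ × ℝ), F ⊆ A ×ˢ A →
      (∀ q ∈ F, a * q.1 + b * q.2 = c) → F.card ≤ A.card := by
    intro a b hab c F hF h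
    by_cases ha : a = 0
    · have hb : b ≠ 0 := fun hb => hab (by rw [ha, hb])
      refine Finset.card_le_card_of_injOn Prod.fst
        (fun q hq => (Finset.mem_product.mp (hF hq)).1) fun q hq r hr hqr => ?_
      refine Prod.ext hqr (mul_left_cancel₀ hb ?_)
      have := h q hq
      have := h r hr
      rw [ha] at *
      linarith
    · refine Finset.card_le_card_of_injOn Prod.snd
        (fun q hq => (Finset.mem_product.mp (hF hq)).2) fun q hq r hr hqr => ?_
      refine Prod.ext (mul_left_cancel₀ ha ?_) hqr
      have h1 := h q hq
      have h2 := h r hr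
      rw [hqr] at h1
      linarith
  have hcase : e.1 ≠ 0 ∨ e.2 ≠ 0 := by
    by_contra! h
    exact he (Prod.ext h.1 h.2)
  rcases hcase with hu | hu
  · refine key (-e.1.2) e.1.1 (fun h => hu ?_) (α.1 - (p.1 * e.1.2 - p.2 * e.1.1)) _
      (Finset.filter_subset _ _) fun q hq => ?_
    · simp only [Prod.mk.injEq, neg_eq_zero] at h
      exact Prod.ext h.2 h.1
    · have := (Finset.mem_filter.mp hq).2.1
      simp only [wedge, Prod.fst_sub, Prod.snd_sub] at this
      linarith
  · refine key (-e.2.2) e.2.1 (fun h => hu ?_) (α.2 - (p.1 * e.2.2 - p.2 * e.2.1)) _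
      (Finset.filter_subset _ _) fun q hq => ?_
    · simp only [Prod.mk.injEq, neg_eq_zero] at h
      exact Prod.ext h.2 h.1
    · have := (Finset.mem_filter.mp hq).2.2
      simp only [wedge, Prod.fst_sub, Prod.snd_sub] at this
      linarith

/-- Cyclic triples of points of `A × A` satisfying prescribed linear relations. -/
noncomputable def diagTriples (A : Finset ℝ) (e₁ e₂ e₃ : (ℝ × ℝ) × (ℝ × ℝ)) (α₁ α₂ α₃ : ℝ × ℝ) :
    Finset ((ℝ × ℝ) × (ℝ × ℝ) × (ℝ × ℝ)) :=
  ((A ×ˢ A) ×ˢ (A ×ˢ A) ×ˢ (A ×ˢ A)).filter fun p =>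
    LinRel e₁ α₁ p.1 p.2.1 ∧ LinRel e₂ α₂ p.2.1 p.2.2 ∧ LinRel e₃ α₃ p.2.2 p.1

lemma mem_diagTriples {A : Finset ℝ} {e₁ e₂ e₃ : (ℝ × ℝ) × (ℝ × ℝ)} {α₁ α₂ α₃ p q r : ℝ × ℝ} :
    (p, q, r) ∈ diagTriples A e₁ e₂ e₃ α₁ α₂ α₃ ↔
      (p ∈ A ×ˢ A ∧ q ∈ A ×ˢ A ∧ r ∈ A ×ˢ A) ∧
      LinRel e₁ α₁ p q ∧ LinRel e₂ α₂ q r ∧ LinRel e₃ α₃ r p := by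
  rw [diagTriples, Finset.mem_filter, Finset.mem_product, Finset.mem_product (p := (p, q, r).2)]

lemma card_diagTriples_rotate (A : Finset ℝ) (e₁ e₂ e₃ : (ℝ × ℝ) × (ℝ × ℝ))
    (α₁ α₂ α₃ : ℝ × ℝ) : (diagTriples A e₁ e₂ e₃ α₁ α₂ α₃).card ≤
      (diagTriples A e₂ e₃ e₁ α₂ α₃ α₁).card := by
  refine Finset.card_le_card_of_injOn (fun p => (p.2.1, p.2.2, p.1)) ?_ ?_
  · rintro ⟨p, q, r⟩ h
    have := mem_diagTriples.mp h
    exact mem_diagTriples.mpr (by tauto)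
  · rintro ⟨p, q, r⟩ - ⟨p', q', r'⟩ - h
    simp only [Prod.mk.injEq] at h ⊢
    tauto

lemma card_diagTriples_le (A : Finset ℝ) (e₁ e₂ e₃ : (ℝ × ℝ) × (ℝ × ℝ))
    (α₁ α₂ α₃ : ℝ × ℝ) : (diagTriples A e₁ e₂ e₃ α₁ α₂ α₃).card ≤ A.card ^ 6 := by
  rw [diagTriples]
  refine (Finset.card_filter_le _ _).trans (le_of_eq ?_)
  simp only [Finset.card_product]
  ring

lemma card_diagTriples_le_of_ne (A : Finset ℝ) (e₁ e₂ e₃ : (ℝ × ℝ) × (ℝ × ℝ))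
    (α₁ α₂ α₃ : ℝ × ℝ) (h₁ : e₁ ≠ 0) (h₂ : e₂ ≠ 0) :
    (diagTriples A e₁ e₂ e₃ α₁ α₂ α₃).card ≤ A.card ^ 4 := by
  have h : (diagTriples A e₁ e₂ e₃ α₁ α₂ α₃).card ≤ ((A ×ˢ A).sigma fun q =>
      ((A ×ˢ A).filter fun p => LinRel e₁ (-α₁) q p) ×ˢ
      ((A ×ˢ A).filter fun r => LinRel e₂ α₂ q r)).card := by
    refine Finset.card_le_card_of_injOn
      (fun p => (⟨p.2.1, (p.1, p.2.2)⟩ : Σ _ : ℝ × ℝ, (ℝ × ℝ) × (ℝ × ℝ))) ?_ ?_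
    · rintro ⟨p, q, r⟩ h
      obtain ⟨⟨hp, hq, hr⟩, h1, h2, -⟩ := mem_diagTriples.mp h
      exact Finset.mem_coe.mpr (Finset.mem_sigma.mpr ⟨hq, Finset.mem_product.mpr
        ⟨Finset.mem_filter.mpr ⟨hp, h1.symm⟩, Finset.mem_filter.mpr ⟨hr, h2⟩⟩⟩)
    · rintro ⟨p, q, r⟩ - ⟨p', q', r'⟩ - h
      simp only [Sigma.mk.injEq, heq_eq_eq, Prod.mk.injEq] at h ⊢
      tauto
  refine h.trans ?_
  rw [Finset.card_sigma]
  refine (Finset.sum_le_card_nsmul _ _ (A.card * A.card) fun q _ => ?_).trans (le_of_eq ?_)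
  · rw [Finset.card_product]
    exact Nat.mul_le_mul (card_linRel_le A e₁ h₁ _ _) (card_linRel_le A e₂ h₂ _ _)
  · rw [Finset.card_product, smul_eq_mul]; ring

lemma card_diagTriples_le_of_wedge_ne (A : Finset ℝ) (e₁ e₂ e₃ : (ℝ × ℝ) × (ℝ × ℝ))
    (α₁ α₂ α₃ : ℝ × ℝ) (h₁ : wedge e₁.1 e₁.2 ≠ 0) (h₂ : wedge e₂.1 e₂.2 ≠ 0) :
    (diagTriples A e₁ e₂ e₃ α₁ α₂ α₃).card ≤ A.card ^ 2 := by
  rw [sq, ← Finset.card_product]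
  refine Finset.card_le_card_of_injOn Prod.fst ?_ ?_
  · rintro ⟨p, q, r⟩ h
    exact (mem_diagTriples.mp h).1.1
  · rintro ⟨p, q, r⟩ h ⟨p', q', r'⟩ h' hp
    obtain ⟨-, g1, g2, -⟩ := mem_diagTriples.mp h
    obtain ⟨-, g1', g2', -⟩ := mem_diagTriples.mp h'
    simp only at hp
    subst hp
    have hq := g1.unique h₁ g1'
    subst hq
    rw [g2.unique h₂ g2']

/-- The triples of off-diagonal pairs with equal determinants. -/
noncomputable def offDiagTriples (A : Finset ℝ) :
    Finset (((ℝ × ℝ) × (ℝ × ℝ)) × ((ℝ × ℝ) × (ℝ × ℝ)) × ((ℝ × ℝ) × (ℝ × ℝ))) :=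
  (((A ×ˢ A) ×ˢ (A ×ˢ A)) ×ˢ ((A ×ˢ A) ×ˢ (A ×ˢ A)) ×ˢ ((A ×ˢ A) ×ˢ (A ×ˢ A))).filter fun e =>
    wedge e.1.1 e.1.2 = wedge e.2.1.1 e.2.1.2 ∧ wedge e.2.1.1 e.2.1.2 = wedge e.2.2.1 e.2.2.2

/-- The off-diagonal and diagonal data satisfied by commuting `3 × 3` matrices. -/
noncomputable def commTuples (A : Finset ℝ) :
    Finset (Σ _ : ((ℝ × ℝ) × (ℝ × ℝ)) × ((ℝ × ℝ) × (ℝ × ℝ)) × ((ℝ × ℝ) × (ℝ × ℝ)),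
      (ℝ × ℝ) × (ℝ × ℝ) × (ℝ × ℝ)) :=
  (offDiagTriples A).sigma fun e => diagTriples A e.1 e.2.1 e.2.2
    (-wedge e.2.2.2 e.2.1.2, wedge e.2.1.1 e.2.2.1)
    (-wedge e.1.2 e.2.2.2, wedge e.2.2.1 e.1.1)
    (-wedge e.2.1.2 e.1.2, wedge e.1.1 e.2.1.1)

lemma card_commTuples_le (A : Finset ℝ) (M : ℕ) (hM : ∀ t ≠ 0, (detPairs A t).card ≤ M) :
    (commTuples A).card ≤ A.card ^ 4 * M ^ 2 * A.card ^ 2 +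
      (detPairs A 0).card ^ 3 * A.card ^ 4 + 3 * A.card ^ 4 * A.card ^ 6 := by
  set N := A.card with hN
  set E := (A ×ˢ A) ×ˢ (A ×ˢ A) with hE
  have hEc : E.card = N ^ 4 := by simp only [hE, Finset.card_product]; ring
  set G := offDiagTriples A with hG
  set G₁ := G.filter fun e => wedge e.1.1 e.1.2 ≠ 0 with hG₁
  set G₀ := G.filter fun e => wedge e.1.1 e.1.2 = 0 with hG₀
  set H := G.filter fun e => (e.1 = 0 ∧ e.2.1 = 0) ∨ (e.2.1 = 0 ∧ e.2.2 = 0) ∨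
    (e.2.2 = 0 ∧ e.1 = 0) with hH
  have hmemG : ∀ e ∈ G, (e.1 ∈ E ∧ e.2.1 ∈ E ∧ e.2.2 ∈ E) ∧
      wedge e.1.1 e.1.2 = wedge e.2.1.1 e.2.1.2 ∧
      wedge e.2.1.1 e.2.1.2 = wedge e.2.2.1 e.2.2.2 := by
    intro e he
    obtain ⟨h1, h2⟩ := Finset.mem_filter.mp he
    obtain ⟨h3, h4⟩ := Finset.mem_product.mp h1
    obtain ⟨h5, h6⟩ := Finset.mem_product.mp h4
    exact ⟨⟨h3, h5, h6⟩, h2⟩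
  have hc₁ : G₁.card ≤ N ^ 4 * M ^ 2 := by
    have h : G₁.card ≤ ((E.filter fun e => wedge e.1 e.2 ≠ 0).sigma fun e =>
        detPairs A (wedge e.1 e.2) ×ˢ detPairs A (wedge e.1 e.2)).card := by
      refine Finset.card_le_card_of_injOn (fun e => (⟨e.1, e.2⟩ : Σ _ : _, _)) ?_ ?_
      · intro e he
        obtain ⟨h1, h2⟩ := Finset.mem_filter.mp he
        obtain ⟨⟨h3, h4, h5⟩, h6, h7⟩ := hmemG e h1
        refine Finset.mem_coe.mpr (Finset.mem_sigma.mpr ⟨Finset.mem_filter.mpr ⟨h3, h2⟩,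
          Finset.mem_product.mpr ⟨Finset.mem_filter.mpr ⟨h4, h6.symm⟩,
            Finset.mem_filter.mpr ⟨h5, ?_⟩⟩⟩)
        rw [h6, h7]
      · rintro ⟨a, b⟩ - ⟨c, d⟩ - h
        simpa using h
    refine h.trans ?_
    rw [Finset.card_sigma]
    refine (Finset.sum_le_card_nsmul _ _ (M ^ 2) fun e he => ?_).trans ?_
    · have := hM _ (Finset.mem_filter.mp he).2
      rw [Finset.card_product, sq]
      exact Nat.mul_le_mul this this
    · rw [smul_eq_mul, ← hEc]
      exact Nat.mul_le_mul_right _ (Finset.card_filter_le _ _)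
  have hc₀ : G₀.card ≤ (detPairs A 0).card ^ 3 := by
    have h : G₀ ⊆ detPairs A 0 ×ˢ detPairs A 0 ×ˢ detPairs A 0 := by
      intro e he
      obtain ⟨h1, h2⟩ := Finset.mem_filter.mp he
      obtain ⟨⟨h3, h4, h5⟩, h6, h7⟩ := hmemG e h1
      refine Finset.mem_product.mpr ⟨Finset.mem_filter.mpr ⟨h3, h2⟩, Finset.mem_product.mpr
        ⟨Finset.mem_filter.mpr ⟨h4, ?_⟩, Finset.mem_filter.mpr ⟨h5, ?_⟩⟩⟩
      · rw [← h6, h2]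
      · rw [← h7, ← h6, h2]
    refine (Finset.card_le_card h).trans (le_of_eq ?_)
    simp only [Finset.card_product]
    ring
  have hcH : H.card ≤ 3 * N ^ 4 := by
    have h : H ⊆ (E.image fun x => (0, 0, x)) ∪
        ((E.image fun x => (x, 0, 0)) ∪ (E.image fun x => (0, x, 0))) := by
      rintro ⟨x, y, z⟩ he
      obtain ⟨h1, h2⟩ := Finset.mem_filter.mp he
      obtain ⟨⟨h3, h4, h5⟩, -⟩ := hmemG _ h1
      simp only [Finset.mem_union, Finset.mem_image, Prod.mk.injEq] at h2 h3 h4 h5 ⊢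
      rcases h2 with ⟨rfl, rfl⟩ | ⟨rfl, rfl⟩ | ⟨rfl, rfl⟩
      · exact Or.inl ⟨z, h5, rfl, rfl, rfl⟩
      · exact Or.inr (Or.inl ⟨x, h3, rfl, rfl, rfl⟩)
      · exact Or.inr (Or.inr ⟨y, h4, rfl, rfl, rfl⟩)
    refine (Finset.card_le_card h).trans ((Finset.card_union_le _ _).trans
      ((Nat.add_le_add Finset.card_image_le ((Finset.card_union_le _ _).trans
        (Nat.add_le_add Finset.card_image_le Finset.card_image_le))).trans ?_))
    omega
  rw [commTuples, Finset.card_sigma]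
  have hpt : ∀ e ∈ G, ∀ α₁ α₂ α₃ : ℝ × ℝ, (diagTriples A e.1 e.2.1 e.2.2 α₁ α₂ α₃).card ≤
      (if wedge e.1.1 e.1.2 ≠ 0 then N ^ 2 else 0) +
      (if wedge e.1.1 e.1.2 = 0 then N ^ 4 else 0) +
      (if (e.1 = 0 ∧ e.2.1 = 0) ∨ (e.2.1 = 0 ∧ e.2.2 = 0) ∨ (e.2.2 = 0 ∧ e.1 = 0)
        then N ^ 6 else 0) := by
    intro e he α₁ α₂ α₃
    obtain ⟨-, h6, h7⟩ := hmemG e he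
    by_cases ht : wedge e.1.1 e.1.2 = 0
    · by_cases hz : (e.1 = 0 ∧ e.2.1 = 0) ∨ (e.2.1 = 0 ∧ e.2.2 = 0) ∨ (e.2.2 = 0 ∧ e.1 = 0)
      · rw [if_pos hz]
        exact (card_diagTriples_le A _ _ _ α₁ α₂ α₃).trans (Nat.le_add_left _ _)
      · rw [if_neg hz, if_pos ht, if_neg (not_not.mpr ht)]
        simp only [zero_add, add_zero]
        have hz' : (e.1 ≠ 0 ∧ e.2.1 ≠ 0) ∨ (e.2.1 ≠ 0 ∧ e.2.2 ≠ 0) ∨ (e.2.2 ≠ 0 ∧ e.1 ≠ 0) := by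
          tauto
        rcases hz' with ⟨g1, g2⟩ | ⟨g1, g2⟩ | ⟨g1, g2⟩
        · exact card_diagTriples_le_of_ne A _ _ _ _ _ _ g1 g2
        · exact (card_diagTriples_rotate A _ _ _ _ _ _).trans
            (card_diagTriples_le_of_ne A _ _ _ _ _ _ g1 g2)
        · exact ((card_diagTriples_rotate A _ _ _ _ _ _).trans
            (card_diagTriples_rotate A _ _ _ _ _ _)).trans
            (card_diagTriples_le_of_ne A _ _ _ _ _ _ g1 g2)
    · rw [if_pos ht, add_assoc]
      exact (card_diagTriples_le_of_wedge_ne A _ _ _ _ _ _ ht (h6 ▸ ht)).trans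
        (Nat.le_add_right _ _)
  refine (Finset.sum_le_sum fun e he => hpt e he _ _ _).trans ?_
  rw [Finset.sum_add_distrib, Finset.sum_add_distrib, ← Finset.sum_filter, ← Finset.sum_filter,
    ← Finset.sum_filter, Finset.sum_const, Finset.sum_const, Finset.sum_const]
  simp only [smul_eq_mul]
  exact Nat.add_le_add (Nat.add_le_add (Nat.mul_le_mul_right _ hc₁) (Nat.mul_le_mul_right _ hc₀))
    (Nat.mul_le_mul_right _ hcH)

/-- The pair of vectors of `ij` and `ji` entries of a pair of matrices. -/
def entryPair (AB : Matrix (Fin 3) (Fin 3) ℝ × Matrix (Fin 3) (Fin 3) ℝ) (i j : Fin 3) : ℝ × ℝ :=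
  (AB.1 i j, AB.2 i j)

lemma wedge_entryPair_of_comm {AB : Matrix (Fin 3) (Fin 3) ℝ × Matrix (Fin 3) (Fin 3) ℝ}
    (h : AB.1 * AB.2 = AB.2 * AB.1) (i j : Fin 3) :
    ∑ k, wedge (entryPair AB i k) (entryPair AB k j) = 0 := by
  have h1 := congrFun (congrFun h i) j
  rw [Matrix.mul_apply, Matrix.mul_apply, ← sub_eq_zero, ← Finset.sum_sub_distrib] at h1
  rw [← h1]
  refine Finset.sum_congr rfl fun k _ => ?_
  simp [wedge, entryPair]

lemma exists_injOn_commTuples (A : Finset ℝ) :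
    ∃ f : {AB : Matrix (Fin 3) (Fin 3) ℝ × Matrix (Fin 3) (Fin 3) ℝ //
      (∀ i j, AB.1 i j ∈ A) ∧ (∀ i j, AB.2 i j ∈ A) ∧ AB.1 * AB.2 = AB.2 * AB.1} →
      commTuples A, Function.Injective f := by
  refine ⟨fun M => ⟨⟨((entryPair M.1 0 1, entryPair M.1 1 0),
    (entryPair M.1 1 2, entryPair M.1 2 1), (entryPair M.1 2 0, entryPair M.1 0 2)),
    (entryPair M.1 0 0, entryPair M.1 1 1, entryPair M.1 2 2)⟩, ?_⟩, ?_⟩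
  · obtain ⟨AB, hA, hB, hAB⟩ := M
    have hmem : ∀ i j, entryPair AB i j ∈ A ×ˢ A := fun i j =>
      Finset.mk_mem_product (hA i j) (hB i j)
    have hw := wedge_entryPair_of_comm hAB
    simp only [Fin.sum_univ_three] at hw
    refine Finset.mem_sigma.mpr ⟨Finset.mem_filter.mpr ⟨?_, ?_, ?_⟩,
      mem_diagTriples.mpr ⟨⟨hmem _ _, hmem _ _, hmem _ _⟩, ⟨?_, ?_⟩, ⟨?_, ?_⟩, ⟨?_, ?_⟩⟩⟩
    · exact Finset.mk_mem_product (Finset.mk_mem_product (hmem _ _) (hmem _ _))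
        (Finset.mk_mem_product (Finset.mk_mem_product (hmem _ _) (hmem _ _))
          (Finset.mk_mem_product (hmem _ _) (hmem _ _)))
    · have := hw 1 1
      simp only [wedge, entryPair] at this ⊢
      linarith
    · have := hw 2 2
      simp only [wedge, entryPair] at this ⊢
      linarith
    · have := hw 0 1
      simp only [wedge, entryPair, Prod.fst_sub, Prod.snd_sub] at this ⊢
      linarith
    · have := hw 1 0
      simp only [wedge, entryPair, Prod.fst_sub, Prod.snd_sub] at this ⊢
      linarith
    · have := hw 1 2
      simp only [wedge, entryPair, Prod.fst_sub, Prod.snd_sub] at this ⊢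
      linarith
    · have := hw 2 1
      simp only [wedge, entryPair, Prod.fst_sub, Prod.snd_sub] at this ⊢
      linarith
    · have := hw 2 0
      simp only [wedge, entryPair, Prod.fst_sub, Prod.snd_sub] at this ⊢
      linarith
    · have := hw 0 2
      simp only [wedge, entryPair, Prod.fst_sub, Prod.snd_sub] at this ⊢
      linarith
  · rintro ⟨⟨X, Y⟩, h⟩ ⟨⟨X', Y'⟩, h'⟩ he
    simp only [entryPair, Subtype.mk.injEq, Sigma.mk.injEq, heq_eq_eq, Prod.mk.injEq] at he
    refine Subtype.ext (Prod.ext ?_ ?_) <;>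
    · ext i j
      fin_cases i <;> fin_cases j <;> simp_all

lemma commCount3_le_card_commTuples (A : Finset ℝ) : commCount3 A ≤ (commTuples A).card := by
  obtain ⟨f, hf⟩ := exists_injOn_commTuples A
  have := Nat.card_le_card_of_injective f hf
  exact this.trans (by rw [Nat.card_eq_fintype_card, Fintype.card_coe])

/-- The pairs in `A × A` with difference `d`. -/
noncomputable def diffPairs (A : Finset ℝ) (d : ℝ) : Finset (ℝ × ℝ) :=
  (A ×ˢ A).filter fun p => p.2 - p.1 = d

/-- The differences between elements of `A`. -/
noncomputable def differences (A : Finset ℝ) : Finset ℝ := (A ×ˢ A).image fun p => p.2 - p.1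

lemma card_pow_six_mul_sum_le_commCount3 (A : Finset ℝ) :
    A.card ^ 6 * ∑ d ∈ differences A, (diffPairs A d).card ^ 3 ≤ commCount3 A := by
  obtain ⟨f, hf⟩ := exists_injOn_commTuples A
  have := Finite.of_injective f hf
  set W := (Fintype.piFinset fun _ : Fin 6 => A) ×ˢ ((differences A).sigma fun d =>
    diffPairs A d ×ˢ diffPairs A d ×ˢ diffPairs A d) with hW
  have hWc : W.card = A.card ^ 6 * ∑ d ∈ differences A, (diffPairs A d).card ^ 3 := by
    rw [hW, Finset.card_product, Fintype.card_piFinset_const, Finset.card_sigma]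
    congr 1
    refine Finset.sum_congr rfl fun d _ => ?_
    simp only [Finset.card_product]
    ring
  rw [← hWc, ← Fintype.card_coe, ← Nat.card_eq_fintype_card]
  have hmem : ∀ w : W, (∀ i, w.1.1 i ∈ A) ∧
      ∀ q ∈ [w.1.2.2.1, w.1.2.2.2.1, w.1.2.2.2.2], q.1 ∈ A ∧ q.2 ∈ A ∧ q.2 = q.1 + w.1.2.1 := by
    rintro ⟨⟨o, d, p, q, r⟩, hw⟩
    obtain ⟨h1, h2⟩ := Finset.mem_product.mp hw
    obtain ⟨-, h3⟩ := Finset.mem_sigma.mp h2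
    obtain ⟨hp, h4⟩ := Finset.mem_product.mp h3
    obtain ⟨hq, hr⟩ := Finset.mem_product.mp h4
    have key : ∀ x ∈ diffPairs A d, x.1 ∈ A ∧ x.2 ∈ A ∧ x.2 = x.1 + d := fun x hx => by
      obtain ⟨g1, g2⟩ := Finset.mem_filter.mp hx
      obtain ⟨g3, g4⟩ := Finset.mem_product.mp g1
      exact ⟨g3, g4, by linarith⟩
    refine ⟨fun i => Fintype.mem_piFinset.mp h1 i, ?_⟩
    simp only [List.mem_cons, List.not_mem_nil, or_false, forall_eq_or_imp, forall_eq]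
    exact ⟨key _ hp, key _ hq, key _ hr⟩
  simp only [List.mem_cons, List.not_mem_nil, or_false, forall_eq_or_imp, forall_eq] at hmem
  refine Nat.card_le_card_of_injective (fun w => ⟨
    (!![w.1.2.2.1.1, w.1.1 0, w.1.1 1; w.1.1 2, w.1.2.2.2.1.1, w.1.1 3;
        w.1.1 4, w.1.1 5, w.1.2.2.2.2.1],
     !![w.1.2.2.1.2, w.1.1 0, w.1.1 1; w.1.1 2, w.1.2.2.2.1.2, w.1.1 3;
        w.1.1 4, w.1.1 5, w.1.2.2.2.2.2]), ?_, ?_, ?_⟩) ?_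
  · obtain ⟨h1, h2, h3, h4⟩ := hmem w
    intro i j
    fin_cases i <;> fin_cases j <;> simp [h1, h2, h3, h4]
  · obtain ⟨h1, ⟨-, h2, -⟩, ⟨-, h3, -⟩, -, h4, -⟩ := hmem w
    intro i j
    fin_cases i <;> fin_cases j <;> simp [h1, h2, h3, h4]
  · obtain ⟨-, ⟨-, -, h2⟩, ⟨-, -, h3⟩, -, -, h4⟩ := hmem w
    simp only
    rw [h2, h3, h4]
    ext i j
    fin_cases i <;> fin_cases j <;>
      simp [Matrix.mul_apply, Fin.sum_univ_three] <;> ring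
  · intro w w' he
    obtain ⟨-, ⟨-, -, hd⟩, -⟩ := hmem w
    obtain ⟨-, ⟨-, -, hd'⟩, -⟩ := hmem w'
    obtain ⟨⟨o, d, p, q, r⟩, hw⟩ := w
    obtain ⟨⟨o', d', p', q', r'⟩, hw'⟩ := w'
    simp only [Subtype.mk.injEq, Prod.mk.injEq] at he hd hd'
    obtain ⟨hX, hY⟩ := he
    have hX' := fun i j => congrFun (congrFun hX i) j
    have hY' := fun i j => congrFun (congrFun hY i) j
    simp only [Fin.forall_fin_succ, Matrix.of_apply, Matrix.cons_val', Matrix.cons_val_zero,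
      Matrix.cons_val_succ, Matrix.cons_val_fin_one, IsEmpty.forall_iff, and_true] at hX' hY'
    obtain ⟨⟨x00, x01, x02⟩, ⟨x10, x11, x12⟩, x20, x21, x22⟩ := hX'
    obtain ⟨⟨y00, y01, y02⟩, ⟨y10, y11, y12⟩, y20, y21, y22⟩ := hY'
    have e1 : p = p' := Prod.ext x00 y00
    have e2 : q = q' := Prod.ext x11 y11
    have e3 : r = r' := Prod.ext x22 y22
    subst e1 e2 e3
    have e4 : d = d' := by linarith
    subst e4
    have e5 : o = o' := by
      funext i
      fin_cases i <;> assumption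
    subst e5
    rfl

lemma card_pow_four_le_sum_sq_diffPairs (A : Finset ℝ) :
    A.card ^ 4 ≤ (A + A).card * ∑ d ∈ differences A, (diffPairs A d).card ^ 2 := by
  have h := Finset.le_card_add_mul_addEnergy A A
  have hE : A.addEnergy A ≤ ∑ d ∈ differences A, (diffPairs A d).card ^ 2 := by
    have h1 : A.addEnergy A ≤ ((differences A).sigma fun d =>
        diffPairs A d ×ˢ diffPairs A d).card := by
      refine Finset.card_le_card_of_injOn (fun x =>
        (⟨x.1.2 - x.1.1, ((x.1.1, x.1.2), (x.2.2, x.2.1))⟩ : Σ _ : ℝ, (ℝ × ℝ) × (ℝ × ℝ))) ?_ ?_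
      · rintro ⟨⟨a, b⟩, c, d⟩ hx
        obtain ⟨h1, h2⟩ := Finset.mem_filter.mp hx
        simp only [Finset.mem_product] at h1 h2
        obtain ⟨⟨ha, hb⟩, hc, hd⟩ := h1
        refine Finset.mem_coe.mpr (Finset.mem_sigma.mpr ⟨Finset.mem_image.mpr
          ⟨(a, b), Finset.mk_mem_product ha hb, rfl⟩, Finset.mk_mem_product
          (Finset.mem_filter.mpr ⟨Finset.mk_mem_product ha hb, rfl⟩)
          (Finset.mem_filter.mpr ⟨Finset.mk_mem_product hd hc, ?_⟩)⟩)
        simp only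
        linarith
      · rintro ⟨⟨a, b⟩, c, d⟩ - ⟨⟨a', b'⟩, c', d'⟩ - he
        simp only [Sigma.mk.injEq, heq_eq_eq, Prod.mk.injEq] at he ⊢
        tauto
    refine h1.trans (le_of_eq ?_)
    rw [Finset.card_sigma]
    exact Finset.sum_congr rfl fun d _ => by rw [Finset.card_product, sq]
  calc A.card ^ 4 = A.card ^ 2 * A.card ^ 2 := by ring
    _ ≤ _ := h
    _ ≤ _ := Nat.mul_le_mul_left _ hE

lemma card_pow_six_le_sum_cube_diffPairs (A : Finset ℝ) (hA : A.Nonempty) :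
    A.card ^ 6 ≤ (A + A).card ^ 2 * ∑ d ∈ differences A, (diffPairs A d).card ^ 3 := by
  have h1 : ∑ d ∈ differences A, (diffPairs A d).card = A.card ^ 2 := by
    rw [sq, ← Finset.card_product]
    exact (Finset.card_eq_sum_card_fiberwise fun p hp =>
      Finset.mem_image_of_mem (fun p : ℝ × ℝ => p.2 - p.1) hp).symm
  have h2 : (∑ d ∈ differences A, (diffPairs A d).card ^ 2) ^ 2 ≤
      A.card ^ 2 * ∑ d ∈ differences A, (diffPairs A d).card ^ 3 := by
    rw [← h1]
    exact Finset.sum_sq_le_sum_mul_sum_of_sq_le_mul _ (fun _ _ => Nat.zero_le _)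
      (fun _ _ => Nat.zero_le _) fun d _ => le_of_eq (by ring)
  have h3 := Nat.pow_le_pow_left (card_pow_four_le_sum_sq_diffPairs A) 2
  have h4 : 0 < A.card ^ 2 := by have := hA.card_pos; positivity
  refine Nat.le_of_mul_le_mul_left ?_ h4
  calc A.card ^ 2 * A.card ^ 6 = (A.card ^ 4) ^ 2 := by ring
    _ ≤ _ := h3
    _ = (A + A).card ^ 2 * (∑ d ∈ differences A, (diffPairs A d).card ^ 2) ^ 2 := by ring
    _ ≤ (A + A).card ^ 2 * (A.card ^ 2 * ∑ d ∈ differences A, (diffPairs A d).card ^ 3) :=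
        Nat.mul_le_mul_left _ h2
    _ = _ := by ring

lemma le_commCount3 (A : Finset ℝ) (hA : A.Nonempty) :
    A.card ^ 12 ≤ (A + A).card ^ 2 * commCount3 A := by
  calc A.card ^ 12 = A.card ^ 6 * A.card ^ 6 := by ring
    _ ≤ A.card ^ 6 * ((A + A).card ^ 2 * ∑ d ∈ differences A, (diffPairs A d).card ^ 3) :=
        Nat.mul_le_mul_left _ (card_pow_six_le_sum_cube_diffPairs A hA)
    _ = (A + A).card ^ 2 * (A.card ^ 6 * ∑ d ∈ differences A, (diffPairs A d).card ^ 3) := by ring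
    _ ≤ _ := Nat.mul_le_mul_left _ (card_pow_six_mul_sum_le_commCount3 A)

lemma commCount3_le (A : Finset ℝ) (hA : A.Nonempty) :
    (commCount3 A : ℝ) ≤
      215028 * (A + A).card ^ 6 * A.card ^ 4 * (1 + Real.log A.card) ^ 3 := by
  set L := 1 + Real.log A.card with hL
  have hL1 : 1 ≤ L := one_le_one_add_log_card A
  set N : ℝ := (A.card : ℝ) with hN
  set n : ℝ := ((A + A).card : ℝ) with hn
  have hN0 : 0 < N := by rw [hN]; exact_mod_cast hA.card_pos
  have hNn : N ≤ n := by rw [hN, hn]; exact_mod_cast card_le_card_add_self A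
  set B := 455 * n ^ 3 / N * L with hB
  have hB0 : 0 ≤ B := by positivity
  have hM : ∀ t ≠ 0, (detPairs A t).card ≤ ⌊B⌋₊ := fun t ht =>
    Nat.le_floor (card_detPairs_le A hA t ht)
  have h1 := (commCount3_le_card_commTuples A).trans (card_commTuples_le A ⌊B⌋₊ hM)
  have h2 : (commCount3 A : ℝ) ≤ N ^ 4 * (⌊B⌋₊ : ℝ) ^ 2 * N ^ 2 +
      ((detPairs A 0).card : ℝ) ^ 3 * N ^ 4 + 3 * N ^ 4 * N ^ 6 := by
    rw [hN]; exact_mod_cast h1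
  have h3 : (⌊B⌋₊ : ℝ) ^ 2 ≤ B ^ 2 := pow_le_pow_left₀ (by positivity) (Nat.floor_le hB0) 2
  have h4 : ((detPairs A 0).card : ℝ) ^ 3 ≤ (20 * n ^ 2 * L) ^ 3 :=
    pow_le_pow_left₀ (by positivity) (card_detPairs_zero_le A hA) 3
  have h5 : N ^ 6 ≤ n ^ 6 := pow_le_pow_left₀ hN0.le hNn 6
  have h6 : 1 ≤ L ^ 3 := one_le_pow₀ hL1
  have h7 : L ^ 2 ≤ L ^ 3 := pow_le_pow_right₀ hL1 (by norm_num)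
  calc (commCount3 A : ℝ) ≤ N ^ 4 * B ^ 2 * N ^ 2 + (20 * n ^ 2 * L) ^ 3 * N ^ 4 +
        3 * N ^ 4 * n ^ 6 := by
        refine h2.trans ?_
        gcongr
    _ = (n ^ 6 * N ^ 4) * (207025 * L ^ 2 + 8000 * L ^ 3 + 3) := by
        rw [hB]; field_simp; ring
    _ ≤ (n ^ 6 * N ^ 4) * (215028 * L ^ 3) := by
        refine mul_le_mul_of_nonneg_left ?_ (by positivity)
        linarith
    _ = _ := by ring

theorem commuting_3x3_small_doubling :
    ∃ c C : ℝ, 0 < c ∧ 0 < C ∧ ∀ (A : Finset ℝ) (K : ℝ), A.Nonempty → 1 ≤ K →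
      ((A + A).card : ℝ) = K * (A.card : ℝ) →
      c * K⁻¹ ^ 3 * (A.card : ℝ) ^ 10 ≤ (commCount3 A : ℝ) ∧
      (commCount3 A : ℝ) ≤ C * K ^ 6 * (A.card : ℝ) ^ 10 *
        (Real.log (2 * (A.card : ℝ))) ^ 3 := by
  refine ⟨1, 215028 * 8, one_pos, by norm_num, fun A K hA hK hAK => ⟨?_, ?_⟩⟩
  · have hN : (0 : ℝ) < A.card := by exact_mod_cast hA.card_pos
    have hK0 : 0 < K := by linarith
    have h : (A.card : ℝ) ^ 12 ≤ ((A + A).card : ℝ) ^ 2 * commCount3 A := by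
      exact_mod_cast le_commCount3 A hA
    rw [hAK] at h
    have h2 : (A.card : ℝ) ^ 10 ≤ K ^ 2 * commCount3 A := by
      refine le_of_mul_le_mul_left (a := (A.card : ℝ) ^ 2) ?_ (by positivity)
      calc (A.card : ℝ) ^ 2 * (A.card : ℝ) ^ 10 = (A.card : ℝ) ^ 12 := by ring
        _ ≤ _ := h
        _ = _ := by ring
    have h3 : K ^ 2 * (commCount3 A : ℝ) ≤ K ^ 3 * commCount3 A :=
      mul_le_mul_of_nonneg_right (pow_le_pow_right₀ hK (by norm_num)) (Nat.cast_nonneg _)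
    rw [one_mul, inv_pow, inv_mul_le_iff₀ (by positivity)]
    exact h2.trans h3
  · have hN : (1 : ℝ) ≤ A.card := by exact_mod_cast hA.card_pos
    have h := commCount3_le A hA
    have hlog : 1 + Real.log A.card ≤ 2 * Real.log (2 * A.card) := by
      rw [Real.log_mul (by norm_num) (by positivity)]
      have := Real.log_two_gt_d9
      have := Real.log_nonneg hN
      linarith
    have h0 : 0 ≤ 1 + Real.log A.card := zero_le_one.trans (one_le_one_add_log_card A)
    calc (commCount3 A : ℝ)
        ≤ 215028 * (A + A).card ^ 6 * A.card ^ 4 * (1 + Real.log A.card) ^ 3 := h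
      _ ≤ 215028 * (A + A).card ^ 6 * A.card ^ 4 * (2 * Real.log (2 * A.card)) ^ 3 := by gcongr
      _ = _ := by rw [hAK]; ring
end

section
/- There exists an absolute constant C > 0 such that the following holds. Let N ≥ 1 be an integer, let u, v be coprime non-zero integers, and let m = max{|u|, |v|}. Then the number of quadruples (a₁,a₂,b₁,b₂) of integers with −N ≤ a₁,a₂,b₁,b₂ ≤ N satisfying u(b₁ − b₂) = v(a₁ − a₂) differs from (4N³/(3m³))·(12m² − 6m(|u| + |v|) + 4|uv|) by at most C·N². -/
open Finset in
/-- The closed form of a sum of a product of two tent functions with common height. -/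
theorem sum_Icc_neg_tent_mul_tent (M P Q : ℝ) (K : ℕ) :
    ∑ h ∈ Icc (-(K : ℤ)) K, (M - P * |(h : ℝ)|) * (M - Q * |(h : ℝ)|) =
      M ^ 2 * (1 + 2 * K) - (P + Q) * M * (K * (K + 1)) +
        P * Q * (K * (K + 1) * (2 * K + 1)) / 3 := by
  induction K with
  | zero => simp; ring
  | succ K ih =>
    have hIcc : Icc (-((K + 1 : ℕ) : ℤ)) ((K + 1 : ℕ) : ℤ) =
        insert (-((K : ℤ) + 1)) (insert ((K : ℤ) + 1) (Icc (-(K : ℤ)) K)) := by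
      ext x
      simp only [mem_Icc, mem_insert]
      omega
    rw [hIcc, sum_insert (by simp only [mem_Icc, mem_insert]; omega),
      sum_insert (by simp only [mem_Icc]; omega), ih]
    have hK : |(K : ℝ) + 1| = K + 1 := abs_of_nonneg (by positivity)
    push_cast
    rw [abs_neg, hK]
    ring

/-- The closed form of the tent sum is within `O(N ^ 2)` of the corresponding integral. -/
theorem abs_tent_sum_sub_integral_le {N P Q : ℝ} {K : ℕ} (hN : 1 ≤ N) (hP : 0 ≤ P) (hPQ : P ≤ Q)
    (hQ : 1 ≤ Q) (hK : Q * K ≤ 2 * N + 1) (hK' : 2 * N + 1 ≤ Q * (K + 1)) :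
    |(2 * N + 1) ^ 2 * (1 + 2 * K) - (P + Q) * (2 * N + 1) * (K * (K + 1)) +
        P * Q * (K * (K + 1) * (2 * K + 1)) / 3 -
      4 * N ^ 3 / (3 * Q ^ 3) * (12 * Q ^ 2 - 6 * Q * (P + Q) + 4 * (P * Q))| ≤ 40 * N ^ 2 := by
  have hQ0 : 0 < Q := by linarith
  obtain ⟨t, ht⟩ : ∃ t, 2 * N + 1 = Q * (K + t) := ⟨(2 * N + 1) / Q - K, by field_simp; ring⟩
  have ht0 : 0 ≤ t := by
    rw [ht] at hK; have := le_of_mul_le_mul_left hK hQ0; linarith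
  have ht1 : t ≤ 1 := by
    rw [ht] at hK'; have := le_of_mul_le_mul_left hK' hQ0; linarith
  have hKsq : (K : ℝ) ≤ K ^ 2 := by exact_mod_cast Nat.le_self_pow two_ne_zero K
  have hK0 : (0 : ℝ) ≤ K := K.cast_nonneg
  obtain ⟨c, hc⟩ : ∃ c, c = (3 * Q - P) / (3 * Q ^ 2) := ⟨_, rfl⟩
  have hc0 : 0 ≤ c := by rw [hc]; apply div_nonneg <;> nlinarith
  have hc1 : c ≤ 1 := by rw [hc, div_le_one (by positivity)]; nlinarith
  have hmain : 4 * N ^ 3 / (3 * Q ^ 3) * (12 * Q ^ 2 - 6 * Q * (P + Q) + 4 * (P * Q)) =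
      c * (2 * N) ^ 3 := by
    rw [hc]; field_simp; ring
  have hdiff : (2 * N + 1) ^ 2 * (1 + 2 * K) - (P + Q) * (2 * N + 1) * (K * (K + 1)) +
        P * Q * (K * (K + 1) * (2 * K + 1)) / 3 - c * (2 * N + 1) ^ 3 =
      Q ^ 2 * ((K + t) * (t * (1 - t))) + P * Q * (K * (1 / 3 - t * (1 - t)) + t ^ 3 / 3) := by
    rw [hc, ht]; field_simp; ring
  have htt : 0 ≤ t * (1 - t) := mul_nonneg ht0 (by linarith)
  have htt' : t * (1 - t) ≤ 1 / 3 := by nlinarith [sq_nonneg (t - 1 / 2)]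
  have ht3 : t ^ 3 ≤ t ^ 2 := pow_le_pow_of_le_one ht0 ht1 (by norm_num)
  have hA0 : 0 ≤ (K + t) * (t * (1 - t)) := by positivity
  have hA1 : (K + t) * (t * (1 - t)) ≤ (K + t) ^ 2 := by
    rw [sq]; gcongr; linarith only [sq_nonneg t, hK0]
  have hB0 : 0 ≤ K * (1 / 3 - t * (1 - t)) + t ^ 3 / 3 :=
    add_nonneg (mul_nonneg hK0 (by linarith)) (by positivity)
  have hB1 : K * (1 / 3 - t * (1 - t)) + t ^ 3 / 3 ≤ (K + t) ^ 2 := by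
    linarith only [mul_nonneg hK0 htt, mul_nonneg hK0 ht0, sq_nonneg t, hKsq, ht3, hK0]
  have hsq : Q ^ 2 * (K + t) ^ 2 = (2 * N + 1) ^ 2 := by rw [ht]; ring
  have h1 : Q ^ 2 * ((K + t) * (t * (1 - t))) ≤ (2 * N + 1) ^ 2 := by rw [← hsq]; gcongr
  have h2 : P * Q * (K * (1 / 3 - t * (1 - t)) + t ^ 3 / 3) ≤ (2 * N + 1) ^ 2 := by
    rw [← hsq, sq Q]; gcongr
  have h1' : 0 ≤ Q ^ 2 * ((K + t) * (t * (1 - t))) := by positivity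
  have h2' : 0 ≤ P * Q * (K * (1 / 3 - t * (1 - t)) + t ^ 3 / 3) := by positivity
  have hNsq : N ≤ N ^ 2 := le_self_pow₀ hN two_ne_zero
  have hcube : (2 * N + 1) ^ 3 - (2 * N) ^ 3 = 12 * N ^ 2 + 6 * N + 1 := by ring
  have hN0 : 0 ≤ N := by linarith
  have hcube0 : 0 ≤ (2 * N + 1) ^ 3 - (2 * N) ^ 3 := by rw [hcube]; positivity
  have hcube1 : (2 * N + 1) ^ 3 - (2 * N) ^ 3 ≤ 19 * N ^ 2 := by rw [hcube]; linarith
  have hcc := mul_nonneg hc0 hcube0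
  have hcc' := mul_le_of_le_one_left hcube0 hc1
  have hsq9 : (2 * N + 1) ^ 2 ≤ 9 * N ^ 2 := by linarith only [hN, hNsq]
  rw [mul_sub] at hcc hcc'
  rw [hmain, abs_le]
  constructor <;> linarith only [hdiff, h1, h2, h1', h2', hcc, hcc', hcube1, hsq9, hN, hNsq]

open Finset in
/-- The number of points of `[-N, N]` whose translate by `d` also lies in `[-N, N]`. -/
theorem card_Icc_inter_translate {N : ℕ} {d : ℤ} (hd : |d| ≤ 2 * N + 1) :
    (#(Icc (max (-(N : ℤ)) (-N - d)) (min (N : ℤ) (N - d))) : ℝ) = 2 * N + 1 - |(d : ℝ)| := by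
  have h : ((#(Icc (max (-(N : ℤ)) (-N - d)) (min (N : ℤ) (N - d))) : ℕ) : ℤ) =
      2 * N + 1 - |d| := by
    rw [Int.card_Icc]
    rcases abs_cases d with h | h <;> omega
  exact_mod_cast h

open Finset in
/-- The solutions of `u * (b₁ - b₂) = v * (a₁ - a₂)` in a box are parametrised by the integer `h`
with `a₁ - a₂ = u * h` and `b₁ - b₂ = v * h`. -/
theorem card_u_diff_eq_v_diff {N K : ℕ} {u v : ℤ} (hu : u ≠ 0) (huv : IsCoprime u v)
    (huK : |u| * K ≤ 2 * N + 1) (hvK : |v| * K ≤ 2 * N + 1)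
    (hK : ∀ h : ℤ, |u| * |h| ≤ 2 * N → |v| * |h| ≤ 2 * N → |h| ≤ K) :
    (Nat.card {a : ℤ × ℤ × ℤ × ℤ //
        |a.1| ≤ (N : ℤ) ∧ |a.2.1| ≤ (N : ℤ) ∧ |a.2.2.1| ≤ (N : ℤ) ∧
        |a.2.2.2| ≤ (N : ℤ) ∧ u * (a.2.2.1 - a.2.2.2) = v * (a.1 - a.2.1)} : ℝ) =
      ∑ h ∈ Icc (-(K : ℤ)) K,
        (2 * N + 1 - |(u : ℝ)| * |(h : ℝ)|) * (2 * N + 1 - |(v : ℝ)| * |(h : ℝ)|) := by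
  let I : ℤ → Finset ℤ := fun d => Icc (max (-(N : ℤ)) (-N - d)) (min (N : ℤ) (N - d))
  have hI : ∀ d x, x ∈ I d ↔ |x| ≤ N ∧ |x + d| ≤ N := by
    intro d x
    simp only [I, mem_Icc, abs_le, max_le_iff, le_min_iff]
    omega
  let T := (Icc (-(K : ℤ)) K).sigma fun h => I (u * h) ×ˢ I (v * h)
  have hT : ∀ h x y, (⟨h, x, y⟩ : Σ _ : ℤ, ℤ × ℤ) ∈ T ↔
      |h| ≤ K ∧ (|x| ≤ N ∧ |x + u * h| ≤ N) ∧ |y| ≤ N ∧ |y + v * h| ≤ N := by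
    intro h x y
    simp only [T, mem_sigma, mem_product, hI, mem_Icc, abs_le (a := h)]
  have hcard : Nat.card T = Nat.card {a : ℤ × ℤ × ℤ × ℤ //
        |a.1| ≤ (N : ℤ) ∧ |a.2.1| ≤ (N : ℤ) ∧ |a.2.2.1| ≤ (N : ℤ) ∧
        |a.2.2.2| ≤ (N : ℤ) ∧ u * (a.2.2.1 - a.2.2.2) = v * (a.1 - a.2.1)} := by
    refine Nat.card_eq_of_bijective (fun s => ⟨(s.1.2.1 + u * s.1.1, s.1.2.1,
      s.1.2.2 + v * s.1.1, s.1.2.2), ?_⟩) ⟨?_, ?_⟩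
    · obtain ⟨⟨h, x, y⟩, hs⟩ := s
      obtain ⟨-, ⟨hx, hx'⟩, hy, hy'⟩ := (hT h x y).1 hs
      exact ⟨hx', hx, hy', hy, by ring⟩
    · rintro ⟨⟨h, x, y⟩, hs⟩ ⟨⟨h', x', y'⟩, hs'⟩ heq
      simp only [Subtype.mk.injEq, Prod.mk.injEq] at heq
      obtain ⟨h1, rfl, -, rfl⟩ := heq
      obtain rfl : h = h' := mul_left_cancel₀ hu (add_left_cancel h1)
      rfl
    · rintro ⟨⟨a₁, a₂, b₁, b₂⟩, h1, h2, h3, h4, heq⟩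
      simp only at h1 h2 h3 h4 heq
      obtain ⟨h, hh⟩ : u ∣ a₁ - a₂ := huv.dvd_of_dvd_mul_left ⟨_, heq.symm⟩
      have hh' : b₁ - b₂ = v * h := by
        apply mul_left_cancel₀ hu
        rw [heq, hh]; ring
      obtain rfl : a₁ = a₂ + u * h := by linarith
      obtain rfl : b₁ = b₂ + v * h := by linarith
      have hhK : |h| ≤ K := by
        apply hK <;> rw [← abs_mul] <;> rw [abs_le] at * <;> constructor <;> linarith
      exact ⟨⟨⟨h, a₂, b₂⟩, (hT _ _ _).2 ⟨hhK, ⟨h2, h1⟩, h4, h3⟩⟩, rfl⟩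
  rw [← hcard, Nat.card_eq_fintype_card, Fintype.card_coe, card_sigma, Nat.cast_sum]
  refine sum_congr rfl fun h hh => ?_
  have hh' : |h| ≤ K := abs_le.2 (mem_Icc.1 hh)
  have hbound : ∀ w : ℤ, |w| * K ≤ 2 * N + 1 → |w * h| ≤ 2 * N + 1 := fun w hw => by
    rw [abs_mul]
    exact (mul_le_mul_of_nonneg_left hh' (abs_nonneg w)).trans hw
  rw [card_product, Nat.cast_mul, card_Icc_inter_translate (hbound u huK),
    card_Icc_inter_translate (hbound v hvK)]
  push_cast
  rw [abs_mul, abs_mul]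

theorem count_u_diff_eq_v_diff :
    ∃ C : ℝ, 0 < C ∧ ∀ N : ℕ, 1 ≤ N → ∀ u v : ℤ, u ≠ 0 → v ≠ 0 → Int.gcd u v = 1 →
      ∀ m : ℝ, m = max |(u : ℝ)| |(v : ℝ)| →
      |(Nat.card {a : ℤ × ℤ × ℤ × ℤ //
            |a.1| ≤ (N : ℤ) ∧ |a.2.1| ≤ (N : ℤ) ∧ |a.2.2.1| ≤ (N : ℤ) ∧
            |a.2.2.2| ≤ (N : ℤ) ∧ u * (a.2.2.1 - a.2.2.2) = v * (a.1 - a.2.1)} : ℝ) -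
          (4 * (N : ℝ) ^ 3 / (3 * m ^ 3)) *
            (12 * m ^ 2 - 6 * m * (|(u : ℝ)| + |(v : ℝ)|) + 4 * |(u : ℝ) * (v : ℝ)|)| ≤
        C * (N : ℝ) ^ 2 := by
  refine ⟨40, by norm_num, fun N hN u v hu hv huv m hm => ?_⟩
  set q : ℕ := max u.natAbs v.natAbs with hq
  have hq0 : 0 < q := lt_max_of_lt_left (Int.natAbs_pos.2 hu)
  have hqm : (q : ℝ) = m := by rw [hm, hq]; push_cast [Nat.cast_natAbs]; rfl
  have huq : |u| ≤ q := by rw [Int.abs_eq_natAbs]; omega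
  have hvq : |v| ≤ q := by rw [Int.abs_eq_natAbs]; omega
  have hmul : q * ((2 * N + 1) / q) ≤ 2 * N + 1 := Nat.mul_div_le _ _
  have hlt : 2 * N + 1 < q * ((2 * N + 1) / q + 1) := Nat.lt_mul_div_succ _ hq0
  generalize (2 * N + 1) / q = K at hmul hlt
  have hmul' : (q : ℤ) * K ≤ 2 * N + 1 := by exact_mod_cast hmul
  have hlt' : 2 * (N : ℤ) + 1 < q * (K + 1) := by exact_mod_cast hlt
  have hcase : |u| = q ∨ |v| = q := by rw [Int.abs_eq_natAbs, Int.abs_eq_natAbs]; omega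
  have hK : ∀ h : ℤ, |u| * |h| ≤ 2 * N → |v| * |h| ≤ 2 * N → |h| ≤ K := by
    intro h h1 h2
    have h3 : (q : ℤ) * |h| ≤ 2 * N := by
      rcases hcase with h' | h' <;> rw [← h'] <;> assumption
    have h4 : (q : ℤ) * |h| < q * (K + 1) := by linarith
    exact Int.lt_add_one_iff.1 (lt_of_mul_lt_mul_left h4 (by positivity))
  rw [card_u_diff_eq_v_diff hu (Int.isCoprime_iff_gcd_eq_one.2 huv)
    ((mul_le_mul_of_nonneg_right huq (by positivity)).trans hmul')
    ((mul_le_mul_of_nonneg_right hvq (by positivity)).trans hmul') hK,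
    sum_Icc_neg_tent_mul_tent, abs_mul]
  have hN' : (1 : ℝ) ≤ N := by exact_mod_cast hN
  have hm1 : 1 ≤ m := by rw [← hqm]; exact_mod_cast hq0
  have hmulR : m * K ≤ 2 * N + 1 := by rw [← hqm]; exact_mod_cast hmul
  have hltR : 2 * (N : ℝ) + 1 ≤ m * (K + 1) := by rw [← hqm]; exact_mod_cast hlt.le
  rcases le_total |(u : ℝ)| |(v : ℝ)| with h | h
  · rw [max_eq_right h] at hm
    subst hm
    exact abs_tent_sum_sub_integral_le hN' (abs_nonneg _) h hm1 hmulR hltR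
  · rw [max_eq_left h] at hm
    subst hm
    rw [add_comm |(u : ℝ)|, mul_comm |(u : ℝ)| |(v : ℝ)|]
    exact abs_tent_sum_sub_integral_le hN' (abs_nonneg _) h hm1 hmulR hltR
end

section
/- Let Γ be the set of pairs (A,B) ∈ Mat₂(ℤ,N)² with AB = BA, and let Γ' be the set of pairs in Γ for which all four off-diagonal entries a₂, a₃ of A and b₂, b₃ of B are non-zero (i.e. a₂a₃b₂b₃ ≠ 0). Then for every integer N > 1, one has |Γ \ Γ'| = 2·(2N)^5 + O(N^4·log N), with an absolute implied constant. -/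
/-- A vector in the plane proportional to a nonzero integer vector: both are integer multiples of
a common nonzero integer vector. -/
theorem exists_common_direction {x y z w : ℤ} (h0 : ¬(x = 0 ∧ y = 0)) (h : x * w = z * y) :
    ∃ p q s t : ℤ, ¬(p = 0 ∧ q = 0) ∧ s ≠ 0 ∧
      x = s * p ∧ y = s * q ∧ z = t * p ∧ w = t * q := by
  have hg : Int.gcd x y ≠ 0 := by
    rwa [Ne, Int.gcd_eq_zero_iff]
  have hg' : (Int.gcd x y : ℤ) ≠ 0 := by exact_mod_cast hg
  obtain ⟨p, hp⟩ := Int.gcd_dvd_left x y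
  obtain ⟨q, hq⟩ := Int.gcd_dvd_right x y
  have hbez := Int.gcd_eq_gcd_ab x y
  generalize (Int.gcd x y : ℤ) = g at *
  generalize Int.gcdA x y = α at *
  generalize Int.gcdB x y = β at *
  subst hp hq
  have h1 : p * α + q * β = 1 := by
    apply mul_left_cancel₀ hg'
    linear_combination -hbez
  have h2 : p * w = z * q := by
    apply mul_left_cancel₀ hg'
    linear_combination h
  refine ⟨p, q, g, α * z + β * w, ?_, hg', rfl, rfl, ?_, ?_⟩
  · rintro ⟨rfl, rfl⟩
    simp at h1
  · linear_combination (-z) * h1 - β * h2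
  · linear_combination (-w) * h1 + α * h2

/-- Quadruples `(x, y, z, w)` in the box of radius `M` with `(x, y) ≠ 0` and `x w = z y`. -/
noncomputable def proportionalPairs (M : ℕ) : Finset (ℤ × ℤ × ℤ × ℤ) :=
  (Finset.Icc (-(M : ℤ)) M ×ˢ Finset.Icc (-(M : ℤ)) M ×ˢ
    Finset.Icc (-(M : ℤ)) M ×ˢ Finset.Icc (-(M : ℤ)) M).filter
    fun v => ¬(v.1 = 0 ∧ v.2.1 = 0) ∧ v.1 * v.2.2.2 = v.2.2.1 * v.2.1

/-- A finite set containing the integer points of sup-norm `m`. -/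
noncomputable def supSphere (m : ℕ) : Finset (ℤ × ℤ) :=
  (({(m : ℤ), -(m : ℤ)} : Finset ℤ) ×ˢ Finset.Icc (-(m : ℤ)) m) ∪
    (Finset.Icc (-(m : ℤ)) m ×ˢ ({(m : ℤ), -(m : ℤ)} : Finset ℤ))

theorem card_Icc_neg_self (m : ℕ) : (Finset.Icc (-(m : ℤ)) m).card = 2 * m + 1 := by
  rw [Int.card_Icc]
  omega

theorem card_supSphere_le {m : ℕ} (hm : 1 ≤ m) : (supSphere m).card ≤ 12 * m := by
  have h2 : (({(m : ℤ), -(m : ℤ)} : Finset ℤ)).card ≤ 2 := Finset.card_le_two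
  refine (Finset.card_union_le _ _).trans ?_
  rw [Finset.card_product, Finset.card_product, card_Icc_neg_self]
  nlinarith

theorem mem_supSphere_max (p q : ℤ) : (p, q) ∈ supSphere (max p.natAbs q.natAbs) := by
  simp only [supSphere, Finset.mem_union, Finset.mem_product, Finset.mem_insert,
    Finset.mem_singleton, Finset.mem_Icc]
  omega

theorem mem_Icc_div_of_abs_le {M m : ℕ} {p q s : ℤ} (hm : m = max p.natAbs q.natAbs) (h0 : 1 ≤ m)
    (hp : |s * p| ≤ M) (hq : |s * q| ≤ M) :
    s ∈ Finset.Icc (-((M / m : ℕ) : ℤ)) ((M / m : ℕ) : ℤ) := by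
  rw [Int.abs_eq_natAbs] at hp hq
  have key : s.natAbs ≤ M / m := by
    rw [Nat.le_div_iff_mul_le h0, hm]
    rcases max_choice p.natAbs q.natAbs with h | h <;> rw [h, ← Int.natAbs_mul] <;> omega
  rw [Finset.mem_Icc]
  omega

theorem proportionalPairs_subset (M : ℕ) :
    proportionalPairs M ⊆ (Finset.Icc 1 M).biUnion fun m =>
      (supSphere m ×ˢ Finset.Icc (-((M / m : ℕ) : ℤ)) ((M / m : ℕ) : ℤ) ×ˢ
        Finset.Icc (-((M / m : ℕ) : ℤ)) ((M / m : ℕ) : ℤ)).image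
        fun v => (v.2.1 * v.1.1, v.2.1 * v.1.2, v.2.2 * v.1.1, v.2.2 * v.1.2) := by
  rintro ⟨x, y, z, w⟩ hv
  simp only [proportionalPairs, Finset.mem_filter, Finset.mem_product, Finset.mem_Icc,
    ← abs_le] at hv
  obtain ⟨⟨hx, hy, hz, hw⟩, h0, h⟩ := hv
  obtain ⟨p, q, s, t, hpq, hs, rfl, rfl, rfl, rfl⟩ := exists_common_direction h0 h
  have hm : 1 ≤ max p.natAbs q.natAbs := by omega
  have hsm := mem_Icc_div_of_abs_le rfl hm hx hy
  have htm := mem_Icc_div_of_abs_le rfl hm hz hw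
  rw [Finset.mem_biUnion]
  refine ⟨max p.natAbs q.natAbs, ?_, ?_⟩
  · rw [Finset.mem_Icc]
    refine ⟨hm, ?_⟩
    by_contra hlt
    rw [Nat.div_eq_of_lt (not_le.mp hlt), Finset.mem_Icc] at hsm
    omega
  · rw [Finset.mem_image]
    exact ⟨((p, q), s, t),
      Finset.mem_product.2 ⟨mem_supSphere_max p q, Finset.mem_product.2 ⟨hsm, htm⟩⟩, rfl⟩

theorem card_proportionalPairs_le (M : ℕ) :
    ((proportionalPairs M).card : ℝ) ≤ 108 * (M : ℝ) ^ 2 * (1 + Real.log M) := by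
  have h1 : (proportionalPairs M).card ≤
      ∑ m ∈ Finset.Icc 1 M, 12 * m * ((2 * (M / m) + 1) * (2 * (M / m) + 1)) := by
    refine (Finset.card_le_card (proportionalPairs_subset M)).trans
      (Finset.card_biUnion_le.trans (Finset.sum_le_sum fun m hm => ?_))
    refine Finset.card_image_le.trans ?_
    rw [Finset.card_product, Finset.card_product, card_Icc_neg_self]
    exact Nat.mul_le_mul_right _ (card_supSphere_le (Finset.mem_Icc.1 hm).1)
  have h2 : ((proportionalPairs M).card : ℝ) ≤
      ∑ m ∈ Finset.Icc 1 M, 108 * (M : ℝ) ^ 2 * (m : ℝ)⁻¹ := by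
    refine (Nat.cast_le.2 h1).trans ?_
    rw [Nat.cast_sum]
    refine Finset.sum_le_sum fun m hm => ?_
    obtain ⟨hm1, hmM⟩ := Finset.mem_Icc.1 hm
    have hm0 : (0 : ℝ) < m := by exact_mod_cast hm1
    have hd : ((M / m : ℕ) : ℝ) ≤ M / m := Nat.cast_div_le
    have hone : (1 : ℝ) ≤ M / m := by
      rw [le_div_iff₀ hm0, one_mul]
      exact_mod_cast hmM
    have hb : 2 * ((M / m : ℕ) : ℝ) + 1 ≤ 3 * (M / m) := by linarith
    push_cast
    calc (12 * m * ((2 * ((M / m : ℕ) : ℝ) + 1) * (2 * ((M / m : ℕ) : ℝ) + 1)) : ℝ)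
        ≤ 12 * m * ((3 * (M / m)) * (3 * (M / m))) := by gcongr
      _ = 108 * (M : ℝ) ^ 2 * (m : ℝ)⁻¹ := by
        field_simp
        ring
  have h3 : ∑ m ∈ Finset.Icc 1 M, (m : ℝ)⁻¹ ≤ 1 + Real.log M := by
    have := harmonic_le_one_add_log M
    rw [harmonic_eq_sum_Icc] at this
    push_cast at this
    exact this
  rw [← Finset.mul_sum] at h2
  exact h2.trans (by gcongr)

/-- Commuting pairs of integer matrices of sup-norm at most `N` with some vanishing off-diagonal
entry. -/
def degenerateCommutingPairs (N : ℕ) :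
    Set (Matrix (Fin 2) (Fin 2) ℤ × Matrix (Fin 2) (Fin 2) ℤ) :=
  {AB | (∀ i j, |AB.1 i j| ≤ (N : ℤ)) ∧ (∀ i j, |AB.2 i j| ≤ (N : ℤ)) ∧
    AB.1 * AB.2 = AB.2 * AB.1 ∧
    AB.1 0 1 * AB.1 1 0 * AB.2 0 1 * AB.2 1 0 = 0}

theorem mk_mem_degenerateCommutingPairs {N : ℕ} {a b c d a' b' c' d' : ℤ} :
    (!![a, b; c, d], !![a', b'; c', d']) ∈ degenerateCommutingPairs N ↔
      ((|a| ≤ N ∧ |b| ≤ N) ∧ |c| ≤ N ∧ |d| ≤ N) ∧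
      ((|a'| ≤ N ∧ |b'| ≤ N) ∧ |c'| ≤ N ∧ |d'| ≤ N) ∧
      (b * c' = b' * c ∧ (a - d) * b' = (a' - d') * b ∧ (a - d) * c' = (a' - d') * c) ∧
      b * c * b' * c' = 0 := by
  have hcomm : !![a, b; c, d] * !![a', b'; c', d'] = !![a', b'; c', d'] * !![a, b; c, d] ↔
      (b * c' = b' * c ∧ (a - d) * b' = (a' - d') * b ∧ (a - d) * c' = (a' - d') * c) := by
    rw [← Matrix.ext_iff]
    simp only [Fin.forall_fin_two, Matrix.mul_fin_two]
    simp only [Matrix.of_apply, Matrix.cons_val', Matrix.cons_val_zero, Matrix.cons_val_one,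
      Matrix.cons_val_fin_one]
    constructor
    · rintro ⟨⟨h1, h2⟩, h3, h4⟩
      exact ⟨by linarith, by linarith, by linarith⟩
    · rintro ⟨h1, h2, h3⟩
      exact ⟨⟨by linarith, by linarith⟩, by linarith, by linarith⟩
  simp only [degenerateCommutingPairs, Set.mem_ofPred_eq, hcomm]
  simp [Fin.forall_fin_two]

/-- Pairs consisting of a scalar matrix and an arbitrary matrix. -/
noncomputable def scalarLeft (N : ℕ) : Finset (Matrix (Fin 2) (Fin 2) ℤ × Matrix (Fin 2) (Fin 2) ℤ) :=
  (Finset.Icc (-(N : ℤ)) N ×ˢ Finset.Icc (-(N : ℤ)) N ×ˢ Finset.Icc (-(N : ℤ)) N ×ˢ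
    Finset.Icc (-(N : ℤ)) N ×ˢ Finset.Icc (-(N : ℤ)) N).image
    fun v => (!![v.1, 0; 0, v.1], !![v.2.1, v.2.2.1; v.2.2.2.1, v.2.2.2.2])

/-- Pairs consisting of an arbitrary matrix and a scalar matrix. -/
noncomputable def scalarRight (N : ℕ) : Finset (Matrix (Fin 2) (Fin 2) ℤ × Matrix (Fin 2) (Fin 2) ℤ) :=
  (scalarLeft N).image Prod.swap

/-- Pairs of upper triangular matrices whose reduced entries are proportional. -/
noncomputable def upperPairs (N : ℕ) : Finset (Matrix (Fin 2) (Fin 2) ℤ × Matrix (Fin 2) (Fin 2) ℤ) :=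
  (Finset.Icc (-(N : ℤ)) N ×ˢ Finset.Icc (-(N : ℤ)) N ×ˢ proportionalPairs (2 * N)).image
    fun v => (!![v.2.2.1 + v.1, v.2.2.2.1; 0, v.1],
      !![v.2.2.2.2.1 + v.2.1, v.2.2.2.2.2; 0, v.2.1])

/-- The transposes of the pairs in `upperPairs`. -/
noncomputable def lowerPairs (N : ℕ) : Finset (Matrix (Fin 2) (Fin 2) ℤ × Matrix (Fin 2) (Fin 2) ℤ) :=
  (upperPairs N).image fun AB => (AB.1.transpose, AB.2.transpose)

theorem mk_mem_scalarLeft {N : ℕ} {k a b c d : ℤ} (hk : |k| ≤ N) (ha : |a| ≤ N) (hb : |b| ≤ N)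
    (hc : |c| ≤ N) (hd : |d| ≤ N) : (!![k, 0; 0, k], !![a, b; c, d]) ∈ scalarLeft N := by
  rw [abs_le] at hk ha hb hc hd
  refine Finset.mem_image.2 ⟨(k, a, b, c, d), ?_, rfl⟩
  simp only [Finset.mem_product, Finset.mem_Icc]
  exact ⟨hk, ha, hb, hc, hd⟩

theorem mk_mem_upperPairs {N : ℕ} {a b d a' b' d' : ℤ} (ha : |a| ≤ N) (hb : |b| ≤ N)
    (hd : |d| ≤ N) (ha' : |a'| ≤ N) (hb' : |b'| ≤ N) (hd' : |d'| ≤ N)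
    (h0 : ¬(a - d = 0 ∧ b = 0)) (h : (a - d) * b' = (a' - d') * b) :
    (!![a, b; 0, d], !![a', b'; 0, d']) ∈ upperPairs N := by
  rw [abs_le] at ha hb hd ha' hb' hd'
  refine Finset.mem_image.2 ⟨(d, d', a - d, b, a' - d', b'), ?_, by simp⟩
  simp only [proportionalPairs, Finset.mem_product, Finset.mem_Icc, Finset.mem_filter]
  push_cast
  refine ⟨hd, hd', ⟨?_, ?_, ?_, ?_⟩, h0, h⟩ <;> constructor <;> linarith

theorem degenerateCommutingPairs_subset (N : ℕ) :
    degenerateCommutingPairs N ⊆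
      ((scalarLeft N ∪ scalarRight N) ∪ (upperPairs N ∪ lowerPairs N) : Finset _) := by
  rintro ⟨A, B⟩ hAB
  rw [Matrix.eta_fin_two A, Matrix.eta_fin_two B] at hAB ⊢
  generalize A 0 0 = a at *
  generalize A 0 1 = b at *
  generalize A 1 0 = c at *
  generalize A 1 1 = d at *
  generalize B 0 0 = a' at *
  generalize B 0 1 = b' at *
  generalize B 1 0 = c' at *
  generalize B 1 1 = d' at *
  obtain ⟨⟨⟨ha, hb⟩, hc, hd⟩, ⟨⟨ha', hb'⟩, hc', hd'⟩, ⟨h1, h2, h3⟩, h4⟩ :=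
    mk_mem_degenerateCommutingPairs.1 hAB
  simp only [Finset.coe_union, Set.mem_union, Finset.mem_coe]
  by_cases hA : a - d = 0 ∧ b = 0 ∧ c = 0
  · obtain ⟨had, rfl, rfl⟩ := hA
    obtain rfl : a = d := by linarith
    exact Or.inl (Or.inl (mk_mem_scalarLeft ha ha' hb' hc' hd'))
  by_cases hB : a' - d' = 0 ∧ b' = 0 ∧ c' = 0
  · obtain ⟨had, rfl, rfl⟩ := hB
    obtain rfl : a' = d' := by linarith
    exact Or.inl (Or.inr (Finset.mem_image.2 ⟨_, mk_mem_scalarLeft ha' ha hb hc hd, rfl⟩))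
  right
  have hcases : (c = 0 ∧ c' = 0) ∨ (b = 0 ∧ b' = 0) := by
    simp only [mul_eq_zero] at h4
    rcases h4 with ((rfl | rfl) | rfl) | rfl <;> simp at h1 h2 h3 <;> tauto
  rcases hcases with ⟨rfl, rfl⟩ | ⟨rfl, rfl⟩
  · exact Or.inl (mk_mem_upperPairs ha hb hd ha' hb' hd' (by tauto) h2)
  · refine Or.inr (Finset.mem_image.2
      ⟨_, mk_mem_upperPairs ha hc hd ha' hc' hd' (by tauto) h3, ?_⟩)
    simp [← Matrix.ext_iff, Fin.forall_fin_two]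

theorem scalar_subset_degenerateCommutingPairs (N : ℕ) :
    ((scalarLeft N ∪ scalarRight N : Finset _) : Set _) ⊆ degenerateCommutingPairs N := by
  intro AB hAB
  simp only [scalarRight, scalarLeft, Finset.coe_union, Set.mem_union, Finset.mem_coe,
    Finset.mem_image, Finset.mem_product, Finset.mem_Icc, ← abs_le] at hAB
  rcases hAB with ⟨⟨k, a, b, c, d⟩, h, rfl⟩ | ⟨_, ⟨⟨k, a, b, c, d⟩, h, rfl⟩, rfl⟩
  · rw [mk_mem_degenerateCommutingPairs]
    simp_all
  · rw [Prod.swap_prod_mk, mk_mem_degenerateCommutingPairs]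
    simp_all

theorem card_scalarLeft (N : ℕ) : (scalarLeft N).card = (2 * N + 1) ^ 5 := by
  rw [scalarLeft, Finset.card_image_of_injective]
  · simp only [Finset.card_product, card_Icc_neg_self]
    ring
  · rintro ⟨k, a, b, c, d⟩ ⟨k', a', b', c', d'⟩ h
    simp at h
    simp [h]

theorem card_scalarRight (N : ℕ) : (scalarRight N).card = (2 * N + 1) ^ 5 := by
  rw [scalarRight, Finset.card_image_of_injective _ Prod.swap_injective, card_scalarLeft]

theorem card_scalarLeft_inter_scalarRight_le (N : ℕ) :
    (scalarLeft N ∩ scalarRight N).card ≤ (2 * N + 1) ^ 2 := by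
  have hsub : scalarLeft N ∩ scalarRight N ⊆
      (Finset.Icc (-(N : ℤ)) N ×ˢ Finset.Icc (-(N : ℤ)) N).image
        fun v => (!![v.1, 0; 0, v.1], !![v.2, 0; 0, v.2]) := by
    intro AB hAB
    simp only [scalarRight, scalarLeft, Finset.mem_inter, Finset.mem_image, Finset.mem_product,
      Finset.mem_Icc] at hAB
    obtain ⟨⟨⟨k, a, b, c, d⟩, h, rfl⟩, ⟨_, ⟨⟨k', a', b', c', d'⟩, h', rfl⟩, hswap⟩⟩ := hAB
    rw [Prod.swap_prod_mk, Prod.mk.injEq] at hswap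
    refine Finset.mem_image.2 ⟨(k, k'), ?_, ?_⟩
    · simp only [Finset.mem_product, Finset.mem_Icc]
      exact ⟨h.1, h'.1⟩
    · rw [← hswap.2]
  refine (Finset.card_le_card hsub).trans (Finset.card_image_le.trans ?_)
  rw [Finset.card_product, card_Icc_neg_self, sq]

theorem card_upperPairs_le (N : ℕ) :
    (upperPairs N).card ≤ (2 * N + 1) ^ 2 * (proportionalPairs (2 * N)).card := by
  refine Finset.card_image_le.trans (le_of_eq ?_)
  simp only [Finset.card_product, card_Icc_neg_self]
  ring

theorem ncard_degenerateCommutingPairs_le (N : ℕ) :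
    (degenerateCommutingPairs N).ncard ≤
      2 * (2 * N + 1) ^ 5 + 2 * ((2 * N + 1) ^ 2 * (proportionalPairs (2 * N)).card) := by
  have h := Set.ncard_le_ncard (degenerateCommutingPairs_subset N) (Finset.finite_toSet _)
  rw [Set.ncard_coe_finset] at h
  have h1 := Finset.card_union_le (scalarLeft N ∪ scalarRight N) (upperPairs N ∪ lowerPairs N)
  have h2 := Finset.card_union_le (scalarLeft N) (scalarRight N)
  have h3 := Finset.card_union_le (upperPairs N) (lowerPairs N)
  have h4 : (lowerPairs N).card ≤ (upperPairs N).card := Finset.card_image_le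
  have h5 := card_upperPairs_le N
  rw [card_scalarLeft, card_scalarRight] at h2
  omega

theorem le_ncard_degenerateCommutingPairs (N : ℕ) :
    2 * (2 * N + 1) ^ 5 ≤ (degenerateCommutingPairs N).ncard + (2 * N + 1) ^ 2 := by
  have h := Set.ncard_le_ncard (scalar_subset_degenerateCommutingPairs N)
    ((Finset.finite_toSet _).subset (degenerateCommutingPairs_subset N))
  rw [Set.ncard_coe_finset] at h
  have h1 := Finset.card_union_add_card_inter (scalarLeft N) (scalarRight N)
  have h2 := card_scalarLeft_inter_scalarRight_le N
  rw [card_scalarLeft, card_scalarRight] at h1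
  omega

theorem degenerate_commuting_pairs_count :
    ∃ C : ℝ, 0 < C ∧ ∀ N : ℕ, 1 < N →
      |(Nat.card {AB : Matrix (Fin 2) (Fin 2) ℤ × Matrix (Fin 2) (Fin 2) ℤ //
            (∀ i j, |AB.1 i j| ≤ (N : ℤ)) ∧ (∀ i j, |AB.2 i j| ≤ (N : ℤ)) ∧
            AB.1 * AB.2 = AB.2 * AB.1 ∧
            AB.1 0 1 * AB.1 1 0 * AB.2 0 1 * AB.2 1 0 = 0} : ℝ) -
          2 * (2 * (N : ℝ)) ^ 5| ≤
        C * (N : ℝ) ^ 4 * Real.log N := by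
  refine ⟨50000, by norm_num, fun N hN => ?_⟩
  change |((degenerateCommutingPairs N).ncard : ℝ) - 2 * (2 * (N : ℝ)) ^ 5| ≤ _
  have hN2 : (2 : ℝ) ≤ N := by exact_mod_cast hN
  have hlog2 : (1 / 2 : ℝ) ≤ Real.log 2 := by linarith [Real.log_two_gt_d9]
  have hlog : Real.log 2 ≤ Real.log N := Real.log_le_log (by norm_num) hN2
  have hupper : ((degenerateCommutingPairs N).ncard : ℝ) ≤ 2 * (2 * N + 1) ^ 5 +
      2 * ((2 * N + 1) ^ 2 * (proportionalPairs (2 * N)).card) := by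
    exact_mod_cast ncard_degenerateCommutingPairs_le N
  have hlower : 2 * (2 * (N : ℝ) + 1) ^ 5 ≤
      (degenerateCommutingPairs N).ncard + (2 * N + 1) ^ 2 := by
    exact_mod_cast le_ncard_degenerateCommutingPairs N
  have hcard : ((proportionalPairs (2 * N)).card : ℝ) ≤ 1728 * (N : ℝ) ^ 2 * Real.log N := by
    have h := card_proportionalPairs_le (2 * N)
    push_cast at h
    rw [Real.log_mul (by norm_num) (by linarith)] at h
    have h' : 1 + (Real.log 2 + Real.log N) ≤ 4 * Real.log N := by linarith
    calc _ ≤ _ := h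
      _ ≤ 108 * (2 * (N : ℝ)) ^ 2 * (4 * Real.log N) := by gcongr
      _ = _ := by ring
  have hsq : (2 * (N : ℝ) + 1) ^ 2 ≤ 9 * (N : ℝ) ^ 2 := by nlinarith
  have hprod : (2 * (N : ℝ) + 1) ^ 2 * (proportionalPairs (2 * N)).card ≤
      15552 * (N : ℝ) ^ 4 * Real.log N := by
    calc _ ≤ 9 * (N : ℝ) ^ 2 * (1728 * (N : ℝ) ^ 2 * Real.log N) := by gcongr
      _ = _ := by ring
  have hN1 : (1 : ℝ) ≤ N := by linarith
  have p3 : (N : ℝ) ^ 3 ≤ N ^ 4 := pow_le_pow_right₀ hN1 (by norm_num)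
  have p2 : (N : ℝ) ^ 2 ≤ N ^ 4 := pow_le_pow_right₀ hN1 (by norm_num)
  have p1 : (N : ℝ) ≤ N ^ 4 := le_self_pow₀ hN1 (by norm_num)
  have p0 : (1 : ℝ) ≤ N ^ 4 := one_le_pow₀ hN1
  have hlogN : (N : ℝ) ^ 4 ≤ 2 * ((N : ℝ) ^ 4 * Real.log N) := by
    nlinarith
  have hexp : 2 * (2 * (N : ℝ) + 1) ^ 5 = 2 * (2 * (N : ℝ)) ^ 5 +
      2 * (80 * N ^ 4 + 80 * N ^ 3 + 40 * N ^ 2 + 10 * N + 1) := by ring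
  have hnonneg : 0 ≤ 80 * (N : ℝ) ^ 4 + 80 * N ^ 3 + 40 * N ^ 2 + 10 * N + 1 := by positivity
  rw [abs_le]
  constructor <;> linarith
end

section
/- Let n ∈ ℕ, let p be a prime, let d, k, m ∈ ℕ, and let F₁, …, F_k be homogeneous polynomials of degree d in m variables with coefficients in ℤ/pⁿℤ. For each non-negative integer h, let S(n,h) denote the set of solutions (x₁,…,x_m) ∈ (ℤ/pⁿℤ)^m to the system F₁(x₁,…,x_m) = ⋯ = F_k(x₁,…,x_m) = 0 which satisfy min{ν_p(x₁),…,ν_p(x_m)} = h (where for the system over ℤ/p^{n'}ℤ with n' = n − dh, S(n',0) is defined analogously using the reductions of the F_i modulo p^{n'}). If 0 ≤ h < n/d, then |S(n,h)| = p^{(d−1)hm}·|S(n−dh,0)|. -/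
/-- The `p`-adic valuation `ν_p : ZMod (p^n) → {0,…,n}`: it sends `0` to `n`, and a
non-zero residue class to the `p`-adic valuation of its canonical representative. -/
def nuZMod (p n : ℕ) (x : ZMod (p ^ n)) : ℕ :=
  if x = 0 then n else padicValNat p x.val

theorem Nat.card_subtype_addMonoidHom {G H : Type*} [AddGroup G] [AddGroup H] (f : G →+ H)
    (P : H → Prop) (hP : ∀ y, P y → ∃ x, f x = y) :
    Nat.card {g // P (f g)} = Nat.card f.ker * Nat.card {y // P y} := by
  have fiberEquiv (y : {y // P y}) : Nonempty ({x // f x = y} ≃ f.ker) := by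
    obtain ⟨x, hx⟩ := hP y y.2
    exact ⟨(Equiv.subtypeEquivRight fun _ => by simp [hx]).trans (f.fiberEquivKer x)⟩
  rw [mul_comm, ← Nat.card_prod]
  exact Nat.card_congr ((Equiv.sigmaSubtypeFiberEquivSubtype f fun _ => Iff.rfl).symm.trans
    ((Equiv.sigmaCongrRight fun y => (fiberEquiv y).some).trans (Equiv.sigmaEquivProd _ _)))

theorem MvPolynomial.IsHomogeneous.eval_mul_left {σ R : Type*} [CommSemiring R]
    {F : MvPolynomial σ R} {d : ℕ} (hF : F.IsHomogeneous d) (c : R) (x : σ → R) :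
    MvPolynomial.eval (fun i => c * x i) F = c ^ d * MvPolynomial.eval x F := by
  rw [MvPolynomial.eval_eq, MvPolynomial.eval_eq, Finset.mul_sum]
  refine Finset.sum_congr rfl fun s hs => ?_
  have hs : ∑ i ∈ s.support, s i = d := by
    rw [← Finsupp.degree_apply, Finsupp.degree_eq_weight_one]
    exact hF (MvPolynomial.mem_support_iff.1 hs)
  simp_rw [mul_pow, Finset.prod_mul_distrib, Finset.prod_pow_eq_pow_sum, hs]
  ring

section ZModPow

variable {p n : ℕ}

theorem ZMod.pow_mul_eq_zero_iff_castHom (hp : p.Prime) {t : ℕ} (ht : t ≤ n)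
    (hdvd : p ^ (n - t) ∣ p ^ n) (x : ZMod (p ^ n)) :
    (p : ZMod (p ^ n)) ^ t * x = 0 ↔ ZMod.castHom hdvd (ZMod (p ^ (n - t))) x = 0 := by
  have : NeZero (p ^ n) := ⟨pow_ne_zero _ hp.ne_zero⟩
  obtain ⟨a, rfl⟩ := ZMod.natCast_zmod_surjective x
  rw [map_natCast, ZMod.natCast_eq_zero_iff, ← Nat.cast_pow, ← Nat.cast_mul,
    ZMod.natCast_eq_zero_iff]
  conv_lhs => rw [← Nat.add_sub_cancel' ht, pow_add]
  exact Nat.mul_dvd_mul_iff_left (pow_pos hp.pos t)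

theorem ZMod.castHom_compLeft_surjective {a b : ℕ} [NeZero b] (h : a ∣ b) (ι : Type*) :
    Function.Surjective ((ZMod.castHom h (ZMod a)).toAddMonoidHom.compLeft ι) :=
  (ZMod.castHom_surjective h).comp_left

theorem ZMod.card_ker_castHom_compLeft (hp : p.Prime) {a : ℕ} (ha : a ≤ n)
    (hdvd : p ^ a ∣ p ^ n) (m : ℕ) :
    Nat.card ((ZMod.castHom hdvd (ZMod (p ^ a))).toAddMonoidHom.compLeft (Fin m)).ker =
      p ^ ((n - a) * m) := by
  have : NeZero (p ^ n) := ⟨pow_ne_zero _ hp.ne_zero⟩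
  have h := Nat.card_subtype_addMonoidHom
    ((ZMod.castHom hdvd (ZMod (p ^ a))).toAddMonoidHom.compLeft (Fin m)) (fun _ => True)
    fun y _ => ZMod.castHom_compLeft_surjective hdvd _ y
  simp only [Nat.card_congr (Equiv.subtypeUnivEquiv fun _ => trivial), Nat.card_fun, Nat.card_zmod,
    Nat.card_fin] at h
  refine Nat.eq_of_mul_eq_mul_right (pow_pos (pow_pos hp.pos a) m) (h.symm.trans ?_)
  rw [← pow_mul, ← pow_mul, ← pow_add, ← add_mul, Nat.sub_add_cancel ha]

theorem ZMod.card_ker_mulLeft_compLeft (hp : p.Prime) {t : ℕ} (ht : t ≤ n) (m : ℕ) :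
    Nat.card ((AddMonoidHom.mulLeft ((p : ZMod (p ^ n)) ^ t)).compLeft (Fin m)).ker =
      p ^ (t * m) := by
  have h := ZMod.card_ker_castHom_compLeft hp (Nat.sub_le n t)
    (pow_dvd_pow p (Nat.sub_le n t)) m
  rw [Nat.sub_sub_self ht] at h
  rw [← h]
  refine Nat.card_congr (Equiv.subtypeEquivRight fun x => ?_)
  simp only [AddMonoidHom.mem_ker, funext_iff]
  exact forall_congr' fun i =>
    ZMod.pow_mul_eq_zero_iff_castHom hp ht (pow_dvd_pow p (Nat.sub_le n t)) (x i)

theorem le_nuZMod_natCast_iff (hp : p.Prime) {t : ℕ} (ht : t ≤ n) (a : ℕ) :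
    t ≤ nuZMod p n (a : ZMod (p ^ n)) ↔ p ^ t ∣ a := by
  have : Fact p.Prime := ⟨hp⟩
  have : NeZero (p ^ n) := ⟨pow_ne_zero _ hp.ne_zero⟩
  unfold nuZMod
  split_ifs with h
  · rw [ZMod.natCast_eq_zero_iff] at h
    exact iff_of_true ht ((pow_dvd_pow p ht).trans h)
  · rw [← padicValNat_dvd_iff_le ((ZMod.val_ne_zero _).2 h), ZMod.val_natCast,
      Nat.dvd_mod_iff (pow_dvd_pow p ht)]

theorem le_iInf_nuZMod_natCast_iff (hp : p.Prime) {ι : Type*} [Nonempty ι] {t : ℕ} (ht : t ≤ n)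
    (a : ι → ℕ) :
    t ≤ ⨅ j, nuZMod p n (a j : ZMod (p ^ n)) ↔ ∀ j, p ^ t ∣ a j := by
  simp_rw [le_ciInf_iff', le_nuZMod_natCast_iff hp ht]

theorem iInf_nuZMod_eq_iff (hp : p.Prime) {ι : Type*} [Nonempty ι] {t : ℕ} (ht : t < n)
    (a : ι → ℕ) :
    ⨅ j, nuZMod p n (a j : ZMod (p ^ n)) = t ↔
      (∀ j, p ^ t ∣ a j) ∧ ¬ ∀ j, p ^ (t + 1) ∣ a j := by
  rw [← le_iInf_nuZMod_natCast_iff hp ht.le, ← le_iInf_nuZMod_natCast_iff hp ht]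
  omega

theorem exists_pow_mul_eq_of_iInf_nuZMod_eq (hp : p.Prime) {ι : Type*} [Nonempty ι] {t : ℕ}
    (ht : t < n) (x : ι → ZMod (p ^ n)) (hx : ⨅ j, nuZMod p n (x j) = t) :
    ∃ z : ι → ZMod (p ^ n), (fun j => (p : ZMod (p ^ n)) ^ t * z j) = x := by
  have : NeZero (p ^ n) := ⟨pow_ne_zero _ hp.ne_zero⟩
  obtain ⟨a, rfl⟩ := (ZMod.natCast_zmod_surjective (n := p ^ n)).comp_left (α := ι) x
  choose b hb using ((iInf_nuZMod_eq_iff hp ht a).1 hx).1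
  exact ⟨fun j => b j, funext fun j => by simp [hb]⟩

theorem iInf_nuZMod_pow_mul_eq_iff (hp : p.Prime) {ι : Type*} [Nonempty ι] {t r : ℕ} (ht : t < n)
    (hr : 0 < r) (hdvd : p ^ r ∣ p ^ n) (z : ι → ZMod (p ^ n)) :
    ⨅ j, nuZMod p n ((p : ZMod (p ^ n)) ^ t * z j) = t ↔
      ⨅ j, nuZMod p r (ZMod.castHom hdvd (ZMod (p ^ r)) (z j)) = 0 := by
  have : NeZero (p ^ n) := ⟨pow_ne_zero _ hp.ne_zero⟩
  obtain ⟨a, rfl⟩ := (ZMod.natCast_zmod_surjective (n := p ^ n)).comp_left (α := ι) z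
  have h := iInf_nuZMod_eq_iff hp ht fun j => p ^ t * a j
  push_cast at h
  simp only [Function.comp_apply, map_natCast]
  rw [h, iInf_nuZMod_eq_iff hp hr]
  simp [pow_succ, Nat.mul_dvd_mul_iff_left (pow_pos hp.pos t)]

theorem MvPolynomial.IsHomogeneous.eval_pow_mul_eq_zero_iff (hp : p.Prime) {σ : Type*} {d t : ℕ}
    {F : MvPolynomial σ (ZMod (p ^ n))} (hF : F.IsHomogeneous d) (ht : d * t ≤ n)
    (hdvd : p ^ (n - d * t) ∣ p ^ n) (z : σ → ZMod (p ^ n)) :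
    MvPolynomial.eval (fun j => (p : ZMod (p ^ n)) ^ t * z j) F = 0 ↔
      MvPolynomial.eval (fun j => ZMod.castHom hdvd (ZMod (p ^ (n - d * t))) (z j))
        (MvPolynomial.map (ZMod.castHom hdvd (ZMod (p ^ (n - d * t)))) F) = 0 := by
  rw [hF.eval_mul_left, ← pow_mul, mul_comm t d, ZMod.pow_mul_eq_zero_iff_castHom hp ht hdvd,
    MvPolynomial.eval_map, MvPolynomial.eval₂_comp]
  rfl

end ZModPow

theorem homogeneous_lifting_trick (p : ℕ) (hp : p.Prime) (n d k m : ℕ)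
    (hn : 0 < n) (hd : 0 < d) (hm : 0 < m)
    (F : Fin k → MvPolynomial (Fin m) (ZMod (p ^ n)))
    (hF : ∀ i, (F i).IsHomogeneous d)
    (h : ℕ) (hh : d * h < n) :
    Nat.card {x : Fin m → ZMod (p ^ n) //
        (∀ i, MvPolynomial.eval x (F i) = 0) ∧ (⨅ j, nuZMod p n (x j)) = h} =
      p ^ ((d - 1) * h * m) *
        Nat.card {y : Fin m → ZMod (p ^ (n - d * h)) //
          (∀ i, MvPolynomial.eval y
              (MvPolynomial.map
                (ZMod.castHom (pow_dvd_pow p (Nat.sub_le n (d * h)))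
                  (ZMod (p ^ (n - d * h)))) (F i)) = 0) ∧
          (⨅ j, nuZMod p (n - d * h) (y j)) = 0} := by
  have : NeZero (p ^ n) := ⟨pow_ne_zero _ hp.ne_zero⟩
  have : Nonempty (Fin m) := ⟨⟨0, hm⟩⟩
  have ht : h < n := (Nat.le_mul_of_pos_left h hd).trans_lt hh
  have hr : 0 < n - d * h := Nat.sub_pos_of_lt hh
  have hdvd := pow_dvd_pow p (Nat.sub_le n (d * h))
  have hmul := Nat.card_subtype_addMonoidHom
    ((AddMonoidHom.mulLeft ((p : ZMod (p ^ n)) ^ h)).compLeft (Fin m))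
    (fun x => (∀ i, MvPolynomial.eval x (F i) = 0) ∧ (⨅ j, nuZMod p n (x j)) = h)
    fun x hx => exists_pow_mul_eq_of_iInf_nuZMod_eq hp ht x hx.2
  have hred := Nat.card_subtype_addMonoidHom
    ((ZMod.castHom hdvd (ZMod (p ^ (n - d * h)))).toAddMonoidHom.compLeft (Fin m))
    (fun y => (∀ i, MvPolynomial.eval y
        (MvPolynomial.map (ZMod.castHom hdvd (ZMod (p ^ (n - d * h)))) (F i)) = 0) ∧
      (⨅ j, nuZMod p (n - d * h) (y j)) = 0)
    fun y _ => ZMod.castHom_compLeft_surjective hdvd _ y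
  rw [ZMod.card_ker_mulLeft_compLeft hp ht.le] at hmul
  rw [ZMod.card_ker_castHom_compLeft hp (Nat.sub_le _ _), Nat.sub_sub_self hh.le] at hred
  have hexp : d * h * m = h * m + (d - 1) * h * m := by
    obtain ⟨e, rfl⟩ := Nat.exists_eq_add_of_lt hd
    simp
    ring
  refine Nat.eq_of_mul_eq_mul_left (pow_pos hp.pos (h * m)) ?_
  rw [← mul_assoc, ← pow_add, ← hexp, ← hred, ← hmul]
  exact Nat.card_congr (Equiv.subtypeEquivRight fun z => and_congr
    (forall_congr' fun i => (hF i).eval_pow_mul_eq_zero_iff hp hh.le hdvd z)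
    (iInf_nuZMod_pow_mul_eq_iff hp ht hr hdvd z))
end

section
/- There exists an absolute constant C > 0 such that for every prime p and every positive integer n, setting q = pⁿ, the number of solutions (a₂,a₃,a₄,b₂,b₃,b₄) ∈ (ℤ/qℤ)^6 to the system a₂b₃ − a₃b₂ = a₂b₄ − a₄b₂ = a₃b₄ − a₄b₃ = 0 which additionally satisfy a₂b₃ = a₃b₂ = 0 is at most C·n²·q^{7/2}. -/
open Finset in
/-- If `f` and `g` jointly separate points and `g` maps each fibre of `f` into a set of size at
most `N`, then the source has at most `N` times as many elements as the target of `f`. -/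
theorem Finset.card_le_mul_card_of_fiber {α β γ : Type*} [DecidableEq β] [DecidableEq γ]
    (s : Finset α) (t : Finset β) (f : α → β) (g : α → γ) (u : β → Finset γ) (N : ℕ)
    (hf : ∀ a ∈ s, f a ∈ t) (hg : ∀ a ∈ s, g a ∈ u (f a)) (hu : ∀ a ∈ s, #(u (f a)) ≤ N)
    (hinj : ∀ a a', f a = f a' → g a = g a' → a = a') : #s ≤ N * #t := by
  refine card_le_mul_card_image_of_maps_to hf N fun b _ => ?_
  rcases (s.filter (f · = b)).eq_empty_or_nonempty with h | ⟨a, ha⟩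
  · simp [h]
  · obtain ⟨has, rfl⟩ := mem_filter.1 ha
    refine le_trans (card_le_card_of_injOn g (t := u (f a)) ?_ ?_) (hu a has)
    · intro x hx
      obtain ⟨hxs, hxa⟩ := mem_filter.1 hx
      exact hxa ▸ hg x hxs
    · intro x hx y hy hxy
      have hx' := (mem_filter.1 hx).2
      have hy' := (mem_filter.1 hy).2
      exact hinj x y (hx'.trans hy'.symm) hxy

/-- The number of solutions of `x * y = c` for fixed `x` is at most that of `x * y = 0`. -/
theorem card_filter_mul_left_eq_le {R : Type*} [Ring R] [Fintype R] [DecidableEq R] (x c : R) :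
    (Finset.univ.filter fun y : R => x * y = c).card ≤
      (Finset.univ.filter fun y : R => x * y = 0).card := by
  rcases (Finset.univ.filter fun y : R => x * y = c).eq_empty_or_nonempty with h | ⟨z, hz⟩
  · simp [h]
  · have hz' := (Finset.mem_filter.1 hz).2
    refine Finset.card_le_card_of_injOn (· - z) ?_ fun a _ b _ h => by simpa using h
    intro y hy
    have hy' : x * y = c := by simpa using hy
    simp [mul_sub, hy', hz']

/-- The number of solutions of `x * y = c` is at most that of `x * y = 0`. -/
theorem card_filter_mul_eq_le {R : Type*} [Ring R] [Fintype R] [DecidableEq R] (c : R) :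
    (Finset.univ.filter fun z : R × R => z.1 * z.2 = c).card ≤
      (Finset.univ.filter fun z : R × R => z.1 * z.2 = 0).card := by
  simp only [Finset.card_filter, Fintype.sum_prod_type]
  refine Finset.sum_le_sum fun x _ => ?_
  simpa only [Finset.card_filter] using card_filter_mul_left_eq_le x c

open Finset in
/-- If multiplication by any `x ∉ K` has all fibres of size at most `m`, this bounds the number of
degenerate solutions over a finite ring in terms of `m`, `#K` and the number of pairs with
product zero. -/
theorem card_degenerate_solutions_le {R : Type*} [CommRing R] [Fintype R] [DecidableEq R]
    (K : Finset R) (m : ℕ) (hfib : ∀ x ∉ K, ∀ c, #(univ.filter fun y : R => x * y = c) ≤ m)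
    (S : Finset ((R × R × R) × (R × R × R)))
    (h24 : ∀ t ∈ S, t.1.1 * t.2.2.2 = t.1.2.2 * t.2.1)
    (h34 : ∀ t ∈ S, t.1.2.1 * t.2.2.2 = t.1.2.2 * t.2.2.1)
    (h23 : ∀ t ∈ S, t.1.1 * t.2.2.1 = 0) (h32 : ∀ t ∈ S, t.1.2.1 * t.2.1 = 0)
    (Z : Finset (R × R)) (hZ : Z = univ.filter fun z : R × R => z.1 * z.2 = 0) :
    #S ≤ 4 * (m * (#Z * #Z * Fintype.card R)) + #Z * (#K * (#K * #K) * Fintype.card R) := by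
  have hT : #((Z ×ˢ Z) ×ˢ (univ : Finset R)) = #Z * #Z * Fintype.card R := by
    simp only [card_product, card_univ]
  have hH : #((K ×ˢ K ×ˢ K) ×ˢ (univ : Finset R)) = #K * (#K * #K) * Fintype.card R := by
    simp only [card_product, card_univ]
  rw [← hT, ← hH]
  let T := (Z ×ˢ Z) ×ˢ (univ : Finset R)
  let f : (R × R × R) × (R × R × R) → ((R × R) × R × R) × R :=
    fun t => (((t.1.1, t.2.2.1), (t.1.2.1, t.2.1)), t.1.2.2)
  let g : (R × R × R) × (R × R × R) → ((R × R) × R × R) × R :=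
    fun t => (((t.1.1, t.2.2.1), (t.1.2.1, t.2.1)), t.2.2.2)
  have hfT : ∀ t ∈ S, f t ∈ T := fun t ht => by simp [f, T, hZ, h23 t ht, h32 t ht]
  have hgT : ∀ t ∈ S, g t ∈ T := fun t ht => by simp [g, T, hZ, h23 t ht, h32 t ht]
  have hf_inj : ∀ t t', f t = f t' → t.2.2.2 = t'.2.2.2 → t = t' := by
    rintro ⟨⟨_, _, _⟩, _, _, _⟩ ⟨⟨_, _, _⟩, _, _, _⟩ h h'
    simp only [f, Prod.mk.injEq] at h h' ⊢
    tauto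
  have hg_inj : ∀ t t', g t = g t' → t.1.2.2 = t'.1.2.2 → t = t' := by
    rintro ⟨⟨_, _, _⟩, _, _, _⟩ ⟨⟨_, _, _⟩, _, _, _⟩ h h'
    simp only [g, Prod.mk.injEq] at h h' ⊢
    tauto
  have ha₂ : #(S.filter fun t => t.1.1 ∉ K) ≤ m * #T := by
    refine card_le_mul_card_of_fiber _ T f (fun t => t.2.2.2)
      (fun b => univ.filter fun y : R => b.1.1.1 * y = b.2 * b.1.2.2) _
      (fun t ht => hfT t (mem_filter.1 ht).1) (fun t ht => ?_)
      (fun t ht => hfib _ (mem_filter.1 ht).2 _) hf_inj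
    simpa [f] using h24 t (mem_filter.1 ht).1
  have ha₃ : #(S.filter fun t => t.1.2.1 ∉ K) ≤ m * #T := by
    refine card_le_mul_card_of_fiber _ T f (fun t => t.2.2.2)
      (fun b => univ.filter fun y : R => b.1.2.1 * y = b.2 * b.1.1.2) _
      (fun t ht => hfT t (mem_filter.1 ht).1) (fun t ht => ?_)
      (fun t ht => hfib _ (mem_filter.1 ht).2 _) hf_inj
    simpa [f] using h34 t (mem_filter.1 ht).1
  have hb₂ : #(S.filter fun t => t.2.1 ∉ K) ≤ m * #T := by
    refine card_le_mul_card_of_fiber _ T g (fun t => t.1.2.2)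
      (fun b => univ.filter fun y : R => b.1.2.2 * y = b.1.1.1 * b.2) _
      (fun t ht => hgT t (mem_filter.1 ht).1) (fun t ht => ?_)
      (fun t ht => hfib _ (mem_filter.1 ht).2 _) hg_inj
    simpa [g, mul_comm t.2.1] using (h24 t (mem_filter.1 ht).1).symm
  have hb₃ : #(S.filter fun t => t.2.2.1 ∉ K) ≤ m * #T := by
    refine card_le_mul_card_of_fiber _ T g (fun t => t.1.2.2)
      (fun b => univ.filter fun y : R => b.1.1.2 * y = b.1.2.1 * b.2) _
      (fun t ht => hgT t (mem_filter.1 ht).1) (fun t ht => ?_)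
      (fun t ht => hfib _ (mem_filter.1 ht).2 _) hg_inj
    simpa [g, mul_comm t.2.2.1] using (h34 t (mem_filter.1 ht).1).symm
  have hhigh : #(S.filter fun t => t.1.2.1 ∈ K ∧ t.2.1 ∈ K ∧ t.2.2.1 ∈ K) ≤
      #Z * #((K ×ˢ K ×ˢ K) ×ˢ (univ : Finset R)) := by
    refine card_le_mul_card_of_fiber _ _
      (fun t => ((t.1.2.1, t.2.1, t.2.2.1), t.1.2.2)) (fun t => (t.1.1, t.2.2.2))
      (fun b => univ.filter fun z : R × R => z.1 * z.2 = b.2 * b.1.2.1) _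
      (fun t ht => ?_) (fun t ht => ?_) (fun t ht => hZ ▸ card_filter_mul_eq_le _) ?_
    · simpa using (mem_filter.1 ht).2
    · simpa using h24 t (mem_filter.1 ht).1
    · rintro ⟨⟨_, _, _⟩, _, _, _⟩ ⟨⟨_, _, _⟩, _, _, _⟩ h h'
      simp only [Prod.mk.injEq] at h h' ⊢
      tauto
  have hcover : S ⊆ ((((S.filter fun t => t.1.1 ∉ K) ∪ S.filter fun t => t.1.2.1 ∉ K) ∪
      S.filter fun t => t.2.1 ∉ K) ∪ S.filter fun t => t.2.2.1 ∉ K) ∪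
      S.filter fun t => t.1.2.1 ∈ K ∧ t.2.1 ∈ K ∧ t.2.2.1 ∈ K := by
    intro t ht
    simp only [mem_union, mem_filter, ht, true_and]
    tauto
  have := card_le_card hcover
  have := card_union_le ((((S.filter fun t => t.1.1 ∉ K) ∪ S.filter fun t => t.1.2.1 ∉ K) ∪
      S.filter fun t => t.2.1 ∉ K) ∪ S.filter fun t => t.2.2.1 ∉ K)
      (S.filter fun t => t.1.2.1 ∈ K ∧ t.2.1 ∈ K ∧ t.2.2.1 ∈ K)
  have := card_union_le (((S.filter fun t => t.1.1 ∉ K) ∪ S.filter fun t => t.1.2.1 ∉ K) ∪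
      S.filter fun t => t.2.1 ∉ K) (S.filter fun t => t.2.2.1 ∉ K)
  have := card_union_le ((S.filter fun t => t.1.1 ∉ K) ∪ S.filter fun t => t.1.2.1 ∉ K)
      (S.filter fun t => t.2.1 ∉ K)
  have := card_union_le (S.filter fun t => t.1.1 ∉ K) (S.filter fun t => t.1.2.1 ∉ K)
  change _ ≤ 4 * (m * #T) + _
  omega

namespace ZMod

variable {p n : ℕ}

theorem exists_pow_mul_eq_zero_of_mul_eq_zero (hp : p.Prime) {x y : ZMod (p ^ n)}
    (h : x * y = 0) :
    ∃ i ≤ n, (p : ZMod (p ^ n)) ^ i * x = 0 ∧ (p : ZMod (p ^ n)) ^ (n - i) * y = 0 := by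
  have : NeZero (p ^ n) := ⟨pow_ne_zero n hp.ne_zero⟩
  have hd : p ^ n ∣ x.val * y.val := by
    rw [← ZMod.natCast_eq_zero_iff]
    simpa using h
  obtain ⟨k, l, hk, hl, hkl⟩ := (Nat.dvd_mul).1 hd
  obtain ⟨s, -, rfl⟩ := (Nat.dvd_prime_pow hp).1 (Dvd.intro _ hkl)
  obtain ⟨t, -, rfl⟩ := (Nat.dvd_prime_pow hp).1 (Dvd.intro_left _ hkl)
  have hst : s + t = n := Nat.pow_right_injective hp.two_le (by simpa [pow_add] using hkl)
  have key : ∀ (i j : ℕ) (z : ZMod (p ^ n)), i + j = n → p ^ j ∣ z.val →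
      (p : ZMod (p ^ n)) ^ i * z = 0 := by
    intro i j z hij hz
    have h1 : ((p ^ i * z.val : ℕ) : ZMod (p ^ n)) = 0 := by
      rw [ZMod.natCast_eq_zero_iff]
      calc p ^ n = p ^ i * p ^ j := by rw [← hij, pow_add]
        _ ∣ _ := mul_dvd_mul_left _ hz
    simpa using h1
  refine ⟨t, by omega, key t s x (by omega) hk, key (n - t) t y (by omega) hl⟩

theorem card_filter_pow_mul_eq_zero_le (hp : p.Prime) [NeZero (p ^ n)] (i : ℕ) :
    (Finset.univ.filter fun x : ZMod (p ^ n) => (p : ZMod (p ^ n)) ^ i * x = 0).card ≤ p ^ i := by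
  simpa [nsmul_eq_mul] using
    IsAddCyclic.card_nsmul_eq_zero_le (α := ZMod (p ^ n)) (pow_pos hp.pos i)

theorem card_filter_mul_eq_zero_le (hp : p.Prime) [NeZero (p ^ n)] :
    (Finset.univ.filter fun z : ZMod (p ^ n) × ZMod (p ^ n) => z.1 * z.2 = 0).card ≤
      (n + 1) * p ^ n := by
  let K (i : ℕ) := Finset.univ.filter fun x : ZMod (p ^ n) => (p : ZMod (p ^ n)) ^ i * x = 0
  have hsub : (Finset.univ.filter fun z : ZMod (p ^ n) × ZMod (p ^ n) => z.1 * z.2 = 0) ⊆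
      (Finset.range (n + 1)).biUnion fun i => K i ×ˢ K (n - i) := by
    intro z hz
    obtain ⟨i, hi, h1, h2⟩ := exists_pow_mul_eq_zero_of_mul_eq_zero hp (Finset.mem_filter.1 hz).2
    simp only [Finset.mem_biUnion, Finset.mem_range, Finset.mem_product]
    exact ⟨i, by omega, by simpa [K] using h1, by simpa [K] using h2⟩
  refine (Finset.card_le_card hsub).trans ?_
  have hK : ∀ i ∈ Finset.range (n + 1), (K i ×ˢ K (n - i)).card ≤ p ^ n := by
    intro i hi
    have hin : i + (n - i) = n := by have := Finset.mem_range.1 hi; omega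
    calc (K i ×ˢ K (n - i)).card = (K i).card * (K (n - i)).card := Finset.card_product _ _
      _ ≤ p ^ i * p ^ (n - i) := Nat.mul_le_mul (card_filter_pow_mul_eq_zero_le hp i)
          (card_filter_pow_mul_eq_zero_le hp (n - i))
      _ = p ^ n := by rw [← pow_add, hin]
  simpa using Finset.card_biUnion_le_card_mul _ _ _ hK

theorem card_filter_mul_left_eq_le_pow (hp : p.Prime) [NeZero (p ^ n)] {x : ZMod (p ^ n)}
    (hx : (p : ZMod (p ^ n)) ^ (n / 2) * x ≠ 0) (c : ZMod (p ^ n)) :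
    (Finset.univ.filter fun y : ZMod (p ^ n) => x * y = c).card ≤ p ^ (n / 2) := by
  refine (card_filter_mul_left_eq_le x c).trans
    ((Finset.card_le_card ?_).trans (card_filter_pow_mul_eq_zero_le hp (n / 2)))
  intro y hy
  obtain ⟨i, hi, h1, h2⟩ := exists_pow_mul_eq_zero_of_mul_eq_zero hp (Finset.mem_filter.1 hy).2
  have hmi : n / 2 < i := by
    by_contra! hle
    obtain ⟨k, hk⟩ := Nat.exists_eq_add_of_le' hle
    exact hx (by rw [hk, pow_add, mul_assoc, h1, mul_zero])
  obtain ⟨k, hk⟩ := Nat.exists_eq_add_of_le' (show n - i ≤ n / 2 by omega)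
  refine Finset.mem_filter.2 ⟨Finset.mem_univ _, ?_⟩
  rw [hk, pow_add, mul_assoc, h2, mul_zero]

open Finset in
theorem card_degenerate_solutions_le (hp : p.Prime) [NeZero (p ^ n)]
    (S : Finset ((ZMod (p ^ n) × ZMod (p ^ n) × ZMod (p ^ n)) ×
      (ZMod (p ^ n) × ZMod (p ^ n) × ZMod (p ^ n))))
    (h24 : ∀ t ∈ S, t.1.1 * t.2.2.2 = t.1.2.2 * t.2.1)
    (h34 : ∀ t ∈ S, t.1.2.1 * t.2.2.2 = t.1.2.2 * t.2.2.1)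
    (h23 : ∀ t ∈ S, t.1.1 * t.2.2.1 = 0) (h32 : ∀ t ∈ S, t.1.2.1 * t.2.1 = 0) :
    #S ≤ 5 * (n + 1) ^ 2 * (p ^ n) ^ 3 * p ^ (n / 2) := by
  have hS := _root_.card_degenerate_solutions_le
    (univ.filter fun x : ZMod (p ^ n) => (p : ZMod (p ^ n)) ^ (n / 2) * x = 0) (p ^ (n / 2))
    (fun x hx => card_filter_mul_left_eq_le_pow hp (by simpa using hx)) S h24 h34 h23 h32 _ rfl
  have hK := card_filter_pow_mul_eq_zero_le (n := n) hp (n / 2)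
  have hZ := card_filter_mul_eq_zero_le (n := n) hp
  rw [ZMod.card] at hS
  generalize #(univ.filter fun x : ZMod (p ^ n) => (p : ZMod (p ^ n)) ^ (n / 2) * x = 0) = k
    at hS hK
  generalize #(univ.filter fun z : ZMod (p ^ n) × ZMod (p ^ n) => z.1 * z.2 = 0) = z at hS hZ
  have hsq : p ^ (n / 2) * p ^ (n / 2) ≤ p ^ n := by
    rw [← pow_add]
    exact Nat.pow_le_pow_right hp.pos (by omega)
  calc #S ≤ 4 * (p ^ (n / 2) * (z * z * p ^ n)) + z * (k * (k * k) * p ^ n) := hS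
    _ ≤ 4 * (p ^ (n / 2) * (((n + 1) * p ^ n) * ((n + 1) * p ^ n) * p ^ n)) +
        (n + 1) * p ^ n * (p ^ (n / 2) * (p ^ (n / 2) * p ^ (n / 2)) * p ^ n) := by gcongr
    _ ≤ 4 * (p ^ (n / 2) * (((n + 1) * p ^ n) * ((n + 1) * p ^ n) * p ^ n)) +
        (n + 1) * p ^ n * (p ^ (n / 2) * p ^ n * p ^ n) := by gcongr
    _ = (4 * (n + 1) ^ 2 + (n + 1)) * ((p ^ n) ^ 3 * p ^ (n / 2)) := by ring
    _ ≤ (4 * (n + 1) ^ 2 + (n + 1) ^ 2) * ((p ^ n) ^ 3 * p ^ (n / 2)) := by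
        gcongr
        exact Nat.le_self_pow two_ne_zero _
    _ = _ := by ring

end ZMod

theorem degenerate_solutions_mod_p_pow :
    ∃ C : ℝ, 0 < C ∧ ∀ p n : ℕ, p.Prime → 0 < n →
      (Nat.card {t : (ZMod (p ^ n) × ZMod (p ^ n) × ZMod (p ^ n)) ×
          (ZMod (p ^ n) × ZMod (p ^ n) × ZMod (p ^ n)) //
          t.1.1 * t.2.2.1 - t.1.2.1 * t.2.1 = 0 ∧
          t.1.1 * t.2.2.2 - t.1.2.2 * t.2.1 = 0 ∧
          t.1.2.1 * t.2.2.2 - t.1.2.2 * t.2.2.1 = 0 ∧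
          t.1.1 * t.2.2.1 = 0 ∧ t.1.2.1 * t.2.1 = 0} : ℝ) ≤
        C * (n : ℝ) ^ 2 * ((p : ℝ) ^ n) ^ ((7 : ℝ) / 2) := by
  refine ⟨20, by norm_num, fun p n hp hn => ?_⟩
  have : NeZero (p ^ n) := ⟨pow_ne_zero n hp.ne_zero⟩
  rw [Nat.card_eq_fintype_card, Fintype.card_subtype]
  have hcard := ZMod.card_degenerate_solutions_le hp (Finset.univ.filter
    fun t : (ZMod (p ^ n) × ZMod (p ^ n) × ZMod (p ^ n)) ×
          (ZMod (p ^ n) × ZMod (p ^ n) × ZMod (p ^ n)) =>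
          t.1.1 * t.2.2.1 - t.1.2.1 * t.2.1 = 0 ∧
          t.1.1 * t.2.2.2 - t.1.2.2 * t.2.1 = 0 ∧
          t.1.2.1 * t.2.2.2 - t.1.2.2 * t.2.2.1 = 0 ∧
          t.1.1 * t.2.2.1 = 0 ∧ t.1.2.1 * t.2.1 = 0)
    (fun t ht => sub_eq_zero.1 (Finset.mem_filter.1 ht).2.2.1)
    (fun t ht => sub_eq_zero.1 (Finset.mem_filter.1 ht).2.2.2.1)
    (fun t ht => (Finset.mem_filter.1 ht).2.2.2.2.1)
    (fun t ht => (Finset.mem_filter.1 ht).2.2.2.2.2)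
  refine (Nat.cast_le (α := ℝ).2 hcard).trans ?_
  push_cast
  have hp1 : (1 : ℝ) ≤ p := by exact_mod_cast hp.one_le
  have hq : (0 : ℝ) < (p : ℝ) ^ n := by positivity
  have hsqrt : (p : ℝ) ^ (n / 2) ≤ √((p : ℝ) ^ n) := by
    refine Real.le_sqrt_of_sq_le ?_
    rw [← pow_mul]
    exact pow_le_pow_right₀ hp1 (by omega)
  have hsplit : ((p : ℝ) ^ n) ^ ((7 : ℝ) / 2) = ((p : ℝ) ^ n) ^ 3 * √((p : ℝ) ^ n) := by
    rw [Real.sqrt_eq_rpow, ← Real.rpow_natCast _ 3, ← Real.rpow_add hq]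
    norm_num
  have hn1 : (1 : ℝ) ≤ n := by exact_mod_cast hn
  have hn2 : 5 * ((n : ℝ) + 1) ^ 2 ≤ 20 * (n : ℝ) ^ 2 := by nlinarith
  rw [hsplit, ← mul_assoc]
  gcongr
end

section
/- Let p be a prime and n a positive integer. For each integer h with 0 ≤ h < n/2, let S(n,h) denote the set of solutions (a₂,a₃,a₄,b₂,b₃,b₄) ∈ (ℤ/pⁿℤ)^6 to the system a₂b₃ − a₃b₂ = a₂b₄ − a₄b₂ = a₃b₄ − a₄b₃ = 0 which satisfy min{ν_p(a₂), ν_p(a₃), ν_p(a₄), ν_p(b₂), ν_p(b₃), ν_p(b₄)} = h. Then |S(n,h)| = p^{4n−2h}·(1 + 1/p)·(1 − 1/p³). -/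
section Counting

variable {G H : Type*} [AddCommGroup G] [AddCommGroup H]

theorem AddMonoidHom.card_preimage_eq_mul_card_ker (f : G →+ H) (S : Set H)
    (hS : S ⊆ Set.range f) :
    Nat.card {x // f x ∈ S} = Nat.card S * Nat.card f.ker := by
  choose s hs using hS
  rw [← Nat.card_prod]
  refine Nat.card_congr
    { toFun := fun x => (⟨f x, x.2⟩, ⟨x - s x.2, by simp [f.mem_ker, hs]⟩)
      invFun := fun y => ⟨s y.1.2 + y.2, ?_⟩
      left_inv := fun x => by simp
      right_inv := ?_ }
  · have := f.mem_ker.1 y.2.2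
    simp [hs, this]
  · rintro ⟨⟨y, hy⟩, ⟨k, hk⟩⟩
    have hk' := f.mem_ker.1 hk
    simp [hs, hk']

theorem AddMonoidHom.card_mul_card_ker_of_surjective (f : G →+ H)
    (hf : Function.Surjective f) : Nat.card H * Nat.card f.ker = Nat.card G := by
  have := f.card_preimage_eq_mul_card_ker Set.univ (by simp [hf.range_eq])
  simpa [Nat.card_congr (Equiv.subtypeUnivEquiv fun x : G => Set.mem_univ (f x))] using this.symm

end Counting

section PrimePowerModulus

variable {p : ℕ} {n k : ℕ}

theorem ZMod.prime_pow_dvd_intCast_iff (hk : k ≤ n) (z : ℤ) :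
    (p : ZMod (p ^ n)) ^ k ∣ (z : ZMod (p ^ n)) ↔ (p : ℤ) ^ k ∣ z := by
  constructor
  · rintro ⟨y, hy⟩
    obtain ⟨w, rfl⟩ := ZMod.intCast_surjective y
    have h0 : ((z - (p : ℤ) ^ k * w : ℤ) : ZMod (p ^ n)) = 0 := by
      push_cast
      rw [hy, sub_self]
    rw [ZMod.intCast_zmod_eq_zero_iff_dvd] at h0
    push_cast at h0
    exact (dvd_sub_left (dvd_mul_right _ _)).1 ((pow_dvd_pow _ hk).trans h0)
  · rintro ⟨w, rfl⟩
    exact ⟨w, by push_cast; rfl⟩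

theorem ZMod.prime_pow_mul_eq_zero_iff (hp : p.Prime) (hk : k ≤ n) (x : ZMod (p ^ n)) :
    (p : ZMod (p ^ n)) ^ k * x = 0 ↔
      ZMod.castHom (pow_dvd_pow p (Nat.sub_le n k)) (ZMod (p ^ (n - k))) x = 0 := by
  obtain ⟨z, rfl⟩ := ZMod.intCast_surjective x
  have hpz : (p : ℤ) ^ k ≠ 0 := pow_ne_zero _ (by exact_mod_cast hp.ne_zero)
  have h1 : (p : ZMod (p ^ n)) ^ k * (z : ZMod (p ^ n)) =
      (((p : ℤ) ^ k * z : ℤ) : ZMod (p ^ n)) := by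
    push_cast
    rfl
  rw [h1, map_intCast, ZMod.intCast_zmod_eq_zero_iff_dvd, ZMod.intCast_zmod_eq_zero_iff_dvd]
  push_cast
  rw [← Nat.add_sub_cancel' hk, pow_add, Nat.add_sub_cancel_left]
  exact mul_dvd_mul_iff_left hpz

theorem ZMod.prime_dvd_castHom_iff (hk : k ≤ n) (hk0 : 0 < k) (x : ZMod (p ^ n)) :
    (p : ZMod (p ^ k)) ∣ ZMod.castHom (pow_dvd_pow p hk) (ZMod (p ^ k)) x ↔
      (p : ZMod (p ^ n)) ∣ x := by
  obtain ⟨z, rfl⟩ := ZMod.intCast_surjective x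
  have h1 := ZMod.prime_pow_dvd_intCast_iff (p := p) (n := k) (k := 1) hk0 z
  have h2 := ZMod.prime_pow_dvd_intCast_iff (p := p) (n := n) (k := 1) (hk0.trans_le hk) z
  rw [pow_one, pow_one] at h1 h2
  rw [map_intCast, h1, h2]

theorem ZMod.prime_pow_succ_dvd_prime_pow_mul_iff (hp : p.Prime) (hk : k < n)
    (x : ZMod (p ^ n)) :
    (p : ZMod (p ^ n)) ^ (k + 1) ∣ (p : ZMod (p ^ n)) ^ k * x ↔ (p : ZMod (p ^ n)) ∣ x := by
  obtain ⟨z, rfl⟩ := ZMod.intCast_surjective x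
  have h1 := ZMod.prime_pow_dvd_intCast_iff (p := p) (n := n) (k := k + 1) hk ((p : ℤ) ^ k * z)
  have h2 := ZMod.prime_pow_dvd_intCast_iff (p := p) (n := n) (k := 1) (by omega) z
  push_cast at h1
  rw [pow_one, pow_one] at h2
  rw [h1, h2, pow_succ]
  exact mul_dvd_mul_iff_left (pow_ne_zero _ (by exact_mod_cast hp.ne_zero))

theorem ZMod.isUnit_iff_not_prime_dvd (hp : p.Prime) (hn : 0 < n) (x : ZMod (p ^ n)) :
    IsUnit x ↔ ¬ (p : ZMod (p ^ n)) ∣ x := by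
  obtain ⟨z, rfl⟩ := ZMod.intCast_surjective x
  have h2 := ZMod.prime_pow_dvd_intCast_iff (p := p) (n := n) (k := 1) hn z
  rw [pow_one, pow_one] at h2
  rw [h2, ZMod.coe_int_isUnit_iff_isCoprime, Nat.cast_pow, IsCoprime.pow_left_iff hn]
  exact (Nat.prime_iff_prime_int.1 hp).coprime_iff_not_dvd

theorem ZMod.card_prime_dvd (hp : p.Prime) :
    Nat.card {x : ZMod (p ^ (n + 1)) // (p : ZMod (p ^ (n + 1))) ∣ x} = p ^ n := by
  let f := (ZMod.castHom (pow_dvd_pow p (Nat.le_add_left 1 n)) (ZMod (p ^ 1))).toAddMonoidHom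
  have hf : Function.Surjective f :=
    ZMod.castHom_surjective (pow_dvd_pow p (Nat.le_add_left 1 n))
  have hker := f.card_mul_card_ker_of_surjective hf
  rw [Nat.card_zmod, Nat.card_zmod] at hker
  rw [← Nat.eq_of_mul_eq_mul_left (pow_pos hp.pos 1) (hker.trans (by ring : _ = p ^ 1 * p ^ n))]
  refine Nat.card_congr (Equiv.subtypeEquivRight fun x => ?_)
  rw [← ZMod.prime_dvd_castHom_iff (k := 1) (Nat.le_add_left 1 n) one_pos]
  have : (p : ZMod (p ^ 1)) = 0 := by
    rw [ZMod.natCast_eq_zero_iff, pow_one]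
  rw [this, zero_dvd_iff]
  exact f.mem_ker.symm

theorem le_nuZMod_iff (hp : p.Prime) (hk : k ≤ n) (x : ZMod (p ^ n)) :
    k ≤ nuZMod p n x ↔ (p : ZMod (p ^ n)) ^ k ∣ x := by
  have : NeZero (p ^ n) := ⟨pow_ne_zero _ hp.ne_zero⟩
  have : Fact p.Prime := ⟨hp⟩
  unfold nuZMod
  split_ifs with hx
  · simp [hx, hk]
  · have hv : x.val ≠ 0 := by rwa [Ne, ZMod.val_eq_zero]
    have h1 := ZMod.prime_pow_dvd_intCast_iff (p := p) hk (x.val : ℤ)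
    rw [Int.cast_natCast, ZMod.natCast_zmod_val] at h1
    rw [h1, ← padicValNat_dvd_iff_le hv]
    norm_cast

end PrimePowerModulus

section Matrices

/-- Two rows of length three, that is, a `2 × 3` matrix. -/
abbrev RowPair (R : Type*) := (R × R × R) × (R × R × R)

/-- All `2 × 2` minors of the matrix vanish. -/
def RowPair.MinorsVanish {R : Type*} [CommRing R] (t : RowPair R) : Prop :=
  t.1.1 * t.2.2.1 - t.1.2.1 * t.2.1 = 0 ∧
  t.1.1 * t.2.2.2 - t.1.2.2 * t.2.1 = 0 ∧
  t.1.2.1 * t.2.2.2 - t.1.2.2 * t.2.2.1 = 0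

/-- All three coordinates are divisible by `r`. -/
def DvdCoords {R : Type*} [CommRing R] (r : R) (v : R × R × R) : Prop :=
  r ∣ v.1 ∧ r ∣ v.2.1 ∧ r ∣ v.2.2

/-- The entrywise extension of a ring homomorphism. -/
def RowPair.map {R S : Type*} [CommRing R] [CommRing S] (f : R →+* S) :
    RowPair R →+* RowPair S :=
  (f.prodMap (f.prodMap f)).prodMap (f.prodMap (f.prodMap f))

theorem RowPair.map_surjective {R S : Type*} [CommRing R] [CommRing S] {f : R →+* S}
    (hf : Function.Surjective f) : Function.Surjective (RowPair.map f) :=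
  (hf.prodMap (hf.prodMap hf)).prodMap (hf.prodMap (hf.prodMap hf))

theorem RowPair.card_eq (R : Type*) : Nat.card (RowPair R) = Nat.card R ^ 6 := by
  simp only [Nat.card_prod]
  ring

variable {R : Type*} [CommRing R]

theorem RowPair.minorsVanish_swap {a b : R × R × R} (h : MinorsVanish (a, b)) :
    MinorsVanish (b, a) := by
  obtain ⟨h1, h2, h3⟩ := h
  dsimp only at h1 h2 h3
  refine ⟨?_, ?_, ?_⟩ <;> dsimp only <;> grind

theorem RowPair.minorsVanish_smul (c : R) (a : R × R × R) : MinorsVanish (a, c • a) := by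
  refine ⟨?_, ?_, ?_⟩ <;> simp <;> ring

theorem RowPair.exists_eq_smul_of_minorsVanish {a b : R × R × R}
    (ha : IsUnit a.1 ∨ IsUnit a.2.1 ∨ IsUnit a.2.2) (h : MinorsVanish (a, b)) :
    ∃ c : R, c • a = b := by
  obtain ⟨a1, a2, a3⟩ := a
  obtain ⟨b1, b2, b3⟩ := b
  obtain ⟨h1, h2, h3⟩ := h
  dsimp only at h1 h2 h3 ha
  rcases ha with ha | ha | ha <;> obtain ⟨u, hu⟩ := ha.exists_right_inv
  · refine ⟨b1 * u, ?_⟩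
    simp only [Prod.smul_mk, smul_eq_mul, Prod.mk.injEq]
    refine ⟨?_, ?_, ?_⟩ <;> grind
  · refine ⟨b2 * u, ?_⟩
    simp only [Prod.smul_mk, smul_eq_mul, Prod.mk.injEq]
    refine ⟨?_, ?_, ?_⟩ <;> grind
  · refine ⟨b3 * u, ?_⟩
    simp only [Prod.smul_mk, smul_eq_mul, Prod.mk.injEq]
    refine ⟨?_, ?_, ?_⟩ <;> grind

theorem smul_left_injective_of_isUnit_coord {a : R × R × R}
    (ha : IsUnit a.1 ∨ IsUnit a.2.1 ∨ IsUnit a.2.2) :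
    Function.Injective fun c : R => c • a := by
  intro c d h
  simp only [Prod.ext_iff, Prod.smul_fst, Prod.smul_snd, smul_eq_mul] at h
  rcases ha with ha | ha | ha
  · exact ha.mul_left_injective h.1
  · exact ha.mul_left_injective h.2.1
  · exact ha.mul_left_injective h.2.2

theorem dvdCoords_smul {r c : R} (hc : r ∣ c) (a : R × R × R) : DvdCoords r (c • a) :=
  ⟨hc.mul_right _, hc.mul_right _, hc.mul_right _⟩

theorem dvd_of_dvdCoords_smul {r c : R} {a : R × R × R}
    (ha : IsUnit a.1 ∨ IsUnit a.2.1 ∨ IsUnit a.2.2) (h : DvdCoords r (c • a)) : r ∣ c := by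
  obtain ⟨h1, h2, h3⟩ := h
  simp only [Prod.smul_fst, Prod.smul_snd, smul_eq_mul] at h1 h2 h3
  rcases ha with ha | ha | ha
  · exact ha.dvd_mul_right.1 h1
  · exact ha.dvd_mul_right.1 h2
  · exact ha.dvd_mul_right.1 h3

/-- If non-divisibility by `r` detects units, the primitive matrices with vanishing minors split
into those with primitive first row `a` and second row `c • a`, and those with primitive second
row `b` and first row `c • b` with `r ∣ c`. -/
theorem RowPair.card_primitive_minorsVanish [Finite R] {r : R}
    (hr : ∀ x : R, IsUnit x ↔ ¬ r ∣ x) :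
    Nat.card {t : RowPair R // t.MinorsVanish ∧ ¬ (DvdCoords r t.1 ∧ DvdCoords r t.2)} =
      Nat.card {v : R × R × R // ¬ DvdCoords r v} * (Nat.card R + Nat.card {c : R // r ∣ c}) := by
  have hu : ∀ v : R × R × R, ¬ DvdCoords r v → IsUnit v.1 ∨ IsUnit v.2.1 ∨ IsUnit v.2.2 := by
    intro v hv
    simp only [hr]
    unfold DvdCoords at hv
    tauto
  rw [mul_add, ← Nat.card_prod, ← Nat.card_prod, ← Nat.card_sum]
  symm
  let F : ({v : R × R × R // ¬ DvdCoords r v} × R) ⊕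
      ({v : R × R × R // ¬ DvdCoords r v} × {c : R // r ∣ c}) →
      {t : RowPair R // t.MinorsVanish ∧ ¬ (DvdCoords r t.1 ∧ DvdCoords r t.2)} :=
    Sum.elim
      (fun x => ⟨(x.1.1, x.2 • x.1.1), minorsVanish_smul _ _, fun h => x.1.2 h.1⟩)
      (fun x => ⟨(x.2.1 • x.1.1, x.1.1), minorsVanish_swap (minorsVanish_smul _ _),
        fun h => x.1.2 h.2⟩)
  refine Nat.card_congr (Equiv.ofBijective F ⟨?_, ?_⟩)
  · rintro (⟨⟨v, hv⟩, c⟩ | ⟨⟨v, hv⟩, ⟨c, hc⟩⟩) (⟨⟨w, hw⟩, d⟩ | ⟨⟨w, hw⟩, ⟨d, hd⟩⟩) h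
    · have h' := congrArg Subtype.val h
      simp only [F, Sum.elim_inl] at h'
      obtain ⟨rfl, h2⟩ := Prod.ext_iff.1 h'
      obtain rfl := smul_left_injective_of_isUnit_coord (hu v hv) h2
      rfl
    · have h' := congrArg (fun t => t.1.1) h
      simp only [F, Sum.elim_inl, Sum.elim_inr] at h'
      exact absurd (h' ▸ dvdCoords_smul hd w) hv
    · have h' := congrArg (fun t => t.1.1) h
      simp only [F, Sum.elim_inl, Sum.elim_inr] at h'
      exact absurd (h' ▸ dvdCoords_smul hc v) hw
    · have h' := congrArg Subtype.val h
      simp only [F, Sum.elim_inr] at h'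
      obtain ⟨h2, h3⟩ := Prod.ext_iff.1 h'
      dsimp only at h2 h3
      subst h3
      obtain rfl := smul_left_injective_of_isUnit_coord (hu v hv) h2
      rfl
  · rintro ⟨⟨a, b⟩, hm, hd⟩
    by_cases ha : DvdCoords r a
    · have hb : ¬ DvdCoords r b := fun hb => hd ⟨ha, hb⟩
      obtain ⟨c, rfl⟩ := exists_eq_smul_of_minorsVanish (hu b hb) (minorsVanish_swap hm)
      exact ⟨Sum.inr (⟨b, hb⟩, ⟨c, dvd_of_dvdCoords_smul (hu b hb) ha⟩), rfl⟩
    · obtain ⟨c, rfl⟩ := exists_eq_smul_of_minorsVanish (hu a ha) hm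
      exact ⟨Sum.inl (⟨a, ha⟩, c), rfl⟩

theorem card_dvdCoords (r : R) :
    Nat.card {v : R × R × R // DvdCoords r v} = Nat.card {c : R // r ∣ c} ^ 3 := by
  rw [pow_succ', sq, ← Nat.card_prod, ← Nat.card_prod]
  exact Nat.card_congr
    { toFun := fun v => (⟨v.1.1, v.2.1⟩, ⟨v.1.2.1, v.2.2.1⟩, ⟨v.1.2.2, v.2.2.2⟩)
      invFun := fun w => ⟨(w.1.1, w.2.1.1, w.2.2.1), w.1.2, w.2.1.2, w.2.2.2⟩
      left_inv := fun _ => rfl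
      right_inv := fun _ => rfl }

theorem card_not_dvdCoords_add [Finite R] (r : R) :
    Nat.card {v : R × R × R // ¬ DvdCoords r v} + Nat.card {c : R // r ∣ c} ^ 3 =
      Nat.card R ^ 3 := by
  classical
  rw [← card_dvdCoords, add_comm, ← Nat.card_sum, Nat.card_congr (Equiv.sumCompl (DvdCoords r)),
    Nat.card_prod, Nat.card_prod]
  ring

end Matrices

section Scaling

variable {p n h : ℕ}

theorem RowPair.card_primitive_minorsVanish_zmod (hp : p.Prime) (k : ℕ) :
    (Nat.card {t : RowPair (ZMod (p ^ (k + 1))) //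
      t.MinorsVanish ∧ ¬ (DvdCoords (p : ZMod (p ^ (k + 1))) t.1 ∧ DvdCoords ↑p t.2)} : ℝ) =
      (p : ℝ) ^ (4 * k) * (p ^ 3 - 1) * (p + 1) := by
  have : NeZero (p ^ (k + 1)) := ⟨pow_ne_zero _ hp.ne_zero⟩
  rw [card_primitive_minorsVanish (ZMod.isUnit_iff_not_prime_dvd (n := k + 1) hp k.succ_pos),
    ZMod.card_prime_dvd hp, Nat.card_zmod]
  have hU := card_not_dvdCoords_add (p : ZMod (p ^ (k + 1)))
  rw [ZMod.card_prime_dvd hp, Nat.card_zmod] at hU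
  have hU' := congrArg (Nat.cast : ℕ → ℝ) hU
  push_cast at hU' ⊢
  rw [eq_sub_of_add_eq hU']
  ring

theorem RowPair.card_ker_map_castHom (hp : p.Prime) {k : ℕ} (hk : k ≤ n) :
    Nat.card (RowPair.map (ZMod.castHom (pow_dvd_pow p (Nat.sub_le n k))
      (ZMod (p ^ (n - k))))).toAddMonoidHom.ker = p ^ (6 * k) := by
  have := AddMonoidHom.card_mul_card_ker_of_surjective
    (RowPair.map (ZMod.castHom (pow_dvd_pow p (Nat.sub_le n k))
      (ZMod (p ^ (n - k))))).toAddMonoidHom (RowPair.map_surjective (ZMod.castHom_surjective _))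
  rw [RowPair.card_eq, RowPair.card_eq, Nat.card_zmod, Nat.card_zmod] at this
  refine Nat.eq_of_mul_eq_mul_left (pow_pos (pow_pos hp.pos (n - k)) 6) (this.trans ?_)
  rw [← pow_mul, ← pow_mul, ← pow_add]
  congr 1
  omega

theorem min_nuZMod_eq_iff (hp : p.Prime) (hh : h < n) (t : RowPair (ZMod (p ^ n))) :
    min (nuZMod p n t.1.1) (min (nuZMod p n t.1.2.1) (min (nuZMod p n t.1.2.2)
          (min (nuZMod p n t.2.1) (min (nuZMod p n t.2.2.1) (nuZMod p n t.2.2.2))))) = h ↔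
      (DvdCoords ((p : ZMod (p ^ n)) ^ h) t.1 ∧ DvdCoords ((p : ZMod (p ^ n)) ^ h) t.2) ∧
      ¬ (DvdCoords ((p : ZMod (p ^ n)) ^ (h + 1)) t.1 ∧
        DvdCoords ((p : ZMod (p ^ n)) ^ (h + 1)) t.2) := by
  simp only [DvdCoords, ← le_nuZMod_iff hp hh.le, ← le_nuZMod_iff hp (Nat.succ_le_of_lt hh)]
  omega

theorem RowPair.minorsVanish_prime_pow_mul_iff (hp : p.Prime) (hh : 2 * h ≤ n)
    (t : RowPair (ZMod (p ^ n))) :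
    ((p : RowPair (ZMod (p ^ n))) ^ h * t).MinorsVanish ↔
      (RowPair.map (ZMod.castHom (pow_dvd_pow p (Nat.sub_le n (2 * h)))
        (ZMod (p ^ (n - 2 * h)))) t).MinorsVanish := by
  have key : ∀ a b c d : ZMod (p ^ n),
      (p : ZMod (p ^ n)) ^ h * a * (p ^ h * b) - p ^ h * c * (p ^ h * d) = 0 ↔
      ZMod.castHom (pow_dvd_pow p (Nat.sub_le n (2 * h))) (ZMod (p ^ (n - 2 * h)))
        (a * b - c * d) = 0 := by
    intro a b c d
    rw [← ZMod.prime_pow_mul_eq_zero_iff hp hh]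
    ring_nf
  simp only [map_sub, map_mul] at key
  exact and_congr (key _ _ _ _) (and_congr (key _ _ _ _) (key _ _ _ _))

theorem RowPair.card_scaled_minorsVanish (hp : p.Prime) (hh : 2 * h < n) :
    Nat.card {t : RowPair (ZMod (p ^ n)) // t.MinorsVanish ∧
      (DvdCoords ((p : ZMod (p ^ n)) ^ h) t.1 ∧ DvdCoords ((p : ZMod (p ^ n)) ^ h) t.2) ∧
      ¬ (DvdCoords ((p : ZMod (p ^ n)) ^ (h + 1)) t.1 ∧
        DvdCoords ((p : ZMod (p ^ n)) ^ (h + 1)) t.2)} =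
    Nat.card {t : RowPair (ZMod (p ^ (n - 2 * h))) //
      t.MinorsVanish ∧ ¬ (DvdCoords (p : ZMod (p ^ (n - 2 * h))) t.1 ∧ DvdCoords ↑p t.2)} *
      p ^ (6 * h) := by
  let mulHom := AddMonoidHom.mulLeft ((p : RowPair (ZMod (p ^ n))) ^ h)
  let red := RowPair.map (ZMod.castHom (pow_dvd_pow p (Nat.sub_le n (2 * h)))
        (ZMod (p ^ (n - 2 * h))))
  let S : Set (RowPair (ZMod (p ^ n))) := {t | t.MinorsVanish ∧
      (DvdCoords ((p : ZMod (p ^ n)) ^ h) t.1 ∧ DvdCoords ((p : ZMod (p ^ n)) ^ h) t.2) ∧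
      ¬ (DvdCoords ((p : ZMod (p ^ n)) ^ (h + 1)) t.1 ∧
        DvdCoords ((p : ZMod (p ^ n)) ^ (h + 1)) t.2)}
  let P : Set (RowPair (ZMod (p ^ (n - 2 * h)))) := {t |
      t.MinorsVanish ∧ ¬ (DvdCoords (p : ZMod (p ^ (n - 2 * h))) t.1 ∧ DvdCoords ↑p t.2)}
  have hker : Nat.card mulHom.ker = p ^ (6 * h) := by
    rw [← RowPair.card_ker_map_castHom hp (show h ≤ n by omega)]
    refine Nat.card_congr (Equiv.subtypeEquivRight fun t => ?_)
    have key := ZMod.prime_pow_mul_eq_zero_iff hp (show h ≤ n by omega)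
    simp only [AddMonoidHom.mem_ker, Prod.ext_iff]
    exact and_congr (and_congr (key _) (and_congr (key _) (key _)))
      (and_congr (key _) (and_congr (key _) (key _)))
  have hS : S ⊆ Set.range mulHom := by
    rintro ⟨⟨_, _, _⟩, ⟨_, _, _⟩⟩ ⟨-, ⟨⟨⟨a, rfl⟩, ⟨b, rfl⟩, ⟨c, rfl⟩⟩, ⟨d, rfl⟩, ⟨e, rfl⟩, ⟨f, rfl⟩⟩, -⟩
    exact ⟨((a, b, c), (d, e, f)), rfl⟩
  have hSP : ∀ t, mulHom t ∈ S ↔ red t ∈ P := by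
    intro t
    have hm := RowPair.minorsVanish_prime_pow_mul_iff hp hh.le t
    have h1 := ZMod.prime_pow_succ_dvd_prime_pow_mul_iff hp (show h < n by omega)
    have h2 := ZMod.prime_dvd_castHom_iff (p := p) (Nat.sub_le n (2 * h)) (by omega)
    have h3 : ∀ x, _ := fun x => (h1 x).trans (h2 x).symm
    have hd : ∀ v : ZMod (p ^ n) × ZMod (p ^ n) × ZMod (p ^ n), DvdCoords ((p : ZMod (p ^ n)) ^ h)
        ((p : ZMod (p ^ n) × ZMod (p ^ n) × ZMod (p ^ n)) ^ h * v) := fun v =>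
      ⟨dvd_mul_right _ _, dvd_mul_right _ _, dvd_mul_right _ _⟩
    have hd' := and_congr (and_congr (h3 t.1.1) (and_congr (h3 t.1.2.1) (h3 t.1.2.2)))
      (and_congr (h3 t.2.1) (and_congr (h3 t.2.2.1) (h3 t.2.2.2)))
    exact and_congr hm ((and_iff_right ⟨hd t.1, hd t.2⟩).trans (not_congr hd'))
  have hcS := mulHom.card_preimage_eq_mul_card_ker S hS
  have hcP := red.toAddMonoidHom.card_preimage_eq_mul_card_ker P
    (fun t _ => RowPair.map_surjective (ZMod.castHom_surjective _) t)
  have hT : Nat.card {t // mulHom t ∈ S} = Nat.card {t // red.toAddMonoidHom t ∈ P} :=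
    Nat.card_congr (Equiv.subtypeEquivRight hSP)
  rw [hcS, hcP, hker, RowPair.card_ker_map_castHom hp hh.le] at hT
  refine Nat.eq_of_mul_eq_mul_right (pow_pos hp.pos (6 * h)) (hT.trans ?_)
  rw [mul_assoc, ← pow_add]
  congr 2
  ring

end Scaling

theorem nondegenerate_solutions_mod_p_pow (p : ℕ) (hp : p.Prime) (n : ℕ) (hn : 0 < n)
    (h : ℕ) (hh : 2 * h < n) :
    (Nat.card {t : (ZMod (p ^ n) × ZMod (p ^ n) × ZMod (p ^ n)) ×
        (ZMod (p ^ n) × ZMod (p ^ n) × ZMod (p ^ n)) //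
        t.1.1 * t.2.2.1 - t.1.2.1 * t.2.1 = 0 ∧
        t.1.1 * t.2.2.2 - t.1.2.2 * t.2.1 = 0 ∧
        t.1.2.1 * t.2.2.2 - t.1.2.2 * t.2.2.1 = 0 ∧
        min (nuZMod p n t.1.1) (min (nuZMod p n t.1.2.1) (min (nuZMod p n t.1.2.2)
          (min (nuZMod p n t.2.1) (min (nuZMod p n t.2.2.1) (nuZMod p n t.2.2.2))))) = h}
      : ℝ) =
      (p : ℝ) ^ (4 * n - 2 * h) * (1 + 1 / (p : ℝ)) * (1 - 1 / (p : ℝ) ^ 3) := by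
  have hp0 : (p : ℝ) ≠ 0 := by exact_mod_cast hp.ne_zero
  have hcard := RowPair.card_scaled_minorsVanish hp hh
  simp only [← min_nuZMod_eq_iff hp (show h < n by omega), RowPair.MinorsVanish, and_assoc]
    at hcard
  rw [hcard]
  obtain ⟨k, rfl⟩ : ∃ k, n = k + 1 + 2 * h := ⟨n - 2 * h - 1, by omega⟩
  have hprim := RowPair.card_primitive_minorsVanish_zmod hp k
  simp only [RowPair.MinorsVanish, and_assoc] at hprim
  rw [Nat.add_sub_cancel, Nat.cast_mul, hprim,
    show 4 * (k + 1 + 2 * h) - 2 * h = 4 * k + 6 * h + 4 by omega]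
  push_cast
  field_simp
  ring
end
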